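/- Let N ≥ 3, t > 0, τ > 0, and let A, B ⊆ ℝ be Borel sets. Then ∫∫ (Σ_{λ ∈ R(H), λ∈A} s_λ(H)) · (Σ_{μ ∈ R(H+D), μ∈B} s_μ(H+D)) dγ^N_t(H) dγ^N_τ(D) = ∫_A ∫_B ρ̃^{(N)}_{t,t+τ}(y,x) dx dy, where ρ̃^{(N)}_{t,t+τ}(y,x) = (2|S_{N−1}||S_{N−2}| / (t²(2π)^N)) ∫₀¹ dz (1−z²)^{(N−3)/2} (τ/t + 1−z²)^{−N/2} exp(−(x² − 2z²xy + y²(1+τ/t)) / (τ + t(1−z²))) · [ (x − y(1−z²)(t+τ)/(τ+t(1−z²))) (y − x(1−z²)t/(τ+t(1−z²))) E_{N−2}(2xy/t) + ((N−1)tτz²/(2(τ+t(1−z²)))) E_{N−2}(2xy/t) − ((N−2)tτz²/(2(τ+t(1−z²)))) (2xy/t) E_{N−3}(2xy/t) ]. (This is the paper's exact finite-N representation of the two-time modified density of real eigenvalues, reduced to a one-dimensional integral.) -/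

import Mathlib

open MeasureTheory Matrix Nat intervalIntegral
open scoped Classical

/-- The measurable space structure on real matrices (the product σ-algebra on entries). -/
noncomputable instance matrixMeasurableSpace (N : ℕ) :
    MeasurableSpace (Matrix (Fin N) (Fin N) ℝ) :=
  inferInstanceAs (MeasurableSpace (Fin N → Fin N → ℝ))

/-- `ginibre N s` is the Gaussian probability measure `γ^N_s` on `N×N` real matrices under
which the `N²` entries are i.i.d. centered Gaussians of variance `s/2`. -/
noncomputable def ginibre (N : ℕ) (s : ℝ) : Measure (Matrix (Fin N) (Fin N) ℝ) :=
  (Measure.pi fun _ : Fin N => Measure.pi fun _ : Fin N =>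
    ProbabilityTheory.gaussianReal 0 (Real.toNNReal (s / 2)) :
      Measure (Fin N → Fin N → ℝ))

/-- `spin x M = (-1)^{n_x(M)}` where `n_x(M)` is the number of real roots (with multiplicity)
of the characteristic polynomial of `M` that are `< x`. -/
noncomputable def spin {N : ℕ} (x : ℝ) (M : Matrix (Fin N) (Fin N) ℝ) : ℝ :=
  (-1 : ℝ) ^ Multiset.card (M.charpoly.roots.filter (fun r => r < x))

/-- The truncated exponential polynomial `E_n(u) = n! Σ_{k=0}^n u^k/k!`. -/
noncomputable def Epoly (n : ℕ) (u : ℝ) : ℝ :=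
  (n ! : ℝ) * ∑ k ∈ Finset.range (n + 1), u ^ k / (k ! : ℝ)

/-- `sphereArea n = |S_n| = 2π^{(n+1)/2}/Γ((n+1)/2)`, the surface area of the unit sphere
`S^n ⊂ ℝ^{n+1}`. -/
noncomputable def sphereArea (n : ℕ) : ℝ :=
  2 * Real.pi ^ (((n : ℝ) + 1) / 2) / Real.Gamma (((n : ℝ) + 1) / 2)

/-- The exact finite-`N` two-time modified density `ρ̃^{(N)}_{t,t+τ}(y,x)`, reduced to a
one-dimensional integral over `z ∈ [0,1]`. -/
noncomputable def rhoMod (N : ℕ) (t τ y x : ℝ) : ℝ :=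
  2 * sphereArea (N - 1) * sphereArea (N - 2) / (t ^ 2 * (2 * Real.pi) ^ N) *
    ∫ z in (0 : ℝ)..1,
      (1 - z ^ 2) ^ (((N : ℝ) - 3) / 2) * (τ / t + (1 - z ^ 2)) ^ (-(N : ℝ) / 2) *
        Real.exp (-(x ^ 2 - 2 * z ^ 2 * x * y + y ^ 2 * (1 + τ / t)) /
          (τ + t * (1 - z ^ 2))) *
        ((x - y * (1 - z ^ 2) * (t + τ) / (τ + t * (1 - z ^ 2))) *
            (y - x * (1 - z ^ 2) * t / (τ + t * (1 - z ^ 2))) * Epoly (N - 2) (2 * x * y / t) +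
          ((N : ℝ) - 1) * t * τ * z ^ 2 / (2 * (τ + t * (1 - z ^ 2))) *
            Epoly (N - 2) (2 * x * y / t) -
          ((N : ℝ) - 2) * t * τ * z ^ 2 / (2 * (τ + t * (1 - z ^ 2))) * (2 * x * y / t) *
            Epoly (N - 3) (2 * x * y / t))

open MeasureTheory Matrix Nat intervalIntegral
open scoped Classical

namespace MDR

lemma alt_sum (S : Finset ℝ) (a b : ℝ) (hab : a ≤ b) :
    ∑ l ∈ S.filter (fun l => l ∈ Set.Ico a b), (-1 : ℝ) ^ (S.filter (fun r => r < l)).card =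
      ((-1 : ℝ) ^ (S.filter (fun r => r < a)).card - (-1 : ℝ) ^ (S.filter (fun r => r < b)).card) / 2 := by
  induction S using Finset.induction_on_max with
  | empty => simp
  | insert m S hm ih =>
    have hmS : m ∉ S := fun h => lt_irrefl _ (hm m h)
    have key : ∀ l ∈ S, (insert m S).filter (fun r => r < l) = S.filter (fun r => r < l) := by
      intro l hl
      rw [Finset.filter_insert, if_neg (not_lt.2 (hm l hl).le)]
    have keym : (insert m S).filter (fun r => r < m) = S := by
      rw [Finset.filter_insert, if_neg (lt_irrefl _)]
      exact Finset.filter_true_of_mem hm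
    have hsum : ∑ l ∈ S.filter (fun l => l ∈ Set.Ico a b),
        (-1 : ℝ) ^ ((insert m S).filter (fun r => r < l)).card =
        ∑ l ∈ S.filter (fun l => l ∈ Set.Ico a b), (-1 : ℝ) ^ (S.filter (fun r => r < l)).card := by
      apply Finset.sum_congr rfl
      intro l hl
      rw [key l (Finset.mem_filter.1 hl).1]
    by_cases hma : m < a
    · have h1 : ∀ x ∈ S, x < a := fun x hx => (hm x hx).trans hma
      have h2 : ∀ x ∈ insert m S, x < a := by simpa [hma] using h1
      have h3 : ∀ x ∈ insert m S, x < b := fun x hx => (h2 x hx).trans_le hab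
      rw [Finset.filter_true_of_mem h2, Finset.filter_true_of_mem h3, Finset.filter_false_of_mem]
      · simp
      · intro x hx hx'
        exact absurd (h2 x hx) (not_lt.2 hx'.1)
    · by_cases hmb : m < b
      · have h3 : ∀ x ∈ S, x < b := fun x hx => (hm x hx).trans hmb
        have h4 : (insert m S).filter (fun r => r < b) = insert m S :=
          Finset.filter_true_of_mem (by simpa [hmb] using h3)
        have h5 : (insert m S).filter (fun r => r < a) = S.filter (fun r => r < a) := by
          rw [Finset.filter_insert, if_neg hma]
        have h6 : (insert m S).filter (fun l => l ∈ Set.Ico a b) =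
            insert m (S.filter (fun l => l ∈ Set.Ico a b)) := by
          rw [Finset.filter_insert, if_pos ⟨not_lt.1 hma, hmb⟩]
        rw [h6, Finset.sum_insert (by simp [hmS]), hsum, ih, keym, h4, h5,
          Finset.filter_true_of_mem h3, Finset.card_insert_of_notMem hmS]
        ring
      · have h4 : (insert m S).filter (fun r => r < b) = S.filter (fun r => r < b) := by
          rw [Finset.filter_insert, if_neg hmb]
        have h5 : (insert m S).filter (fun r => r < a) = S.filter (fun r => r < a) := by
          rw [Finset.filter_insert, if_neg hma]
        have h6 : (insert m S).filter (fun l => l ∈ Set.Ico a b) =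
            (S.filter (fun l => l ∈ Set.Ico a b)) := by
          rw [Finset.filter_insert, if_neg (fun h => hmb h.2)]
        rw [h6, hsum, ih, h4, h5]

/-- the alternating root sum -/
noncomputable def rs {N : ℕ} (A : Set ℝ) (M : Matrix (Fin N) (Fin N) ℝ) : ℝ :=
  (Multiset.map (fun l => spin l M) (Multiset.filter (fun l => l ∈ A) M.charpoly.roots)).sum

lemma rs_Ico {N : ℕ} (M : Matrix (Fin N) (Fin N) ℝ) (hM : M.charpoly.roots.Nodup) (a b : ℝ)
    (hab : a ≤ b) : rs (Set.Ico a b) M = (spin a M - spin b M) / 2 := by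
  have hS : M.charpoly.roots = (⟨M.charpoly.roots, hM⟩ : Finset ℝ).val := rfl
  have := alt_sum ⟨M.charpoly.roots, hM⟩ a b hab
  simpa [rs, spin, Finset.sum, Finset.card] using this

lemma pos_of_monic_no_root (q : Polynomial ℝ) (hq : q.Monic) (h : ∀ x, q.eval x ≠ 0) (x : ℝ) :
    0 < q.eval x := by
  by_contra hx
  have hx : q.eval x < 0 := lt_of_le_of_ne (not_lt.1 hx) (h x)
  have hdeg : 0 < q.degree := by
    by_contra hd
    have : q = 1 := by
      apply hq.natDegree_eq_zero.1
      exact Polynomial.natDegree_eq_zero_iff_degree_le_zero.2 (not_lt.1 hd)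
    rw [this] at hx
    simp at hx
    linarith
  have ht := q.tendsto_atTop_of_leadingCoeff_nonneg hdeg (by rw [hq.leadingCoeff]; exact zero_le_one)
  obtain ⟨y, hy1, hy2⟩ := ((ht.eventually_ge_atTop 0).and (Filter.eventually_ge_atTop x)).exists
  have := intermediate_value_Icc hy2 (q.continuous.continuousOn)
  obtain ⟨z, -, hz⟩ := this ⟨hx.le, hy1⟩
  exact h z hz

lemma sign_prod (R : Multiset ℝ) (a : ℝ) (h : ∀ r ∈ R, r ≠ a) :
    SignType.sign ((R.map (fun r => r - a)).prod) =
      (-1 : SignType) ^ Multiset.card (R.filter (fun r => r < a)) := by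
  induction R using Multiset.induction_on with
  | empty => simp
  | cons r R ih =>
    have ih := ih (fun r' hr' => h r' (Multiset.mem_cons_of_mem hr'))
    have hr := h r (Multiset.mem_cons_self _ _)
    rw [Multiset.map_cons, Multiset.prod_cons, sign_mul, ih]
    rcases lt_or_gt_of_ne hr with h1 | h1
    · rw [Multiset.filter_cons_of_pos (p := fun r => r < a) _ h1, Multiset.card_cons, pow_succ, sign_neg (by linarith)]
      rw [mul_comm]
    · rw [Multiset.filter_cons_of_neg (p := fun r => r < a) _ (not_lt.2 h1.le), sign_pos (by linarith), one_mul]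

lemma spin_eq {N : ℕ} (M : Matrix (Fin N) (Fin N) ℝ) (a : ℝ)
    (ha : (M - Matrix.scalar (Fin N) a).det ≠ 0) :
    spin a M = ((SignType.sign (M - Matrix.scalar (Fin N) a).det : SignType) : ℝ) := by
  obtain ⟨q, h1, h2, h3⟩ := Polynomial.exists_prod_multiset_X_sub_C_mul M.charpoly
  have hmon : M.charpoly.Monic := Matrix.charpoly_monic M
  have hq : q.Monic := by
    have h4 : ((M.charpoly.roots.map (fun a => Polynomial.X - Polynomial.C a)).prod).Monic :=
      Polynomial.monic_multiset_prod_of_monic _ _ (fun a _ => Polynomial.monic_X_sub_C a)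
    exact h4.of_mul_monic_left (by rw [h1]; exact hmon)
  have hq0 : ∀ x, q.eval x ≠ 0 := by
    intro x hx
    have : x ∈ q.roots := (Polynomial.mem_roots hq.ne_zero).2 hx
    rw [h3] at this
    simp at this
  have hqpos : 0 < (-1 : ℝ) ^ q.natDegree * q.eval a := by
    have := pos_of_monic_no_root _ hq.neg_one_pow_natDegree_mul_comp_neg_X (by
      intro x
      simp [Polynomial.eval_comp, hq0]) (-a)
    simpa [Polynomial.eval_comp] using this
  have hdet : (M - Matrix.scalar (Fin N) a).det = (-1) ^ N * M.charpoly.eval a := by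
    rw [Matrix.eval_charpoly, ← neg_sub, Matrix.det_neg, Fintype.card_fin]
  have hN : M.charpoly.natDegree = N := by simp [Matrix.charpoly_natDegree_eq_dim]
  have hev : M.charpoly.eval a = (M.charpoly.roots.map (fun r => a - r)).prod * q.eval a := by
    conv_lhs => rw [← h1]
    rw [Polynomial.eval_mul, Polynomial.eval_multiset_prod, Multiset.map_map]
    simp
  have hneg : (M.charpoly.roots.map (fun r => r - a)).prod =
      (-1) ^ Multiset.card M.charpoly.roots * (M.charpoly.roots.map (fun r => a - r)).prod := by
    have := Multiset.prod_map_neg (M.charpoly.roots.map (fun r => a - r))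
    rw [Multiset.map_map, Multiset.card_map] at this
    rw [← this]
    congr 1
    apply Multiset.map_congr rfl
    intro x _
    simp
  have hfin : (M - Matrix.scalar (Fin N) a).det =
      (M.charpoly.roots.map (fun r => r - a)).prod * ((-1 : ℝ) ^ q.natDegree * q.eval a) := by
    have h5 : (-1 : ℝ) ^ N = (-1) ^ Multiset.card M.charpoly.roots * (-1) ^ q.natDegree := by
      rw [← pow_add, h2, hN]
    rw [hdet, hev, hneg, h5]
    ring
  have hr : ∀ r ∈ M.charpoly.roots, r ≠ a := by
    rintro r hr rfl
    have := (Polynomial.mem_roots hmon.ne_zero).1 hr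
    rw [Polynomial.IsRoot] at this
    apply ha
    rw [hdet, this, mul_zero]
  rw [hfin, sign_mul, sign_pos hqpos, mul_one, sign_prod _ _ hr, spin]
  simp

end MDR

open MeasureTheory Matrix Nat intervalIntegral
open scoped Classical

namespace MDR

lemma null_of_rays {E : Type*} [NormedAddCommGroup E] [NormedSpace ℝ E] [MeasurableSpace E]
    [BorelSpace E] [FiniteDimensional ℝ E] (μ : Measure E) [μ.IsAddHaarMeasure] (Z : Set E)
    (hZ : MeasurableSet Z) (x0 : E) (h : ∀ x, {r : ℝ | x0 + r • x ∈ Z}.Finite) : μ Z = 0 := by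
  have h1 : (volume.prod μ) {p : ℝ × E | x0 + p.1 • p.2 ∈ Z} = 0 := by
    have hm : MeasurableSet {p : ℝ × E | x0 + p.1 • p.2 ∈ Z} :=
      hZ.preimage (by fun_prop)
    rw [Measure.prod_apply_symm hm]
    simp only [lintegral_eq_zero_iff' (measurable_measure_prodMk_right hm).aemeasurable]
    refine Filter.Eventually.of_forall fun x => ?_
    exact (h x).measure_zero volume
  have hm : MeasurableSet {p : ℝ × E | x0 + p.1 • p.2 ∈ Z} :=
      hZ.preimage (by fun_prop)
  rw [Measure.measure_prod_null hm] at h1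
  have h2 : ∀ᵐ r : ℝ, r ≠ 0 := by simp [ae_iff]
  obtain ⟨r, hr1, hr2⟩ := (h1.and h2).exists
  have h3 : (Prod.mk r ⁻¹' {p : ℝ × E | x0 + p.1 • p.2 ∈ Z}) = (fun x => r • x) ⁻¹' ((fun x => x0 + x) ⁻¹' Z) := by
    ext; simp
  beta_reduce at hr1
  rw [h3, Measure.addHaar_preimage_smul _ hr2, measure_preimage_add] at hr1
  simpa [hr2] using hr1

lemma null_mv {N : ℕ} (P : MvPolynomial (Fin N × Fin N) ℝ) (x0 : Fin N → Fin N → ℝ)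
    (h0 : MvPolynomial.eval (fun ij => x0 ij.1 ij.2) P ≠ 0) :
    ∀ᵐ M : Fin N → Fin N → ℝ, MvPolynomial.eval (fun ij => M ij.1 ij.2) P ≠ 0 := by
  rw [ae_iff]
  have hc : Continuous (fun M : Fin N → Fin N → ℝ => MvPolynomial.eval (fun ij : Fin N × Fin N => M ij.1 ij.2) P) :=
    (MvPolynomial.continuous_eval P).comp (by fun_prop)
  refine null_of_rays volume _ ?_ x0 ?_
  · simp only [not_not]
    exact (isClosed_singleton.preimage hc).measurableSet
  intro x
  set q : Polynomial ℝ := MvPolynomial.aeval (fun ij : Fin N × Fin N =>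
    Polynomial.C (x0 ij.1 ij.2) + Polynomial.X * Polynomial.C (x ij.1 ij.2)) P with hq
  have hev : ∀ r : ℝ, q.eval r = MvPolynomial.eval (fun ij => (x0 + r • x) ij.1 ij.2) P := by
    intro r
    rw [hq, ← Polynomial.coe_evalRingHom, MvPolynomial.map_aeval]
    rw [MvPolynomial.coe_eval₂Hom, ← MvPolynomial.eval₂_id]
    congr 1
    · ext; simp
    · ext; simp; ring
  have hq0 : q ≠ 0 := by
    intro h
    apply h0
    have := hev 0
    rw [h] at this
    simpa using this.symm
  refine (q.roots.toFinset.finite_toSet).subset ?_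
  intro r hr
  simp only [Set.mem_ofPred_eq, not_not] at hr
  simp only [Finset.mem_coe, Multiset.mem_toFinset]
  rw [Polynomial.mem_roots hq0, Polynomial.IsRoot, hev]
  exact hr

lemma univ_map {N : ℕ} (M : Fin N → Fin N → ℝ) :
    (Matrix.charpoly.univ ℝ (Fin N)).map (MvPolynomial.eval (fun ij : Fin N × Fin N => M ij.1 ij.2)) =
      (Matrix.of M).charpoly := by
  have := Matrix.charpoly.univ_map_eval₂Hom (n := Fin N) (RingHom.id ℝ) (fun ij => M ij.1 ij.2)
  exact this

lemma charpoly_dist {N : ℕ} (d : Fin N → ℝ) :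
    (Matrix.diagonal d).charpoly = ∏ i, (Polynomial.X - Polynomial.C (d i)) := by
  rw [Matrix.charpoly_diagonal]

lemma ae_det_ne {N : ℕ} (a : ℝ) :
    ∀ᵐ M : Fin N → Fin N → ℝ, (Matrix.of M - Matrix.scalar (Fin N) a).det ≠ 0 := by
  have key : ∀ M : Fin N → Fin N → ℝ, MvPolynomial.eval (fun ij : Fin N × Fin N => M ij.1 ij.2)
      ((Matrix.charpoly.univ ℝ (Fin N)).eval (MvPolynomial.C a)) = (Matrix.scalar (Fin N) a - Matrix.of M).det := by
    intro M
    rw [← Matrix.eval_charpoly, ← univ_map, Polynomial.eval_map, ← Polynomial.eval₂_hom]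
    simp
  have := null_mv ((Matrix.charpoly.univ ℝ (Fin N)).eval (MvPolynomial.C a))
    (fun i j => Matrix.diagonal (fun _ => a - 1) i j) (by
      rw [key (fun i j => Matrix.diagonal (fun _ => a - 1) i j)]
      have : Matrix.scalar (Fin N) a - Matrix.of (fun i j => Matrix.diagonal (fun _ => a - 1) i j) = 1 := by
        ext i j
        by_cases h : i = j <;> simp [h, Matrix.diagonal, Matrix.one_apply]
      rw [this]; simp)
  filter_upwards [this] with M hM
  rw [key] at hM
  rw [← neg_sub, Matrix.det_neg]
  exact mul_ne_zero (by simp) hM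

lemma ae_nodup {N : ℕ} :
    ∀ᵐ M : Fin N → Fin N → ℝ, (Matrix.of M).charpoly.roots.Nodup := by
  set u := Matrix.charpoly.univ ℝ (Fin N)
  have key : ∀ M : Fin N → Fin N → ℝ, MvPolynomial.eval (fun ij : Fin N × Fin N => M ij.1 ij.2)
      (u.resultant u.derivative N (N - 1)) =
      (Matrix.of M).charpoly.resultant (Matrix.of M).charpoly.derivative := by
    intro M
    have h1 : (Matrix.of M).charpoly.natDegree = N := by
      simp [Matrix.charpoly_natDegree_eq_dim]
    have h2 : (Matrix.of M).charpoly.derivative.natDegree = N - 1 := by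
      rw [Polynomial.natDegree_derivative, h1]
    rw [h1, h2, ← univ_map, Polynomial.derivative_map, Polynomial.resultant_map_map]
  have hsep : (Matrix.diagonal (fun i : Fin N => (i : ℝ))).charpoly.Separable := by
    rw [Matrix.charpoly_diagonal]
    apply Polynomial.separable_prod_X_sub_C_iff.2
    intro i j h
    simpa [Fin.ext_iff] using h
  have := null_mv (u.resultant u.derivative N (N - 1)) (fun i j => Matrix.diagonal (fun i : Fin N => (i : ℝ)) i j) (by
    rw [key (fun i j => Matrix.diagonal (fun i : Fin N => (i : ℝ)) i j)]
    exact Polynomial.resultant_ne_zero _ _ hsep)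
  filter_upwards [this] with M hM
  rw [key] at hM
  apply Polynomial.nodup_roots
  by_contra hns
  apply hM
  rw [Polynomial.resultant_eq_zero_iff]
  exact ⟨by left; exact (Matrix.charpoly_monic _).ne_zero, hns⟩

end MDR

open MeasureTheory Matrix Nat intervalIntegral
open scoped Classical

namespace MDR

/-- all moments finite -/
def AM {Ω : Type*} [MeasurableSpace Ω] (μ : Measure Ω) (f : Ω → ℝ) : Prop :=
  AEStronglyMeasurable f μ ∧ ∀ p : ℕ, Integrable (fun ω => |f ω| ^ p) μ

section
variable {Ω Ω' : Type*} [MeasurableSpace Ω] [MeasurableSpace Ω'] {μ : Measure Ω} {ν : Measure Ω'}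
  {f g : Ω → ℝ}

lemma AM.integrable (h : AM μ f) : Integrable f μ := by
  have := h.2 1
  simp only [pow_one] at this
  exact (integrable_norm_iff h.1).1 this

lemma AM.mul (hf : AM μ f) (hg : AM μ g) : AM μ (fun ω => f ω * g ω) := by
  refine ⟨hf.1.mul hg.1, fun p => ?_⟩
  refine ((hf.2 (2*p)).add (hg.2 (2*p))).mono' ?_ ?_
  · exact (((hf.1.mul hg.1).norm).pow p)
  · refine Filter.Eventually.of_forall fun ω => ?_
    simp only [Real.norm_eq_abs, abs_pow, abs_abs, abs_mul, mul_pow, Pi.add_apply, pow_mul']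
    nlinarith [sq_nonneg (|f ω| ^ p - |g ω| ^ p), sq_nonneg (|f ω| ^ p), sq_nonneg (|g ω| ^ p)]

lemma AM.add (hf : AM μ f) (hg : AM μ g) : AM μ (fun ω => f ω + g ω) := by
  refine ⟨hf.1.add hg.1, fun p => ?_⟩
  refine (((hf.2 p).add (hg.2 p)).const_mul (2^p)).mono' ?_ ?_
  · exact (((hf.1.add hg.1).norm).pow p)
  · refine Filter.Eventually.of_forall fun ω => ?_
    simp only [Real.norm_eq_abs, abs_pow, abs_abs, Pi.add_apply]
    have h1 : |f ω + g ω| ≤ 2 * max |f ω| |g ω| := by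
      have := abs_add_le (f ω) (g ω)
      have := le_max_left |f ω| |g ω|
      have := le_max_right |f ω| |g ω|
      linarith
    calc |f ω + g ω| ^ p ≤ (2 * max |f ω| |g ω|) ^ p := by gcongr
      _ = 2 ^ p * (max |f ω| |g ω|) ^ p := by rw [mul_pow]
      _ ≤ _ := by
        gcongr
        rcases max_cases |f ω| |g ω| with ⟨h, _⟩ | ⟨h, _⟩ <;> rw [h]
        · have : 0 ≤ |g ω| ^ p := by positivity
          linarith
        · have : 0 ≤ |f ω| ^ p := by positivity
          linarith

lemma AM.of_bdd [IsFiniteMeasure μ] (hf : AEStronglyMeasurable f μ) (C : ℝ) (h : ∀ᵐ ω ∂μ, |f ω| ≤ C) :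
    AM μ f := by
  refine ⟨hf, fun p => ?_⟩
  refine (integrable_const (C ^ p)).mono' (hf.norm.pow p) ?_
  filter_upwards [h] with ω hω
  simp only [Real.norm_eq_abs, abs_pow, abs_abs]
  gcongr

lemma AM.const [IsFiniteMeasure μ] (c : ℝ) : AM μ (fun _ => c) :=
  AM.of_bdd aestronglyMeasurable_const |c| (by simp)

lemma AM.neg (hf : AM μ f) : AM μ (fun ω => - f ω) :=
  ⟨hf.1.neg, fun p => by simpa using hf.2 p⟩

lemma AM.sub (hf : AM μ f) (hg : AM μ g) : AM μ (fun ω => f ω - g ω) := by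
  simpa [sub_eq_add_neg] using hf.add hg.neg

lemma AM.sum [IsFiniteMeasure μ] {ι : Type*} (s : Finset ι) {F : ι → Ω → ℝ} (h : ∀ i ∈ s, AM μ (F i)) :
    AM μ (fun ω => ∑ i ∈ s, F i ω) := by
  induction s using Finset.induction_on with
  | empty => simpa using AM.const 0
  | insert a s ha ih =>
    simp only [Finset.sum_insert ha]
    exact (h a (by simp)).add (ih fun i hi => h i (by simp [hi]))

lemma AM.prod [IsFiniteMeasure μ] {ι : Type*} (s : Finset ι) {F : ι → Ω → ℝ} (h : ∀ i ∈ s, AM μ (F i)) :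
    AM μ (fun ω => ∏ i ∈ s, F i ω) := by
  induction s using Finset.induction_on with
  | empty => simpa using AM.const 1
  | insert a s ha ih =>
    simp only [Finset.prod_insert ha]
    exact (h a (by simp)).mul (ih fun i hi => h i (by simp [hi]))

lemma AM.pow [IsFiniteMeasure μ] (hf : AM μ f) (k : ℕ) : AM μ (fun ω => f ω ^ k) := by
  have := AM.prod (μ := μ) (Finset.range k) (F := fun _ => f) (fun _ _ => hf)
  simpa using this

lemma AM.fst [IsFiniteMeasure ν] (hf : AM μ f) : AM (μ.prod ν) (fun ω => f ω.1) :=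
  ⟨hf.1.comp_fst, fun p => (hf.2 p).comp_fst ν⟩

lemma AM.snd [SFinite μ] [SFinite ν] [IsFiniteMeasure μ] {f : Ω' → ℝ} (hf : AM ν f) :
    AM (μ.prod ν) (fun ω => f ω.2) :=
  ⟨hf.1.comp_snd, fun p => (hf.2 p).comp_snd μ⟩

lemma AM.comp {T : Ω' → Ω} (hf : AM μ f) (hT : MeasurePreserving T ν μ) : AM ν (fun ω => f (T ω)) :=
  ⟨hf.1.comp_measurePreserving hT, fun p => hT.integrable_comp_of_integrable (hf.2 p)⟩

lemma AM.det [IsFiniteMeasure μ] {ι : Type*} [Fintype ι] [DecidableEq ι] {F : Ω → Matrix ι ι ℝ}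
    (h : ∀ i j, AM μ (fun ω => F ω i j)) : AM μ (fun ω => (F ω).det) := by
  simp only [Matrix.det_apply']
  exact AM.sum _ fun σ _ => (AM.const _).mul (AM.prod _ fun i _ => h _ _)

lemma AM.dotProduct [IsFiniteMeasure μ] {ι : Type*} [Fintype ι] {u v : Ω → ι → ℝ}
    (hu : ∀ i, AM μ (fun ω => u ω i)) (hv : ∀ i, AM μ (fun ω => v ω i)) :
    AM μ (fun ω => u ω ⬝ᵥ v ω) := by
  simp only [_root_.dotProduct]
  exact AM.sum _ fun i _ => (hu i).mul (hv i)

lemma AM.mulVec [IsFiniteMeasure μ] {ι : Type*} [Fintype ι] {F : Ω → Matrix ι ι ℝ} {v : Ω → ι → ℝ}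
    (h : ∀ i j, AM μ (fun ω => F ω i j)) (hv : ∀ i, AM μ (fun ω => v ω i)) (i : ι) :
    AM μ (fun ω => (F ω *ᵥ v ω) i) := by
  simp only [Matrix.mulVec]
  exact AM.dotProduct (h i) hv

lemma AM.adj [IsFiniteMeasure μ] {ι : Type*} [Fintype ι] [DecidableEq ι] {F : Ω → Matrix ι ι ℝ}
    (h : ∀ i j, AM μ (fun ω => F ω i j)) (i j : ι) : AM μ (fun ω => (F ω).adjugate i j) := by
  simp only [Matrix.adjugate_apply]
  apply AM.det
  intro a b
  simp only [Matrix.updateRow_apply]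
  by_cases ha : a = j
  · simp only [ha, if_true]; exact AM.const _
  · simp only [ha, if_false]; exact h a b

end

lemma AM.gauss (v : NNReal) : AM (ProbabilityTheory.gaussianReal 0 v) (fun x => x) := by
  refine ⟨aestronglyMeasurable_id, fun p => ?_⟩
  have := (ProbabilityTheory.memLp_id_gaussianReal (μ := 0) (v := v) (p : NNReal))
  by_cases hp : p = 0
  · simp [hp]
  have := this.integrable_norm_rpow (by simp [hp]) (by simp)
  simpa using this

lemma AM.pi {ι : Type*} [Fintype ι] {α : Type*} [MeasurableSpace α] (μ : ι → Measure α)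
    [∀ i, IsProbabilityMeasure (μ i)] (i : ι) {f : α → ℝ} (h : AM (μ i) f) :
    AM (Measure.pi μ) (fun x => f (x i)) :=
  h.comp (measurePreserving_eval μ i)

/-- gaussian measure on vectors -/
noncomputable def gv (ι : Type*) [Fintype ι] (s : ℝ) : Measure (ι → ℝ) :=
  Measure.pi fun _ : ι => ProbabilityTheory.gaussianReal 0 (Real.toNNReal (s / 2))

noncomputable def gm (N : ℕ) (s : ℝ) : Measure (Fin N → Fin N → ℝ) :=
  Measure.pi fun _ : Fin N => gv (Fin N) s

instance (ι : Type*) [Fintype ι] (s : ℝ) : IsProbabilityMeasure (gv ι s) := by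
  unfold gv; infer_instance
instance (N : ℕ) (s : ℝ) : IsProbabilityMeasure (gm N s) := by
  unfold gm; infer_instance

lemma AM.gv {ι : Type*} [Fintype ι] (s : ℝ) (i : ι) : AM (gv ι s) (fun x => x i) :=
  AM.pi (fun _ : ι => ProbabilityTheory.gaussianReal 0 (Real.toNNReal (s / 2))) i (AM.gauss _)
lemma AM.gm {N : ℕ} (s : ℝ) (i j : Fin N) : AM (gm N s) (fun x => x i j) :=
  AM.pi (fun _ : Fin N => MDR.gv (Fin N) s) i (AM.gv s j)

end MDR

open MeasureTheory Matrix Nat intervalIntegral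
open scoped Classical

namespace MDR

lemma gv_charFun {ι : Type*} [Fintype ι] (s : ℝ) (t : EuclideanSpace ℝ ι) :
    charFun ((gv ι s).map (WithLp.toLp 2)) t = Complex.exp (-(Real.toNNReal (s/2) : ℝ) * ((∑ i, t i ^ 2 : ℝ) : ℂ) / 2) := by
  unfold gv
  rw [charFun_pi]
  simp_rw [ProbabilityTheory.charFun_gaussianReal, ← Complex.exp_sum]
  congr 1
  push_cast
  simp only [Finset.mul_sum, Finset.sum_div, neg_mul, neg_div, Finset.sum_neg_distrib]
  simp

lemma gv_rot {ι : Type*} [Fintype ι] [DecidableEq ι] (s : ℝ) (O : Matrix ι ι ℝ) (hO : O * Oᵀ = 1) :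
    MeasurePreserving (fun v => O *ᵥ v) (gv ι s) (gv ι s) := by
  have hm : Measurable (fun v : ι → ℝ => O *ᵥ v) := by
    have : Continuous (fun v : ι → ℝ => O *ᵥ v) := by fun_prop
    exact this.measurable
  have hm2 : Measurable (WithLp.toLp 2 : (ι → ℝ) → EuclideanSpace ℝ ι) := by fun_prop
  refine ⟨hm, ?_⟩
  apply (MeasurableEquiv.toLp 2 (ι → ℝ)).map_measurableEquiv_injective
  change Measure.map (WithLp.toLp 2) _ = Measure.map (WithLp.toLp 2) _
  apply Measure.ext_of_charFun (E := EuclideanSpace ℝ ι)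
  ext t
  have h1 : charFun (Measure.map (WithLp.toLp 2) (Measure.map (fun v => O *ᵥ v) (gv ι s))) t =
     charFun ((gv ι s).map (WithLp.toLp 2)) (WithLp.toLp 2 (Oᵀ *ᵥ t.ofLp)) := by
    rw [Measure.map_map hm2 hm, charFun_apply, charFun_apply, integral_map, integral_map]
    · congr 1
      ext v
      congr 3
      simp only [Function.comp]
      rw [EuclideanSpace.inner_eq_star_dotProduct, EuclideanSpace.inner_eq_star_dotProduct]
      simp only [star_trivial]
      rw [Matrix.dotProduct_mulVec, Matrix.mulVec_transpose]
    · exact hm2.aemeasurable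
    · exact Measurable.aestronglyMeasurable (by fun_prop)
    · exact (hm2.comp hm).aemeasurable
    · exact Measurable.aestronglyMeasurable (by fun_prop)
  rw [h1, gv_charFun, gv_charFun]
  congr 4
  have : ∀ x : ι → ℝ, ∑ i, x i ^ 2 = x ⬝ᵥ x := by intro x; simp [dotProduct, sq]
  rw [this, this]
  rw [Matrix.dotProduct_mulVec, Matrix.vecMul_transpose, Matrix.mulVec_mulVec, hO, Matrix.one_mulVec]

lemma gm_transpose {N : ℕ} (s : ℝ) :
    MeasurePreserving (fun M : Fin N → Fin N → ℝ => fun i j => M j i) (gm N s) (gm N s) := by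
  have hm : Measurable (fun M : Fin N → Fin N → ℝ => fun i j => M j i) := by fun_prop
  refine ⟨hm, ?_⟩
  set g := ProbabilityTheory.gaussianReal 0 (Real.toNNReal (s / 2))
  have h0 : gm N s = (Measure.pi fun _ : Fin N × Fin N => g).map (MeasurableEquiv.curry (Fin N) (Fin N) ℝ) := by
    have := Measure.infinitePi_map_curry (fun _ _ : Fin N => g)
    simp only [Measure.infinitePi_eq_pi] at this
    rw [this]; rfl
  have h1 := (measurePreserving_piCongrLeft (fun _ : Fin N × Fin N => g) (Equiv.prodComm (Fin N) (Fin N))).map_eq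
  rw [h0]
  conv_rhs => rw [← h1]
  rw [Measure.map_map hm (by fun_prop), Measure.map_map (by fun_prop) (by fun_prop)]
  congr 1

lemma gm_mul_left {N : ℕ} (s : ℝ) (O : Matrix (Fin N) (Fin N) ℝ) (hO : O * Oᵀ = 1) :
    MeasurePreserving (fun M : Fin N → Fin N → ℝ => fun i => O *ᵥ (M i)) (gm N s) (gm N s) := by
  unfold gm
  exact measurePreserving_pi _ _ (fun _ => gv_rot s O hO)

lemma gm_conj {N : ℕ} (s : ℝ) (O : Matrix (Fin N) (Fin N) ℝ) (hO : O * Oᵀ = 1) :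
    MeasurePreserving (fun M : Fin N → Fin N → ℝ => (fun i j => (Oᵀ * Matrix.of M * O) i j)) (gm N s) (gm N s) := by
  have hO' : Oᵀ * Oᵀᵀ = 1 := by rw [Matrix.transpose_transpose]; exact mul_eq_one_comm.1 hO
  have := (gm_transpose s).comp ((gm_mul_left s _ hO').comp ((gm_transpose s).comp (gm_mul_left s _ hO')))
  convert this using 1
  ext M i j
  simp only [Function.comp, Matrix.mul_apply, Matrix.mulVec, dotProduct, Matrix.transpose_apply, Matrix.of_apply]
  simp only [Finset.sum_mul, Finset.mul_sum]
  refine Finset.sum_comm.trans (Finset.sum_congr rfl fun a _ => Finset.sum_congr rfl fun b _ => by ring)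

end MDR

open MeasureTheory Matrix Nat intervalIntegral
open scoped Classical

namespace MDR

lemma detB : ∀ {n : ℕ} (M : Matrix (Fin (n+2)) (Fin (n+2)) ℝ) (c : Fin n → ℝ)
    (_ : ∀ l j, M (Fin.succ (Fin.succ l)) j = if j = l.succ.succ then c l else 0),
    M.det = (M 0 0 * M 1 1 - M 0 1 * M 1 0) * ∏ l, c l
  | 0, M, c, h => by simp [Matrix.det_fin_two]
  | n+1, M, c, h => by
    rw [Matrix.det_succ_row M (Fin.last _), Finset.sum_eq_single (Fin.last _)]
    · have e1 : (Fin.last (n+2)) = Fin.succ (Fin.succ (Fin.last n)) := rfl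
      rw [Fin.succAbove_last, Fin.prod_univ_castSucc]
      rw [detB (M.submatrix Fin.castSucc Fin.castSucc) (fun l => c l.castSucc)]
      · conv_lhs => rw [e1, h]
        have e0 : M.submatrix Fin.castSucc Fin.castSucc 0 0 = M 0 0 := rfl
        have e2 : M.submatrix Fin.castSucc Fin.castSucc 1 1 = M 1 1 := rfl
        have e3 : M.submatrix Fin.castSucc Fin.castSucc 0 1 = M 0 1 := rfl
        have e4 : M.submatrix Fin.castSucc Fin.castSucc 1 0 = M 1 0 := rfl
        rw [e0, e2, e3, e4]
        simp only [if_true]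
        rw [Even.neg_one_pow ⟨_, rfl⟩]
        ring
      · intro l j
        have := h l.castSucc j.castSucc
        simp only [Matrix.submatrix_apply]
        rw [← Fin.succ_castSucc, ← Fin.succ_castSucc] at *
        rw [this]
        simp only [Fin.succ_castSucc, Fin.castSucc_inj]
    · intro j _ hj
      have e1 : (Fin.last (n+2)) = Fin.succ (Fin.succ (Fin.last n)) := rfl
      rw [e1, h, if_neg (by rw [← e1]; exact hj)]
      simp
    · simp

lemma sumB {n : ℕ} (e w : Fin (n+2) → ℝ) (W : Fin (n+2) → Fin (n+2) → ℝ) (c : Fin n → Fin (n+2) → ℝ) :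
    ∑ σ : Equiv.Perm (Fin (n+2)), ∑ π : Equiv.Perm (Fin (n+2)),
      ((Equiv.Perm.sign σ : ℤ) : ℝ) * ((Equiv.Perm.sign π : ℤ) : ℝ) * (e (σ 0) * w (π 0)) * W (σ 1) (π 1) *
        ∏ l : Fin n, (if σ l.succ.succ = π l.succ.succ then c l (σ l.succ.succ) else 0) =
    ∑ σ : Equiv.Perm (Fin (n+2)), e (σ 0) * (w (σ 0) * W (σ 1) (σ 1) - w (σ 1) * W (σ 1) (σ 0)) *
       ∏ l : Fin n, c l (σ l.succ.succ) := by
  refine Finset.sum_congr rfl fun σ _ => ?_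
  have := detB (Matrix.of (fun l j : Fin (n+2) => Fin.cases (w (σ j)) (fun l' => Fin.cases (W (σ 1) (σ j))
    (fun l'' => if j = l''.succ.succ then c l'' (σ l''.succ.succ) else 0) l') l)) (fun l => c l (σ l.succ.succ)) (by
      intro l j; simp)
  rw [← Matrix.det_transpose, Matrix.det_apply'] at this
  have h1 : (1 : Fin (n+2)) = Fin.succ 0 := rfl
  rw [h1] at this ⊢
  simp only [Matrix.of_apply, Fin.cases_zero, Fin.cases_succ, Matrix.transpose_apply] at this
  rw [mul_assoc, ← this, Finset.mul_sum]
  rw [← Equiv.sum_comp (Equiv.mulLeft σ)]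
  refine Finset.sum_congr rfl fun ρ _ => ?_
  rw [Fin.prod_univ_succ, Fin.prod_univ_succ]
  simp only [Fin.cases_zero, Fin.cases_succ, Equiv.coe_mulLeft, Equiv.Perm.sign_mul, Equiv.Perm.mul_apply, Units.val_mul, Int.cast_mul,
    EmbeddingLike.apply_eq_iff_eq]
  have h2 : ((Equiv.Perm.sign σ : ℤ) : ℝ) * ((Equiv.Perm.sign σ : ℤ) : ℝ) = 1 := by
    rcases Int.units_eq_one_or (Equiv.Perm.sign σ) with h | h <;> simp [h]
  have h3 : (∏ l : Fin n, if l.succ.succ = ρ l.succ.succ then c l (σ l.succ.succ) else 0) =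
     (∏ l : Fin n, if ρ l.succ.succ = l.succ.succ then c l (σ l.succ.succ) else 0) := by
    refine Finset.prod_congr rfl fun l _ => ?_
    simp only [eq_comm]
  rw [h3]
  linear_combination (e (σ 0) * ((Equiv.Perm.sign ρ : ℤ) : ℝ) * w (σ (ρ 0)) * W (σ (Fin.succ 0)) (σ (ρ (Fin.succ 0))) *
    (∏ l : Fin n, if ρ l.succ.succ = l.succ.succ then c l (σ l.succ.succ) else 0)) * h2

lemma card_fix {n : ℕ} (S : Finset (Fin n)) :
    ∑ e : Equiv.Perm (Fin n), (if ∀ i ∈ S, e i = i then (1:ℝ) else 0) = ((n - S.card)! : ℝ) := by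
  rw [Finset.sum_boole]
  norm_cast
  have h := Fintype.card_congr (Equiv.Perm.subtypeEquivSubtypePerm (fun i : Fin n => i ∉ S))
  rw [Fintype.card_perm] at h
  have h2 : Fintype.card {i // i ∉ S} = n - S.card := by
    rw [Fintype.card_subtype_compl]; simp
  rw [h2] at h
  rw [h, Fintype.card_subtype]
  simp

lemma perm_sum {n : ℕ} (s : ℝ) (x : Fin n → ℝ) :
    ∑ e : Equiv.Perm (Fin n), ∏ l, (s + if e l = l then x l else 0) =
      ∑ S ∈ (Finset.univ : Finset (Fin n)).powerset, (∏ l ∈ S, x l) * (s ^ (n - S.card) * ((n - S.card)! : ℝ)) := by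
  simp_rw [add_comm s]
  simp_rw [Finset.prod_add]
  rw [Finset.sum_comm]
  refine Finset.sum_congr rfl fun S _ => ?_
  rw [← card_fix S, Finset.mul_sum, Finset.mul_sum]
  refine Finset.sum_congr rfl fun e _ => ?_
  rw [Finset.prod_ite_zero]
  simp only [Finset.prod_const]
  rw [Finset.card_sdiff_of_subset (Finset.subset_univ _)]
  simp only [Finset.card_univ, Fintype.card_fin]
  split_ifs <;> simp

lemma Ppoly (n : ℕ) (s q : ℝ) (hs : s ≠ 0) :
    ∑ k ∈ Finset.range (n+1), (n.choose k : ℝ) * (q ^ k * (s ^ (n - k) * ((n-k)! : ℝ))) = s ^ n * Epoly n (q / s) := by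
  unfold Epoly
  rw [Finset.mul_sum, Finset.mul_sum]
  refine Finset.sum_congr rfl fun k hk => ?_
  have hk : k ≤ n := by simpa [Nat.lt_succ_iff] using hk
  have := Nat.choose_mul_factorial_mul_factorial hk
  have h2 : (n.choose k : ℝ) * k ! * (n-k)! = n ! := by exact_mod_cast this
  have hk0 : (k ! : ℝ) ≠ 0 := by positivity
  rw [← h2, div_pow, pow_sub₀ s hs hk]
  field_simp

lemma perm_P {n : ℕ} (s q : ℝ) (hs : s ≠ 0) :
    ∑ e : Equiv.Perm (Fin n), ∏ l, (s + if e l = l then q else 0) = s ^ n * Epoly n (q / s) := by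
  rw [perm_sum s (fun _ => q), ← Ppoly n s q hs]
  simp only [Finset.prod_const]
  rw [Finset.sum_powerset_apply_card (fun k => q ^ k * (s ^ (n - k) * ((n - k)! : ℝ)))]
  simp

lemma perm_Q {n : ℕ} (s q : ℝ) (hs : s ≠ 0) (j : Fin (n+1)) :
    ∑ e : Equiv.Perm (Fin (n+1)), ∏ l, (s + if e l = l then (if l = j then 0 else q) else 0) =
      s ^ (n+1) * Epoly (n+1) (q / s) - q * (s ^ n * Epoly n (q / s)) := by
  rw [← perm_P s q hs, ← Ppoly n s q hs, perm_sum, perm_sum]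
  rw [eq_sub_iff_add_eq]
  have hj : (Finset.univ : Finset (Fin (n+1))) = insert j (Finset.univ.erase j) := by simp
  rw [hj, Finset.sum_powerset_insert (by simp), Finset.sum_powerset_insert (by simp)]
  have h1 : ∀ S ∈ (Finset.univ.erase j).powerset, (∏ l ∈ insert j S, if l = j then (0:ℝ) else q) = 0 := by
    intro S _
    apply Finset.prod_eq_zero (Finset.mem_insert_self j S); simp
  have h2 : ∀ S ∈ (Finset.univ.erase j).powerset, (∏ l ∈ S, if l = j then (0:ℝ) else q) = ∏ l ∈ S, q := by
    intro S hS
    refine Finset.prod_congr rfl fun l hl => ?_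
    have := Finset.mem_powerset.1 hS hl
    simp only [Finset.mem_erase] at this
    simp [this.1]
  rw [Finset.sum_congr (rfl : (Finset.univ.erase j).powerset = _) (fun S hS => by rw [h2 S hS])]
  rw [Finset.sum_eq_zero (s := (Finset.univ.erase j).powerset) (f := fun t => (∏ l ∈ insert j t, if l = j then 0 else q) * _) (fun S hS => by rw [h1 S hS, zero_mul])]
  simp only [Finset.prod_const, add_zero]
  congr 1
  have h3 : ∀ S ∈ (Finset.univ.erase j).powerset, q ^ (insert j S).card * (s ^ (n + 1 - (insert j S).card) * ((n + 1 - (insert j S).card)! : ℝ)) =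
     q * (q ^ S.card * (s ^ (n - S.card) * ((n - S.card)! : ℝ))) := by
    intro S hS
    have : j ∉ S := fun h => by simpa using Finset.mem_powerset.1 hS h
    rw [Finset.card_insert_of_notMem this, Nat.add_sub_add_right, pow_succ]
    ring
  rw [Finset.sum_congr rfl h3, ← Finset.mul_sum,
    Finset.sum_powerset_apply_card (fun k => q ^ k * (s ^ (n - k) * ((n - k)! : ℝ)))]
  simp

lemma sum_fix0 {m : ℕ} (F : Equiv.Perm (Fin (m+1)) → ℝ) :
    ∑ σ : Equiv.Perm (Fin (m+1)), F σ = ∑ p : Fin (m+1), ∑ e : Equiv.Perm (Fin m), F (Equiv.Perm.decomposeFin.symm (p, e)) := by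
  rw [← Equiv.sum_comp Equiv.Perm.decomposeFin.symm, Fintype.sum_prod_type]

/-- combinatorial core -/
lemma beta {m : ℕ} (z z' s q : ℝ) (hs : s ≠ 0) (w : Fin (m+3) → ℝ) (hw0 : w 0 = z) (hw1 : w 1 = z')
    (hw2 : ∀ l : Fin (m+1), w l.succ.succ = 0)
    (W : Fin (m+3) → Fin (m+3) → ℝ) :
    ∑ σ : Equiv.Perm (Fin (m+3)), ∑ π : Equiv.Perm (Fin (m+3)),
      ((Equiv.Perm.sign σ : ℤ) : ℝ) * ((Equiv.Perm.sign π : ℤ) : ℝ) * ((if σ 0 = 0 then 1 else 0) * w (π 0)) * W (σ 1) (π 1) *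
        ∏ l : Fin (m+1), (if σ l.succ.succ = π l.succ.succ then (s + if σ l.succ.succ = l.succ.succ then q else 0) else 0) =
     s ^ (m+1) * Epoly (m+1) (q / s) * (z * W 1 1 - z' * W 1 0) +
     (s ^ (m+1) * Epoly (m+1) (q / s) - q * (s ^ m * Epoly m (q / s))) * (z * ∑ j : Fin (m+1), W j.succ.succ j.succ.succ) := by
  have h := sumB (n := m+1) (fun i => if i = 0 then 1 else 0) w W (fun l i => s + if i = l.succ.succ then q else 0)
  refine h.trans ?_
  rw [sum_fix0, Fin.sum_univ_succ]
  have hz : ∀ p : Fin (m+2), ∑ e : Equiv.Perm (Fin (m+2)), (if (Equiv.Perm.decomposeFin.symm (p.succ, e)) 0 = 0 then (1:ℝ) else 0) *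
          (w ((Equiv.Perm.decomposeFin.symm (p.succ, e)) 0) *
              W ((Equiv.Perm.decomposeFin.symm (p.succ, e)) 1) ((Equiv.Perm.decomposeFin.symm (p.succ, e)) 1) -
            w ((Equiv.Perm.decomposeFin.symm (p.succ, e)) 1) *
              W ((Equiv.Perm.decomposeFin.symm (p.succ, e)) 1) ((Equiv.Perm.decomposeFin.symm (p.succ, e)) 0)) *
        ∏ l : Fin (m+1), (s + if (Equiv.Perm.decomposeFin.symm (p.succ, e)) l.succ.succ = l.succ.succ then q else 0) = 0 := by
    intro p
    refine Finset.sum_eq_zero fun e _ => ?_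
    rw [Equiv.Perm.decomposeFin_symm_apply_zero]
    simp
  rw [Finset.sum_eq_zero (fun p _ => hz p), add_zero]
  have h1 : (1 : Fin (m+3)) = Fin.succ 0 := rfl
  have hw1' : w (Fin.succ 0) = z' := hw1
  rw [h1]
  simp only [Equiv.Perm.decomposeFin_symm_apply_zero, Equiv.Perm.decomposeFin_symm_apply_succ, Equiv.swap_self,
    Equiv.refl_apply, if_true, one_mul, hw0]
  rw [sum_fix0, Fin.sum_univ_succ]
  congr 1
  · simp only [Equiv.Perm.decomposeFin_symm_apply_zero, Equiv.Perm.decomposeFin_symm_apply_succ, Equiv.swap_self,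
      Equiv.refl_apply, Fin.succ_inj, hw1']
    rw [← Finset.mul_sum, perm_P s q hs]
    ring
  · rw [Finset.mul_sum, Finset.mul_sum]
    refine Finset.sum_congr rfl fun j _ => ?_
    simp only [Equiv.Perm.decomposeFin_symm_apply_zero, Equiv.Perm.decomposeFin_symm_apply_succ, hw2]
    rw [← perm_Q s q hs j, Finset.sum_mul]
    refine Finset.sum_congr rfl fun e _ => ?_
    rw [zero_mul, sub_zero, mul_comm]
    congr 1
    refine Finset.prod_congr rfl fun l _ => ?_
    congr 1
    by_cases hl : e l = j
    · rw [hl, Equiv.swap_apply_right]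
      have h0 : ¬ ((0 : Fin (m+2)).succ = l.succ.succ) := by
        rw [Fin.succ_inj]; exact (Fin.succ_ne_zero l).symm
      rw [if_neg h0]
      by_cases hjl : j = l
      · rw [if_pos hjl, if_pos hjl.symm]
      · rw [if_neg hjl]
    · rw [Equiv.swap_apply_of_ne_of_ne (by simp) (by simpa using hl)]
      by_cases hjl : e l = l
      · have : l ≠ j := fun h => hl (hjl.trans h)
        simp [hjl, this]
      · simp [hjl]

end MDR

open MeasureTheory Matrix Nat intervalIntegral
open scoped Classical

namespace MDR
open ProbabilityTheory

/-- centered gaussian of variance s/2 -/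
noncomputable abbrev gr (s : ℝ) : Measure ℝ := gaussianReal 0 (Real.toNNReal (s / 2))
noncomputable def ph (s x : ℝ) : ℝ := (√(Real.pi * s))⁻¹ * Real.exp (-x ^ 2 / s)

lemma ph_eq {s : ℝ} (hs : 0 < s) (x : ℝ) : gaussianPDFReal 0 (Real.toNNReal (s/2)) x = ph s x := by
  rw [gaussianPDFReal_def, ph]
  simp only [sub_zero]
  rw [Real.coe_toNNReal _ (by positivity)]
  congr 3
  · ring
  · field_simp

lemma ph_nonneg (s x : ℝ) : 0 ≤ ph s x := by unfold ph; positivity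

lemma ph_cont (s : ℝ) : Continuous (ph s) := by unfold ph; fun_prop

lemma ph_le {s : ℝ} (hs : 0 < s) (x : ℝ) : ph s x * (1 + |x|) ≤ (√(Real.pi * s))⁻¹ * (2 + s) := by
  unfold ph
  rw [mul_assoc]
  refine mul_le_mul_of_nonneg_left ?_ (by positivity)
  have h1 : Real.exp (-x ^ 2 / s) ≤ 1 := by
    rw [Real.exp_le_one_iff, div_le_iff₀ hs]
    nlinarith [sq_nonneg x]
  have h2 : Real.exp (-x ^ 2 / s) * (x ^ 2 / s) ≤ 1 := by
    have h3 := Real.add_one_le_exp (x ^ 2 / s)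
    have : Real.exp (-x ^ 2 / s) = (Real.exp (x ^ 2 / s))⁻¹ := by rw [← Real.exp_neg, neg_div]
    rw [this, inv_mul_le_iff₀ (Real.exp_pos _)]
    linarith
  have h4 : Real.exp (-x ^ 2 / s) * x ^ 2 ≤ s := by
    have := mul_le_mul_of_nonneg_right h2 hs.le
    have e : Real.exp (-x ^ 2 / s) * (x ^ 2 / s) * s = Real.exp (-x ^ 2 / s) * x ^ 2 := by field_simp
    rw [e] at this; linarith
  have h5 : |x| ≤ 1 + x ^ 2 := by nlinarith [sq_abs x, sq_nonneg (|x| - 1), abs_nonneg x]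
  have h0 := Real.exp_pos (-x ^ 2 / s)
  nlinarith [mul_le_mul_of_nonneg_left h5 h0.le]

lemma ph_le' {s : ℝ} (hs : 0 < s) (x : ℝ) : ph s x ≤ (√(Real.pi * s))⁻¹ * (2 + s) := by
  refine le_trans ?_ (ph_le hs x)
  exact le_mul_of_one_le_right (ph_nonneg _ _) (by linarith [abs_nonneg x])

lemma toNN_ne {s : ℝ} (hs : 0 < s) : Real.toNNReal (s/2) ≠ 0 := by
  simp [Real.toNNReal_eq_zero]; linarith

lemma int_gr {s : ℝ} (hs : 0 < s) (F : ℝ → ℝ) : ∫ x, F x ∂(gr s) = ∫ x, ph s x * F x := by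
  rw [integral_gaussianReal_eq_integral_smul (toNN_ne hs)]
  simp only [ph_eq hs, smul_eq_mul]

lemma gr_scale {s : ℝ} (hs : 0 < s) : (gr 1).map (fun x => √s * x) = gr s := by
  rw [gaussianReal_map_const_mul]
  congr 1
  · simp
  · ext
    simp only [NNReal.coe_mul, NNReal.coe_mk]
    rw [Real.coe_toNNReal _ (by positivity), Real.coe_toNNReal _ (by positivity), Real.sq_sqrt hs.le]
    ring

/-- change of variables -/
lemma cv {ε τ : ℝ} (hε : 0 < ε) (hτ : 0 < τ) (m : ℝ) (F : ℝ → ℝ) :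
    ∫ p, ph ε (p + m) * F p ∂(gr τ) = ∫ q, ph τ (√ε * q - m) * F (√ε * q - m) ∂(gr 1) := by
  rw [int_gr hτ]
  rw [← integral_sub_right_eq_self _ m]
  simp only [sub_add_cancel]
  have : ∀ x, ph τ (x - m) * (ph ε x * F (x - m)) = ph ε x * (ph τ (x - m) * F (x - m)) := by intro x; ring
  simp only [this]
  rw [← int_gr hε (fun x => ph τ (x - m) * F (x - m)), ← gr_scale hε]
  have hs : √ε ≠ 0 := by positivity
  have he : MeasurableEmbedding (fun x => √ε * x) := (Homeomorph.mulLeft₀ (√ε) hs).measurableEmbedding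
  rw [he.integral_map]

lemma gr_rot (τ z z' : ℝ) (hz : z ^ 2 + z' ^ 2 = 1) :
    MeasurePreserving (fun p : ℝ × ℝ => (z * p.1 - z' * p.2, z' * p.1 + z * p.2)) ((gr τ).prod (gr τ)) ((gr τ).prod (gr τ)) := by
  have hc : Continuous (fun p : ℝ × ℝ => (z * p.1 - z' * p.2, z' * p.1 + z * p.2)) := by fun_prop
  refine ⟨hc.measurable, ?_⟩
  obtain ⟨θ, h1, h2⟩ : ∃ θ : ℝ, Real.cos θ = z ∧ Real.sin θ = -z' := by
    refine ⟨Complex.arg (⟨z, -z'⟩ : ℂ), ?_, ?_⟩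
    · have hn : ‖(⟨z, -z'⟩ : ℂ)‖ = 1 := by
        rw [Complex.norm_eq_sqrt_sq_add_sq]; simp [hz]
      have h0 : (⟨z, -z'⟩ : ℂ) ≠ 0 := by intro h; rw [h] at hn; simp at hn
      rw [Complex.cos_arg h0, hn]; simp
    · have hn : ‖(⟨z, -z'⟩ : ℂ)‖ = 1 := by
        rw [Complex.norm_eq_sqrt_sq_add_sq]; simp [hz]
      rw [Complex.sin_arg, hn]; simp
  have := IsGaussian.map_rotation_eq_self (μ := gr τ) (by simp) θ
  convert this using 2
  ext p
  · simp [ContinuousLinearMap.rotation_apply, h1, h2]; ring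
  · simp [ContinuousLinearMap.rotation_apply, h1, h2]

lemma gr_arr (t τ z z' : ℝ) (hz : z ^ 2 + z' ^ 2 = 1) :
    MeasurePreserving (fun p : ℝ × (ℝ × (ℝ × ℝ)) => ((p.2.1, z * p.2.2.1 - z' * p.2.2.2), (p.1, z' * p.2.2.1 + z * p.2.2.2)))
      ((gr t).prod ((gr t).prod ((gr τ).prod (gr τ)))) (((gr t).prod (gr τ)).prod ((gr t).prod (gr τ))) := by
  have i1 := (MeasurePreserving.id (gr t)).prod ((MeasurePreserving.id (gr t)).prod (gr_rot τ z z' hz))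
  have i2 := (MeasurePreserving.id (gr t)).prod ((measurePreserving_prodAssoc (gr t) (gr τ) (gr τ)).symm)
  have i3 := Measure.measurePreserving_swap (μ := gr t) (ν := ((gr t).prod (gr τ)).prod (gr τ))
  have i4 := measurePreserving_prodAssoc ((gr t).prod (gr τ)) (gr τ) (gr t)
  have i5 := (MeasurePreserving.id ((gr t).prod (gr τ))).prod (Measure.measurePreserving_swap (μ := gr τ) (ν := gr t))
  have := i5.comp (i4.comp (i3.comp (i2.comp i1)))
  exact this

/-- select -/
noncomputable def sel (a : Prop) (x : ℝ) : ℝ := if a then x else 1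

lemma AM.sel {Ω : Type*} [MeasurableSpace Ω] {μ : Measure Ω} [IsFiniteMeasure μ] {f : Ω → ℝ} (a : Prop) (h : AM μ f) :
    AM μ (fun ω => MDR.sel a (f ω)) := by
  unfold MDR.sel
  by_cases ha : a
  · simpa [ha] using h
  · simpa [ha] using AM.const 1

lemma sel_cont (a : Prop) : Continuous (sel a) := by
  unfold sel
  by_cases ha : a
  · simp only [ha, if_true]; exact continuous_id
  · simp only [ha, if_false]; exact continuous_const

lemma sel_le (a : Prop) (x C : ℝ) (h : |x| ≤ C) (h1 : 1 ≤ C) : |sel a x| ≤ C := by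
  unfold sel
  split_ifs <;> simp [h, h1]

/-- row functional -/
noncomputable def rowA (t τ ε1 ε2 z z' α β γ0 γ1 : ℝ) (a b : Prop) : ℝ :=
  ∫ p : (ℝ × ℝ) × (ℝ × ℝ), ph ε1 (p.1.1 - α) * ph ε2 (z * (p.1.1 + p.1.2 - γ0) + z' * (p.2.1 + p.2.2 - γ1)) *
     (sel a (p.2.1 - β) * sel b (z * (p.2.1 + p.2.2 - γ1) - z' * (p.1.1 + p.1.2 - γ0)))
     ∂(((gr t).prod (gr τ)).prod ((gr t).prod (gr τ)))

noncomputable def rowI (t τ e1 e2 z z' α β γ0 γ1 : ℝ) (a b : Prop) (p : ℝ × ℝ × ℝ) : ℝ :=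
  ph t (e1 * p.2.1 + α) * ph τ (e2 * p.2.2 - (z * (e1 * p.2.1 + α - γ0) + z' * (p.1 - γ1))) *
    (sel a (p.1 - β) * sel b (z * (p.1 - γ1) - z' * (e1 * p.2.1 + α - γ0)))

lemma rowI_le {t τ : ℝ} (ht : 0 < t) (hτ : 0 < τ) (R : ℝ) : ∃ C : ℝ, ∀ (e1 e2 z z' α β γ0 γ1 : ℝ) (a b : Prop) (p : ℝ × ℝ × ℝ),
    z ^ 2 + z' ^ 2 = 1 → |α| ≤ R → |β| ≤ R → |γ0| ≤ R → |γ1| ≤ R →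
    |rowI t τ e1 e2 z z' α β γ0 γ1 a b p| ≤ C * (1 + 2 * R + |p.1|) ^ 2 := by
  refine ⟨((√(Real.pi * t))⁻¹ * (2 + t)) * ((√(Real.pi * τ))⁻¹ * (2 + τ)), ?_⟩
  intro e1 e2 z z' α β γ0 γ1 a b p hz hα hβ h0 h1
  unfold rowI
  set h := e1 * p.2.1 + α
  have hR : 0 ≤ R := (abs_nonneg _).trans hα
  have hz1 : |z| ≤ 1 := by rw [abs_le]; constructor <;> nlinarith
  have hz2 : |z'| ≤ 1 := by rw [abs_le]; constructor <;> nlinarith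
  have hp := abs_nonneg p.1
  have hh := abs_nonneg h
  have s1 : |sel a (p.1 - β)| ≤ 1 + 2 * R + |p.1| := by
    apply sel_le
    · have := abs_sub p.1 β; linarith
    · linarith
  have s2 : |sel b (z * (p.1 - γ1) - z' * (h - γ0))| ≤ (1 + 2 * R + |p.1|) * (1 + |h|) := by
    apply sel_le
    · have a1 : |z * (p.1 - γ1)| ≤ |p.1| + R := by
        rw [abs_mul]
        have := abs_sub p.1 γ1
        calc |z| * |p.1 - γ1| ≤ 1 * |p.1 - γ1| := by gcongr
          _ ≤ _ := by linarith
      have a2 : |z' * (h - γ0)| ≤ |h| + R := by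
        rw [abs_mul]
        have := abs_sub h γ0
        calc |z'| * |h - γ0| ≤ 1 * |h - γ0| := by gcongr
          _ ≤ _ := by linarith
      have := abs_sub (z * (p.1 - γ1)) (z' * (h - γ0))
      nlinarith [mul_nonneg hR hh, mul_nonneg hp hh]
    · nlinarith [mul_nonneg hR hh, mul_nonneg hp hh]
  rw [abs_mul, abs_mul, abs_mul, abs_of_nonneg (ph_nonneg _ _), abs_of_nonneg (ph_nonneg _ _)]
  have p1 := ph_le ht h
  have p2 := ph_le' hτ (e2 * p.2.2 - (z * (h - γ0) + z' * (p.1 - γ1)))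
  calc _ ≤ ph t h * ((√(Real.pi * τ))⁻¹ * (2 + τ)) * ((1 + 2 * R + |p.1|) * ((1 + 2 * R + |p.1|) * (1 + |h|))) := by
        have := ph_nonneg t h
        gcongr
    _ = (ph t h * (1 + |h|)) * ((√(Real.pi * τ))⁻¹ * (2 + τ)) * (1 + 2 * R + |p.1|) ^ 2 := by ring
    _ ≤ _ := by gcongr

lemma rowI_cont (t τ z z' α β γ0 γ1 : ℝ) (a b : Prop) :
    Continuous (fun q : (ℝ × ℝ) × (ℝ × ℝ × ℝ) => rowI t τ q.1.1 q.1.2 z z' α β γ0 γ1 a b q.2) := by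
  unfold rowI
  have h1 := ph_cont t
  have h2 := ph_cont τ
  have h3 := sel_cont a
  have h4 := sel_cont b
  fun_prop

lemma AM_gr (s : ℝ) : AM (gr s) (fun x => x) := AM.gauss _

lemma rowA_eq {t τ ε1 ε2 : ℝ} (ht : 0 < t) (hτ : 0 < τ) (h1 : 0 < ε1) (h2 : 0 < ε2) (z z' α β γ0 γ1 : ℝ) (a b : Prop)
    (hz : z ^ 2 + z' ^ 2 = 1) :
    rowA t τ ε1 ε2 z z' α β γ0 γ1 a b =
      ∫ p, rowI t τ (√ε1) (√ε2) z z' α β γ0 γ1 a b p ∂((gr t).prod ((gr 1).prod (gr 1))) := by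
  have hint : Integrable (fun p => rowI t τ (√ε1) (√ε2) z z' α β γ0 γ1 a b p) ((gr t).prod ((gr 1).prod (gr 1))) := by
    obtain ⟨C, hC⟩ := rowI_le ht hτ (|α| + |β| + |γ0| + |γ1|)
    have hAM : AM ((gr t).prod ((gr 1).prod (gr 1))) (fun p => C * (1 + 2 * (|α| + |β| + |γ0| + |γ1|) + |p.1|) ^ 2) := by
      refine (AM.const C).mul (AM.pow ((AM.const _).add ?_) 2)
      refine AM.fst (f := fun x => |x|) ⟨(continuous_abs.aestronglyMeasurable), fun p => ?_⟩
      simpa using (AM_gr t).2 p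
    refine hAM.integrable.mono' ?_ ?_
    · exact ((rowI_cont t τ z z' α β γ0 γ1 a b).comp (by fun_prop : Continuous fun p : ℝ × ℝ × ℝ => ((√ε1, √ε2), p))).aestronglyMeasurable
    · refine Filter.Eventually.of_forall fun p => ?_
      have := abs_nonneg α; have := abs_nonneg β; have := abs_nonneg γ0; have := abs_nonneg γ1
      exact hC _ _ _ _ _ _ _ _ _ _ _ hz (by linarith) (by linarith) (by linarith) (by linarith)
  rw [integral_prod _ hint]
  have hAMb : ∀ ε : ℝ, 0 < ε → ∀ f : ℝ × (ℝ × (ℝ × ℝ)) → ℝ, Continuous f → AM ((gr t).prod ((gr t).prod ((gr τ).prod (gr τ)))) (fun p => ph ε (f p)) := by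
    intro ε hε f hf
    refine AM.of_bdd ((ph_cont ε).comp hf).aestronglyMeasurable ((√(Real.pi * ε))⁻¹ * (2 + ε)) (Filter.Eventually.of_forall fun p => ?_)
    rw [abs_of_nonneg (ph_nonneg _ _)]; exact ph_le' hε _
  unfold rowA
  rw [← (gr_arr t τ z z' hz).map_eq, integral_map (gr_arr t τ z z' hz).measurable.aemeasurable]
  swap
  · have h1 := ph_cont ε1
    have h2 := ph_cont ε2
    have h3 := sel_cont a
    have h4 := sel_cont b
    refine Continuous.aestronglyMeasurable ?_
    fun_prop
  have e1 : ∀ p f h0 h1 : ℝ, z * (h0 + (z * p - z' * f) - γ0) + z' * (h1 + (z' * p + z * f) - γ1) =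
      p + (z * (h0 - γ0) + z' * (h1 - γ1)) := by
    intro p f h0 h1; linear_combination p * hz
  have e2 : ∀ p f h0 h1 : ℝ, z * (h1 + (z' * p + z * f) - γ1) - z' * (h0 + (z * p - z' * f) - γ0) =
      f + (z * (h1 - γ1) - z' * (h0 - γ0)) := by
    intro p f h0 h1; linear_combination f * hz
  simp only [e1, e2]
  have c1 : AM ((gr t).prod ((gr t).prod ((gr τ).prod (gr τ)))) (fun p => p.1) := AM.fst (AM_gr t)
  have c2 : AM ((gr t).prod ((gr t).prod ((gr τ).prod (gr τ)))) (fun p => p.2.1) :=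
    AM.snd (f := fun q : ℝ × (ℝ × ℝ) => q.1) (AM.fst (AM_gr t))
  have c4 : AM ((gr t).prod ((gr t).prod ((gr τ).prod (gr τ)))) (fun p => p.2.2.2) :=
    AM.snd (f := fun q : ℝ × (ℝ × ℝ) => q.2.2) (AM.snd (f := fun q : (ℝ × ℝ) => q.2) (AM.snd (f := fun q => q) (AM_gr τ)))
  have hI : Integrable (fun p : ℝ × (ℝ × (ℝ × ℝ)) => ph ε1 (p.2.1 - α) * ph ε2 (p.2.2.1 + (z * (p.2.1 - γ0) + z' * (p.1 - γ1))) *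
     (sel a (p.1 - β) * sel b (p.2.2.2 + (z * (p.1 - γ1) - z' * (p.2.1 - γ0)))))
      ((gr t).prod ((gr t).prod ((gr τ).prod (gr τ)))) := by
    apply AM.integrable
    refine AM.mul (AM.mul (hAMb _ h1 _ (by fun_prop)) (hAMb _ h2 _ (by fun_prop))) (AM.mul (AM.sel _ ?_) (AM.sel _ ?_))
    · exact c1.sub (AM.const _)
    · exact c4.add (((AM.const z).mul (c1.sub (AM.const _))).sub ((AM.const z').mul (c2.sub (AM.const _))))
  rw [integral_prod _ hI]
  refine integral_congr_ae ?_
  filter_upwards [hI.prod_right_ae, hint.prod_right_ae] with x hx hx'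
  rw [integral_prod _ hx, integral_prod _ hx']
  have step : ∀ h0 : ℝ, ∫ pf : ℝ × ℝ, ph ε1 (h0 - α) * ph ε2 (pf.1 + (z * (h0 - γ0) + z' * (x - γ1))) *
     (sel a (x - β) * sel b (pf.2 + (z * (x - γ1) - z' * (h0 - γ0)))) ∂((gr τ).prod (gr τ)) =
     ph ε1 (h0 + -α) * ((∫ q, ph τ (√ε2 * q - (z * (h0 - γ0) + z' * (x - γ1))) * 1 ∂(gr 1)) * (sel a (x - β) * sel b (z * (x - γ1) - z' * (h0 - γ0)))) := by
    intro h0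
    rw [← cv h2 hτ (z * (h0 - γ0) + z' * (x - γ1)) (fun _ => 1)]
    have : ∀ pf : ℝ × ℝ, ph ε1 (h0 - α) * ph ε2 (pf.1 + (z * (h0 - γ0) + z' * (x - γ1))) *
     (sel a (x - β) * sel b (pf.2 + (z * (x - γ1) - z' * (h0 - γ0)))) =
      (ph ε1 (h0 - α) * (ph ε2 (pf.1 + (z * (h0 - γ0) + z' * (x - γ1))) * 1)) *
       (sel a (x - β) * sel b (pf.2 + (z * (x - γ1) - z' * (h0 - γ0)))) := by intro pf; ring
    simp only [this]
    rw [integral_prod_mul (fun p => ph ε1 (h0 - α) * (ph ε2 (p + (z * (h0 - γ0) + z' * (x - γ1))) * 1))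
      (fun f => sel a (x - β) * sel b (f + (z * (x - γ1) - z' * (h0 - γ0))))]
    rw [MeasureTheory.integral_const_mul, MeasureTheory.integral_const_mul]
    have hs : ∫ f, sel b (f + (z * (x - γ1) - z' * (h0 - γ0))) ∂(gr τ) = sel b (z * (x - γ1) - z' * (h0 - γ0)) := by
      unfold sel
      by_cases hb : b
      · simp only [hb, if_true]
        rw [integral_add (AM_gr τ).integrable (integrable_const _), integral_id_gaussianReal]
        simp
      · simp [hb]
    rw [hs, ← sub_eq_add_neg]; ring
  simp only [step]
  rw [cv h1 ht (-α)]
  refine integral_congr_ae (Filter.Eventually.of_forall fun p => ?_)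
  simp only [sub_neg_eq_add, rowI, mul_one]
  rw [MeasureTheory.integral_mul_const, MeasureTheory.integral_const_mul]
  ring

end MDR

open MeasureTheory Matrix Nat intervalIntegral
open scoped Classical

namespace MDR
open ProbabilityTheory

lemma gr_m1 (s : ℝ) : ∫ x, x ∂(gr s) = 0 := by simp
lemma gr_m2 {s : ℝ} (hs : 0 < s) : ∫ x, x ^ 2 ∂(gr s) = s / 2 := by
  have h := variance_id_gaussianReal (μ := 0) (v := Real.toNNReal (s/2))
  rw [variance_eq_sub (memLp_id_gaussianReal 2)] at h
  simp at h
  rw [h]; rw [max_eq_left (by positivity)]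

lemma gr_AMabs (t R : ℝ) (C : ℝ) : AM (gr t) (fun p => C * (1 + 2 * R + |p|) ^ 2) := by
  refine (AM.const C).mul (AM.pow ((AM.const _).add ?_) 2)
  refine ⟨(continuous_abs.aestronglyMeasurable), fun p => ?_⟩
  simpa using (AM_gr t).2 p

lemma rowA_bdd {t τ : ℝ} (ht : 0 < t) (hτ : 0 < τ) (R : ℝ) : ∃ C : ℝ, 0 ≤ C ∧ ∀ (ε1 ε2 z z' α β γ0 γ1 : ℝ) (a b : Prop),
    0 < ε1 → 0 < ε2 → z ^ 2 + z' ^ 2 = 1 → |α| ≤ R → |β| ≤ R → |γ0| ≤ R → |γ1| ≤ R →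
    |rowA t τ ε1 ε2 z z' α β γ0 γ1 a b| ≤ C := by
  obtain ⟨C, hC⟩ := rowI_le ht hτ R
  refine ⟨|∫ p : ℝ × ℝ × ℝ, C * (1 + 2 * R + |p.1|) ^ 2 ∂((gr t).prod ((gr 1).prod (gr 1)))|, abs_nonneg _, ?_⟩
  intro ε1 ε2 z z' α β γ0 γ1 a b h1 h2 hz h3 h4 h5 h6
  rw [rowA_eq ht hτ h1 h2 _ _ _ _ _ _ _ _ hz]
  refine le_trans ?_ (le_abs_self _)
  rw [← Real.norm_eq_abs]
  refine norm_integral_le_of_norm_le (AM.fst (gr_AMabs t R C)).integrable ?_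
  exact Filter.Eventually.of_forall fun p => hC _ _ _ _ _ _ _ _ _ _ _ hz h3 h4 h5 h6

noncomputable def row0 (t τ z z' α β γ0 γ1 : ℝ) (a b : Prop) : ℝ :=
  ∫ h, rowI t τ 0 0 z z' α β γ0 γ1 a b (h, 0, 0) ∂(gr t)

lemma rowA_lim {t τ : ℝ} (ht : 0 < t) (hτ : 0 < τ) {e1 e2 : ℕ → ℝ} (p1 : ∀ n, 0 < e1 n) (p2 : ∀ n, 0 < e2 n)
    (l1 : Filter.Tendsto e1 Filter.atTop (nhds 0)) (l2 : Filter.Tendsto e2 Filter.atTop (nhds 0))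
    (z z' α β γ0 γ1 : ℝ) (a b : Prop) (hz : z ^ 2 + z' ^ 2 = 1) :
    Filter.Tendsto (fun n => rowA t τ (e1 n) (e2 n) z z' α β γ0 γ1 a b) Filter.atTop (nhds (row0 t τ z z' α β γ0 γ1 a b)) := by
  have e : row0 t τ z z' α β γ0 γ1 a b = ∫ p, rowI t τ 0 0 z z' α β γ0 γ1 a b p ∂((gr t).prod ((gr 1).prod (gr 1))) := by
    have : ∀ p : ℝ × ℝ × ℝ, rowI t τ 0 0 z z' α β γ0 γ1 a b p = rowI t τ 0 0 z z' α β γ0 γ1 a b (p.1, 0, 0) * 1 := by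
      intro p; simp [rowI]
    rw [row0]
    rw [integral_congr_ae (Filter.Eventually.of_forall this)]
    rw [integral_prod_mul (fun h => rowI t τ 0 0 z z' α β γ0 γ1 a b (h, 0, 0)) (fun _ => (1:ℝ))]
    simp
  rw [e]
  have : ∀ n, rowA t τ (e1 n) (e2 n) z z' α β γ0 γ1 a b = _ := fun n => rowA_eq ht hτ (p1 n) (p2 n) z z' α β γ0 γ1 a b hz
  simp_rw [this]
  obtain ⟨C, hC⟩ := rowI_le ht hτ (|α| + |β| + |γ0| + |γ1|)
  have := abs_nonneg α; have := abs_nonneg β; have := abs_nonneg γ0; have := abs_nonneg γ1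
  refine tendsto_integral_of_dominated_convergence (fun p => C * (1 + 2 * (|α| + |β| + |γ0| + |γ1|) + |p.1|) ^ 2) ?_ ?_ ?_ ?_
  · intro n
    exact ((rowI_cont t τ z z' α β γ0 γ1 a b).comp (by fun_prop : Continuous fun p : ℝ × ℝ × ℝ => ((√(e1 n), √(e2 n)), p))).aestronglyMeasurable
  · exact (AM.fst (gr_AMabs t _ C)).integrable
  · intro n
    refine Filter.Eventually.of_forall fun p => ?_
    exact hC (√(e1 n)) (√(e2 n)) z z' α β γ0 γ1 a b p hz (by linarith) (by linarith) (by linarith) (by linarith)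
  · refine Filter.Eventually.of_forall fun p => ?_
    have hc : Continuous (fun q : ℝ × ℝ => rowI t τ q.1 q.2 z z' α β γ0 γ1 a b p) :=
      by
        have h0 : Continuous fun q : ℝ × ℝ => (q, p) := by fun_prop
        have := (rowI_cont t τ z z' α β γ0 γ1 a b).comp h0
        simpa only [Function.comp_def] using this
    have l1' : Filter.Tendsto (fun n => √(e1 n)) Filter.atTop (nhds 0) := by
      simpa [Function.comp_def] using (Real.continuous_sqrt.tendsto 0).comp l1
    have l2' : Filter.Tendsto (fun n => √(e2 n)) Filter.atTop (nhds 0) := by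
      simpa [Function.comp_def] using (Real.continuous_sqrt.tendsto 0).comp l2
    have := (hc.tendsto (0, 0)).comp (l1'.prodMk_nhds l2')
    simpa only [Function.comp_def] using this

lemma ph_split {t τ z' : ℝ} (ht : 0 < t) (hτ : 0 < τ) (S h : ℝ) :
    ph t h * ph τ (S - z' * h) = ph (τ + t * z' ^ 2) S * ph (t * τ / (τ + t * z' ^ 2)) (h - z' * t * S / (τ + t * z' ^ 2)) := by
  have hD : 0 < τ + t * z' ^ 2 := by positivity
  unfold ph
  rw [mul_mul_mul_comm, mul_mul_mul_comm (√(Real.pi * (τ + t * z' ^ 2)))⁻¹, ← Real.exp_add, ← Real.exp_add, ← mul_inv, ← mul_inv, ← Real.sqrt_mul (by positivity),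
    ← Real.sqrt_mul (by positivity)]
  congr 2
  · have : Real.pi * t * (Real.pi * τ) = Real.pi * (τ + t * z' ^ 2) * (Real.pi * (t * τ / (τ + t * z' ^ 2))) := by field_simp
    rw [this]
  · field_simp
    ring

lemma row0_eq {t τ : ℝ} (ht : 0 < t) (hτ : 0 < τ) (z z' α β γ0 γ1 : ℝ) (a b : Prop) (D S μ κ : ℝ) (hD : D = τ + t * z' ^ 2)
    (hS : S = z * (γ0 - α) + z' * γ1) (hμ : μ = z' * t * S / D) (hκ : κ = z * γ1 + z' * (α - γ0)) :
    row0 t τ z z' α β γ0 γ1 a b = ph t α * (ph D S * (if a then (if b then z * (t * τ / (2 * D)) + (μ - β) * (z * μ - κ) else μ - β) else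
      (if b then z * μ - κ else 1))) := by
  have hD0 : 0 < D := by rw [hD]; positivity
  have hv : 0 < t * τ / D := by positivity
  rw [row0, int_gr ht]
  have e : ∀ h, ph t h * rowI t τ 0 0 z z' α β γ0 γ1 a b (h, 0, 0) =
      ph t α * (ph D S * (ph (t * τ / D) (h - μ) * (sel a (h - μ + (μ - β)) * sel b (z * (h - μ) + (z * μ - κ))))) := by
    intro h
    have := ph_split (z' := z') ht hτ S h
    rw [← hD, ← hμ] at this
    unfold rowI
    simp only [zero_mul, zero_add, zero_sub]
    have e1 : -(z * (α - γ0) + z' * (h - γ1)) = S - z' * h := by rw [hS]; ring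
    have e2 : h - β = h - μ + (μ - β) := by ring
    have e3 : z * (h - γ1) - z' * (α - γ0) = z * (h - μ) + (z * μ - κ) := by rw [hκ]; ring
    rw [e1, e2, e3]
    linear_combination (ph t α * (sel a (h - μ + (μ - β)) * sel b (z * (h - μ) + (z * μ - κ)))) * this
  simp_rw [e]
  rw [MeasureTheory.integral_const_mul, MeasureTheory.integral_const_mul,
    integral_sub_right_eq_self (fun h => ph (t * τ / D) h * (sel a (h + (μ - β)) * sel b (z * h + (z * μ - κ)))) μ,
    ← int_gr hv (fun h => sel a (h + (μ - β)) * sel b (z * h + (z * μ - κ)))]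
  congr 2
  have i1 := (AM_gr (t * τ / D)).integrable
  have i2 := ((AM_gr (t * τ / D)).pow 2).integrable
  by_cases ha : a <;> by_cases hb : b <;> simp only [sel, ha, hb, if_true, if_false, one_mul, mul_one]
  · have : ∀ h : ℝ, (h + (μ - β)) * (z * h + (z * μ - κ)) = z * h ^ 2 + ((z * μ - κ + z * (μ - β)) * h + (μ - β) * (z * μ - κ)) := by
      intro h; ring
    simp_rw [this]
    have i3 : Integrable (fun x => (z * μ - κ + z * (μ - β)) * x + (μ - β) * (z * μ - κ)) (gr (t * τ / D)) :=
      (i1.const_mul _).add (integrable_const _)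
    rw [integral_add (i2.const_mul _) i3, integral_add (i1.const_mul _) (integrable_const _),
      MeasureTheory.integral_const_mul, MeasureTheory.integral_const_mul, gr_m1, gr_m2 hv]
    simp
    left
    field_simp
  · rw [integral_add i1 (integrable_const _), gr_m1]; simp
  · rw [integral_add (i1.const_mul _) (integrable_const _), MeasureTheory.integral_const_mul, gr_m1]; simp
  · simp

/-- integration over pairs of matrices as a product over entries -/
lemma gm_pair (N : ℕ) (t τ : ℝ) (F : (Fin N → Fin N → ℝ) × (Fin N → Fin N → ℝ) → ℝ) :
    ∫ p, F p ∂((gm N t).prod (gm N τ)) =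
     ∫ q : Fin N → Fin N → ℝ × ℝ, F (fun k l => (q k l).1, fun k l => (q k l).2)
      ∂(Measure.pi fun _ => Measure.pi fun _ => (gr t).prod (gr τ)) := by
  have i1 : MeasurePreserving (fun q : Fin N → Fin N → ℝ × ℝ => fun k => MeasurableEquiv.arrowProdEquivProdArrow ℝ ℝ (Fin N) (q k))
     (Measure.pi fun _ => Measure.pi fun _ => (gr t).prod (gr τ)) (Measure.pi fun _ : Fin N => (gv (Fin N) t).prod (gv (Fin N) τ)) := by
    apply measurePreserving_pi
    intro k
    exact measurePreserving_arrowProdEquivProdArrow ℝ ℝ (Fin N) (fun _ => gr t) (fun _ => gr τ)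
  have i2 := measurePreserving_arrowProdEquivProdArrow (Fin N → ℝ) (Fin N → ℝ) (Fin N) (fun _ => gv (Fin N) t) (fun _ => gv (Fin N) τ)
  change ∫ p, F p ∂((Measure.pi fun _ : Fin N => gv (Fin N) t).prod (Measure.pi fun _ : Fin N => gv (Fin N) τ)) = _
  rw [← MeasurePreserving.integral_comp' i2]
  let e : (Fin N → Fin N → ℝ × ℝ) ≃ᵐ (Fin N → (Fin N → ℝ) × (Fin N → ℝ)) :=
    MeasurableEquiv.piCongrRight (fun _ => MeasurableEquiv.arrowProdEquivProdArrow ℝ ℝ (Fin N))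
  have i1' : MeasurePreserving e _ _ := i1
  rw [← MeasurePreserving.integral_comp' i1']
  rfl

lemma split2 {Ω : Type*} [MeasurableSpace Ω] (ν : Measure Ω) [IsProbabilityMeasure ν] (n : ℕ) (G : Ω × Ω → ℝ) (f : Fin n → Ω → ℝ) :
    ∫ q : Fin (n+2) → Ω, G (q 0, q 1) * ∏ l, f l (q l.succ.succ) ∂(Measure.pi fun _ => ν) =
      (∫ p, G p ∂(ν.prod ν)) * ∏ l, ∫ o, f l o ∂ν := by
  have i1 := measurePreserving_piFinSuccAbove (fun _ : Fin (n+2) => ν) 0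
  have i2 := measurePreserving_piFinSuccAbove (fun _ : Fin (n+1) => ν) 0
  have i3 := (MeasurePreserving.id ν).prod i2
  have i4 := (measurePreserving_prodAssoc ν ν (Measure.pi fun _ : Fin n => ν)).symm
  let e : (Fin (n+2) → Ω) ≃ᵐ (Ω × Ω) × (Fin n → Ω) :=
    ((MeasurableEquiv.piFinSuccAbove (fun _ : Fin (n+2) => Ω) 0).trans
      ((MeasurableEquiv.refl Ω).prodCongr (MeasurableEquiv.piFinSuccAbove (fun _ : Fin (n+1) => Ω) 0))).trans MeasurableEquiv.prodAssoc.symm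
  have i5 : MeasurePreserving e (Measure.pi fun _ => ν) ((ν.prod ν).prod (Measure.pi fun _ : Fin n => ν)) := i4.comp (i3.comp i1)
  rw [← integral_fintype_prod_eq_prod, ← integral_prod_mul G (fun q : Fin n → Ω => ∏ l, f l (q l)), ← MeasurePreserving.integral_comp' i5]
  rfl

end MDR

open MeasureTheory Matrix Nat intervalIntegral
open scoped Classical

namespace MDR
open ProbabilityTheory

/-- the shifted matrices -/
def Xm {N : ℕ} (H : Fin N → Fin N → ℝ) (y : ℝ) : Matrix (Fin N) (Fin N) ℝ := Matrix.of H - Matrix.scalar (Fin N) y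

noncomputable def delta {n : ℕ} (k l : Fin n) (y : ℝ) : ℝ := if k = l then y else 0

lemma Xm_apply {N : ℕ} (H : Fin N → Fin N → ℝ) (y : ℝ) (k l : Fin N) : Xm H y k l = H k l - delta k l y := by
  simp [delta, Xm, Matrix.scalar_apply, Matrix.diagonal_apply]

/-- quadratic form times gaussian -/
noncomputable def Qf {N : ℕ} (ε : ℝ) (X : Matrix (Fin N) (Fin N) ℝ) (u : Fin N → ℝ) : ℝ :=
  (u ⬝ᵥ (X.adjugate *ᵥ u)) * ∏ k, ph ε ((X *ᵥ u) k)

noncomputable def Kf {N : ℕ} (t τ ε1 ε2 y x : ℝ) (u w : Fin N → ℝ) : ℝ :=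
  ∫ p, Qf ε1 (Xm p.1 y) u * Qf ε2 (Xm (p.1 + p.2) x) w ∂((gm N t).prod (gm N τ))

lemma quad_e0 {N : ℕ} (X : Matrix (Fin (N+1)) (Fin (N+1)) ℝ) :
    (Pi.single 0 1 : Fin (N+1) → ℝ) ⬝ᵥ (X.adjugate *ᵥ Pi.single 0 1) = (X.updateCol 0 (Pi.single 0 1)).det := by
  simp only [single_one_dotProduct]
  rw [← cramer_eq_adjugate_mulVec, cramer_apply]

lemma quad_w {m : ℕ} (Y : Matrix (Fin (m+2)) (Fin (m+2)) ℝ) (z z' : ℝ) (w : Fin (m+2) → ℝ) (hw : w = z • Pi.single 0 1 + z' • Pi.single 1 1) :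
    w ⬝ᵥ (Y.adjugate *ᵥ w) = ((Y.updateCol 0 w).updateCol 1 (z • (fun k => Y k 1) + (-z') • (fun k => Y k 0))).det := by
  rw [det_updateCol_add, det_updateCol_smul, det_updateCol_smul, ← cramer_eq_adjugate_mulVec]
  conv_lhs => lhs; rw [hw]
  simp only [add_dotProduct, smul_dotProduct, single_one_dotProduct, smul_eq_mul, cramer_apply]
  have h1 : (Y.updateCol 0 w).updateCol 1 (fun k => Y k 1) = Y.updateCol 0 w := by
    ext i j
    simp only [updateCol_apply]
    split_ifs with a b <;> simp_all
  have h2 : ((Y.updateCol 0 w).updateCol 1 (fun k => Y k 0)).det = - (Y.updateCol 1 w).det := by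
    have := det_permute' (Equiv.swap (0 : Fin (m+2)) 1) (Y.updateCol 1 w)
    rw [Equiv.Perm.sign_swap (by simp)] at this
    simp only [Units.val_neg, Units.val_one, Int.cast_neg, Int.cast_one, neg_mul, one_mul] at this
    rw [← this]
    congr 1
    ext i j
    simp only [updateCol_apply, submatrix_apply, id]
    by_cases a : j = 1
    · subst a; simp
    · by_cases b : j = 0
      · subst b; simp
      · rw [Equiv.swap_apply_of_ne_of_ne b a]; simp [a, b]
  rw [h1, h2]; ring

lemma prod_sel {ι : Type*} [Fintype ι] (i : ι) (f : ι → ℝ) : ∏ k, sel (k = i) (f k) = f i := by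
  simp [sel, Finset.prod_ite_eq']

noncomputable def rowG (ε1 ε2 z z' α β γ0 γ1 : ℝ) (a b : Prop) (p : (ℝ × ℝ) × (ℝ × ℝ)) : ℝ :=
  ph ε1 (p.1.1 - α) * ph ε2 (z * (p.1.1 + p.1.2 - γ0) + z' * (p.2.1 + p.2.2 - γ1)) *
     (sel a (p.2.1 - β) * sel b (z * (p.2.1 + p.2.2 - γ1) - z' * (p.1.1 + p.1.2 - γ0)))

noncomputable def rowF {m : ℕ} (ε1 ε2 z z' y x : ℝ) (σ π : Equiv.Perm (Fin (m+3))) (k : Fin (m+3)) (q : Fin (m+3) → ℝ × ℝ) : ℝ :=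
  rowG ε1 ε2 z z' (delta k 0 y) (delta k 1 y) (delta k 0 x) (delta k 1 x) (k = σ 1) (k = π 1) (q 0, q 1) *
    ∏ l : Fin (m+1), (sel (k = σ l.succ.succ) ((q l.succ.succ).1 - delta k l.succ.succ y) *
      sel (k = π l.succ.succ) ((q l.succ.succ).1 + (q l.succ.succ).2 - delta k l.succ.succ x))

lemma KI_expand {m : ℕ} (ε1 ε2 z z' y x : ℝ) (w : Fin (m+3) → ℝ) (hw : w = z • Pi.single 0 1 + z' • Pi.single 1 1)
    (p : (Fin (m+3) → Fin (m+3) → ℝ) × (Fin (m+3) → Fin (m+3) → ℝ)) :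
    Qf ε1 (Xm p.1 y) (Pi.single 0 1) * Qf ε2 (Xm (p.1 + p.2) x) w =
    ∑ σ : Equiv.Perm (Fin (m+3)), ∑ π : Equiv.Perm (Fin (m+3)),
      ((Equiv.Perm.sign σ : ℤ) : ℝ) * ((Equiv.Perm.sign π : ℤ) : ℝ) * ((if σ 0 = 0 then 1 else 0) * w (π 0)) *
        ∏ k, rowF ε1 ε2 z z' y x σ π k (fun l => (p.1 k l, p.2 k l)) := by
  set X := Xm p.1 y with hX
  set Y := Xm (p.1 + p.2) x with hY
  have eX : ∀ k l, p.1 k l - delta k l y = X k l := fun k l => by rw [hX, Xm_apply]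
  have eY : ∀ k l, p.1 k l + p.2 k l - delta k l x = Y k l := fun k l => by rw [hY, Xm_apply]; rfl
  have eXu : ∀ k, (X *ᵥ Pi.single 0 1) k = X k 0 := fun k => by simp
  have eYw : ∀ k, (Y *ᵥ w) k = z * Y k 0 + z' * Y k 1 := fun k => by
    rw [hw, mulVec_add, mulVec_smul, mulVec_smul]; simp
  unfold Qf
  rw [quad_e0, quad_w Y z z' w hw, mul_mul_mul_comm, det_apply', det_apply', Finset.sum_mul_sum, Finset.sum_mul]
  simp_rw [Finset.sum_mul, eXu, eYw]
  refine Finset.sum_congr rfl fun σ _ => Finset.sum_congr rfl fun π _ => ?_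
  have hd1 : ∏ i, (X.updateCol 0 (Pi.single 0 1)) (σ i) i = (if σ 0 = 0 then 1 else 0) * (X (σ 1) 1 * ∏ l : Fin (m+1), X (σ l.succ.succ) l.succ.succ) := by
    rw [Fin.prod_univ_succ, Fin.prod_univ_succ]
    congr 1
    simp only [updateCol_self, Pi.single_apply]
  have hd2 : ∏ i, ((Y.updateCol 0 w).updateCol 1 (z • (fun k => Y k 1) + (-z') • (fun k => Y k 0))) (π i) i =
      w (π 0) * ((z * Y (π 1) 1 - z' * Y (π 1) 0) * ∏ l : Fin (m+1), Y (π l.succ.succ) l.succ.succ) := by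
    rw [Fin.prod_univ_succ, Fin.prod_univ_succ]
    congr 1
    congr 1
    simp; ring
  have hr : ∏ k, rowF ε1 ε2 z z' y x σ π k (fun l => (p.1 k l, p.2 k l)) =
     ((∏ k, ph ε1 (X k 0)) * ∏ k, ph ε2 (z * Y k 0 + z' * Y k 1)) * ((X (σ 1) 1 * (z * Y (π 1) 1 - z' * Y (π 1) 0)) *
      ((∏ l : Fin (m+1), X (σ l.succ.succ) l.succ.succ) * ∏ l : Fin (m+1), Y (π l.succ.succ) l.succ.succ)) := by
    unfold rowF rowG
    simp only [eX, eY]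
    simp only [Finset.prod_mul_distrib]
    rw [Finset.prod_comm, Finset.prod_comm (f := fun (x : Fin (m+3)) (x_1 : Fin (m+1)) => sel (x = π x_1.succ.succ) (Y x x_1.succ.succ))]
    have q1 : ∀ l : Fin (m+1), ∏ k, sel (k = σ l.succ.succ) (X k l.succ.succ) = X (σ l.succ.succ) l.succ.succ := fun l => prod_sel _ _
    have q2 : ∀ l : Fin (m+1), ∏ k, sel (k = π l.succ.succ) (Y k l.succ.succ) = Y (π l.succ.succ) l.succ.succ := fun l => prod_sel _ _
    simp only [q1, q2]
    rw [prod_sel (σ 1) (fun k => X k 1), prod_sel (π 1) (fun k => z * Y k 1 - z' * Y k 0)]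
    ring
  rw [hd1, hd2, hr]
  ring

lemma AM.ph {Ω : Type*} [MeasurableSpace Ω] {μ : Measure Ω} [IsFiniteMeasure μ] {f : Ω → ℝ} {ε : ℝ} (hε : 0 < ε) (h : AM μ f) :
    AM μ (fun ω => MDR.ph ε (f ω)) := by
  refine AM.of_bdd ((ph_cont ε).comp_aestronglyMeasurable h.1) ((√(Real.pi * ε))⁻¹ * (2 + ε)) (Filter.Eventually.of_forall fun p => ?_)
  rw [abs_of_nonneg (ph_nonneg _ _)]; exact ph_le' hε _

lemma AM_rowF {m : ℕ} (t τ : ℝ) {ε1 ε2 : ℝ} (h1 : 0 < ε1) (h2 : 0 < ε2) (z z' y x : ℝ) (σ π : Equiv.Perm (Fin (m+3))) (k : Fin (m+3)) :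
    AM ((gm (m+3) t).prod (gm (m+3) τ)) (fun p => rowF ε1 ε2 z z' y x σ π k (fun l => (p.1 k l, p.2 k l))) := by
  have c1 : ∀ l, AM ((gm (m+3) t).prod (gm (m+3) τ)) (fun p => p.1 k l) := fun l => AM.fst (AM.gm t k l)
  have c2 : ∀ l, AM ((gm (m+3) t).prod (gm (m+3) τ)) (fun p => p.2 k l) := fun l => AM.snd (AM.gm τ k l)
  have c3 : ∀ l γ, AM ((gm (m+3) t).prod (gm (m+3) τ)) (fun p => p.1 k l + p.2 k l - γ) :=
    fun l γ => ((c1 l).add (c2 l)).sub (AM.const γ)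
  unfold rowF rowG
  refine AM.mul (AM.mul (AM.mul (AM.ph h1 ?_) (AM.ph h2 ?_)) (AM.mul (AM.sel _ ?_) (AM.sel _ ?_))) (AM.prod _ fun l _ => AM.mul (AM.sel _ ?_) (AM.sel _ ?_))
  · exact (c1 _).sub (AM.const _)
  · exact ((AM.const z).mul (c3 _ _)).add ((AM.const z').mul (c3 _ _))
  · exact (c1 _).sub (AM.const _)
  · exact ((AM.const z).mul (c3 _ _)).sub ((AM.const z').mul (c3 _ _))
  · exact (c1 _).sub (AM.const _)
  · exact c3 _ _

noncomputable def mom (t τ : ℝ) (a b : Prop) (α β : ℝ) : ℝ := ∫ p : ℝ × ℝ, sel a (p.1 - α) * sel b (p.1 + p.2 - β) ∂((gr t).prod (gr τ))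

lemma mom_ff (t τ α β : ℝ) {a b : Prop} (ha : ¬ a) (hb : ¬ b) : mom t τ a b α β = 1 := by simp [mom, sel, ha, hb]
lemma mom_tf (t τ α β : ℝ) {a b : Prop} (ha : a) (hb : ¬ b) : mom t τ a b α β = -α := by
  simp only [mom, sel, ha, hb, if_true, if_false, mul_one]
  rw [integral_sub (AM.fst (AM_gr t)).integrable (integrable_const _)]
  have := integral_prod_mul (μ := gr t) (ν := gr τ) (fun x => x) (fun _ => (1:ℝ))
  simp only [mul_one] at this
  rw [this]; simp
lemma int_fst (t τ : ℝ) (f : ℝ → ℝ) : ∫ p : ℝ × ℝ, f p.1 ∂((gr t).prod (gr τ)) = ∫ x, f x ∂(gr t) := by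
  have := integral_prod_mul (μ := gr t) (ν := gr τ) f (fun _ => (1:ℝ))
  simp only [mul_one] at this
  rw [this]; simp
lemma int_snd (t τ : ℝ) (f : ℝ → ℝ) : ∫ p : ℝ × ℝ, f p.2 ∂((gr t).prod (gr τ)) = ∫ x, f x ∂(gr τ) := by
  have := integral_prod_mul (μ := gr t) (ν := gr τ) (fun _ => (1:ℝ)) f
  simp only [one_mul] at this
  rw [this]; simp
lemma mom_ft (t τ α β : ℝ) {a b : Prop} (ha : ¬ a) (hb : b) : mom t τ a b α β = -β := by
  simp only [mom, sel, ha, hb, if_true, if_false, one_mul]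
  have i1 : Integrable (fun p : ℝ × ℝ => p.1) ((gr t).prod (gr τ)) := (AM.fst (AM_gr t)).integrable
  have i2 : Integrable (fun p : ℝ × ℝ => p.2) ((gr t).prod (gr τ)) := (AM.snd (AM_gr τ)).integrable
  have i3 : Integrable (fun p : ℝ × ℝ => p.1 + p.2) ((gr t).prod (gr τ)) := i1.add i2
  rw [integral_sub i3 (integrable_const _), integral_add i1 i2, int_fst t τ (fun x => x), int_snd t τ (fun x => x), gr_m1, gr_m1]
  simp
lemma mom_tt {t : ℝ} (ht : 0 < t) (τ α β : ℝ) {a b : Prop} (ha : a) (hb : b) : mom t τ a b α β = t / 2 + α * β := by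
  simp only [mom, sel, ha, hb, if_true]
  have i1 : Integrable (fun p : ℝ × ℝ => p.1) ((gr t).prod (gr τ)) := (AM.fst (AM_gr t)).integrable
  have i2 : Integrable (fun p : ℝ × ℝ => p.2) ((gr t).prod (gr τ)) := (AM.snd (AM_gr τ)).integrable
  have i3 : Integrable (fun p : ℝ × ℝ => p.1 ^ 2) ((gr t).prod (gr τ)) := (AM.fst ((AM_gr t).pow 2)).integrable
  have i4 : Integrable (fun p : ℝ × ℝ => p.1 * p.2) ((gr t).prod (gr τ)) := ((AM.fst (AM_gr t)).mul (AM.snd (AM_gr τ))).integrable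
  have i5 : Integrable (fun p : ℝ × ℝ => p.1 ^ 2 + p.1 * p.2) ((gr t).prod (gr τ)) := i3.add i4
  have i6 : Integrable (fun p : ℝ × ℝ => p.1 ^ 2 + p.1 * p.2 - (α + β) * p.1) ((gr t).prod (gr τ)) := i5.sub (i1.const_mul _)
  have i7 : Integrable (fun p : ℝ × ℝ => p.1 ^ 2 + p.1 * p.2 - (α + β) * p.1 - α * p.2) ((gr t).prod (gr τ)) := i6.sub (i2.const_mul _)
  have : ∀ p : ℝ × ℝ, (p.1 - α) * (p.1 + p.2 - β) = p.1 ^ 2 + p.1 * p.2 - (α + β) * p.1 - α * p.2 + α * β := by intro p; ring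
  rw [integral_congr_ae (Filter.Eventually.of_forall this), integral_add i7 (integrable_const _), integral_sub i6 (i2.const_mul _),
    integral_sub i5 (i1.const_mul _), integral_add i3 i4, MeasureTheory.integral_const_mul, MeasureTheory.integral_const_mul,
    int_fst t τ (fun x => x), int_snd t τ (fun x => x), gr_m1, gr_m1, int_fst t τ (fun x => x ^ 2), gr_m2 ht,
    integral_prod_mul (fun x : ℝ => x) (fun x : ℝ => x), gr_m1]
  simp

lemma mom_prod {m : ℕ} {t : ℝ} (ht : 0 < t) (τ y x : ℝ) (i j l : Fin m) :
    ∏ k, mom t τ (k = i) (k = j) (delta k l y) (delta k l x) = if i = j then t / 2 + (if i = l then x * y else 0) else 0 := by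
  by_cases hij : i = j
  · subst hij
    rw [if_pos rfl, Finset.prod_eq_single i]
    · rw [mom_tt ht _ _ _ rfl rfl]
      unfold delta; split_ifs <;> ring
    · intro b _ hb; exact mom_ff _ _ _ _ hb hb
    · simp
  · rw [if_neg hij]
    by_cases hil : i = l
    · apply Finset.prod_eq_zero (Finset.mem_univ j)
      rw [mom_ft _ _ _ _ (Ne.symm hij) rfl, delta, if_neg (by rw [← hil]; exact Ne.symm hij), neg_zero]
    · apply Finset.prod_eq_zero (Finset.mem_univ i)
      rw [mom_tf _ _ _ _ rfl hij, delta, if_neg hil, neg_zero]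

noncomputable def Wm {m : ℕ} (t τ ε1 ε2 z z' y x : ℝ) (i j : Fin (m+3)) : ℝ :=
  ∏ k : Fin (m+3), rowA t τ ε1 ε2 z z' (delta k 0 y) (delta k 1 y) (delta k 0 x) (delta k 1 x) (k = i) (k = j)

lemma int_rowF {m : ℕ} {t : ℝ} (ht : 0 < t) (τ ε1 ε2 : ℝ) (z z' y x : ℝ) (σ π : Equiv.Perm (Fin (m+3))) :
    ∫ p, ∏ k, rowF ε1 ε2 z z' y x σ π k (fun l => (p.1 k l, p.2 k l)) ∂((gm (m+3) t).prod (gm (m+3) τ)) =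
    Wm t τ ε1 ε2 z z' y x (σ 1) (π 1) *
      ∏ l : Fin (m+1), (if σ l.succ.succ = π l.succ.succ then (t / 2 + if σ l.succ.succ = l.succ.succ then x * y else 0) else 0) := by
  rw [gm_pair (m+3) t τ (fun p => ∏ k, rowF ε1 ε2 z z' y x σ π k (fun l => (p.1 k l, p.2 k l)))]
  simp only [Prod.mk.eta]
  rw [integral_fintype_prod_eq_prod (f := fun k (q : Fin (m+3) → ℝ × ℝ) => rowF ε1 ε2 z z' y x σ π k q)]
  have : ∀ k, ∫ q, rowF ε1 ε2 z z' y x σ π k q ∂(Measure.pi fun _ => (gr t).prod (gr τ)) =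
     rowA t τ ε1 ε2 z z' (delta k 0 y) (delta k 1 y) (delta k 0 x) (delta k 1 x) (k = σ 1) (k = π 1) *
      ∏ l : Fin (m+1), mom t τ (k = σ l.succ.succ) (k = π l.succ.succ) (delta k l.succ.succ y) (delta k l.succ.succ x) := by
    intro k
    exact split2 ((gr t).prod (gr τ)) (m+1) (rowG ε1 ε2 z z' (delta k 0 y) (delta k 1 y) (delta k 0 x) (delta k 1 x) (k = σ 1) (k = π 1))
      (fun l o => sel (k = σ l.succ.succ) (o.1 - delta k l.succ.succ y) * sel (k = π l.succ.succ) (o.1 + o.2 - delta k l.succ.succ x))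
  simp only [this]
  rw [Finset.prod_mul_distrib, Finset.prod_comm]
  simp only [mom_prod ht]
  rfl

lemma KU {m : ℕ} {t : ℝ} (ht : 0 < t) (τ : ℝ) {ε1 ε2 : ℝ} (h1 : 0 < ε1) (h2 : 0 < ε2) (z z' y x : ℝ) (w : Fin (m+3) → ℝ)
    (hw : w = z • Pi.single 0 1 + z' • Pi.single 1 1) :
    Kf t τ ε1 ε2 y x (Pi.single 0 1) w =
     (t/2) ^ (m+1) * Epoly (m+1) (2 * x * y / t) * (z * Wm (m := m) t τ ε1 ε2 z z' y x 1 1 - z' * Wm (m := m) t τ ε1 ε2 z z' y x 1 0) +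
     ((t/2) ^ (m+1) * Epoly (m+1) (2 * x * y / t) - x * y * ((t/2) ^ m * Epoly m (2 * x * y / t))) *
       (z * ∑ j : Fin (m+1), Wm t τ ε1 ε2 z z' y x j.succ.succ j.succ.succ) := by
  have hb := beta z z' (t/2) (x * y) (by positivity) w (by simp [hw]) (by simp [hw])
    (by intro l
        have h1 : l.succ.succ ≠ 1 := by
          intro h; have := congrArg Fin.val h; simp at this
        simp [hw, h1]) (Wm t τ ε1 ε2 z z' y x)
  have e : x * y / (t / 2) = 2 * x * y / t := by field_simp
  rw [e] at hb
  rw [← hb, Kf]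
  simp_rw [KI_expand ε1 ε2 z z' y x w hw]
  rw [MeasureTheory.integral_finsetSum]
  swap
  · intro σ _
    exact (AM.sum _ fun π _ => (AM.const _).mul (AM.prod _ fun k _ => AM_rowF t τ h1 h2 z z' y x σ π k)).integrable
  refine Finset.sum_congr rfl fun σ _ => ?_
  rw [MeasureTheory.integral_finsetSum]
  swap
  · intro π _
    exact ((AM.const _).mul (AM.prod _ fun k _ => AM_rowF t τ h1 h2 z z' y x σ π k)).integrable
  refine Finset.sum_congr rfl fun π _ => ?_
  rw [MeasureTheory.integral_const_mul, int_rowF ht]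
  ring

end MDR

open MeasureTheory Matrix Nat intervalIntegral
open scoped Classical

namespace MDR
open ProbabilityTheory

/-- integrand of rhoMod, without the sphere weight -/
noncomputable def Jf (N : ℕ) (t τ y x z : ℝ) : ℝ :=
  (τ / t + (1 - z ^ 2)) ^ (-(N : ℝ) / 2) *
        Real.exp (-(x ^ 2 - 2 * z ^ 2 * x * y + y ^ 2 * (1 + τ / t)) /
          (τ + t * (1 - z ^ 2))) *
        ((x - y * (1 - z ^ 2) * (t + τ) / (τ + t * (1 - z ^ 2))) *
            (y - x * (1 - z ^ 2) * t / (τ + t * (1 - z ^ 2))) * Epoly (N - 2) (2 * x * y / t) +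
          ((N : ℝ) - 1) * t * τ * z ^ 2 / (2 * (τ + t * (1 - z ^ 2))) *
            Epoly (N - 2) (2 * x * y / t) -
          ((N : ℝ) - 2) * t * τ * z ^ 2 / (2 * (τ + t * (1 - z ^ 2))) * (2 * x * y / t) *
            Epoly (N - 3) (2 * x * y / t))

lemma Epoly_cont (n : ℕ) : Continuous (Epoly n) := by unfold Epoly; fun_prop

lemma Wm_bdd {m : ℕ} {t τ : ℝ} (ht : 0 < t) (hτ : 0 < τ) (R : ℝ) : ∃ C : ℝ, 0 ≤ C ∧ ∀ (ε1 ε2 z z' y x : ℝ) (i j : Fin (m+3)),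
    0 < ε1 → 0 < ε2 → z ^ 2 + z' ^ 2 = 1 → |y| ≤ R → |x| ≤ R →
    |Wm t τ ε1 ε2 z z' y x i j| ≤ C := by
  obtain ⟨C, hC, h⟩ := rowA_bdd ht hτ R
  refine ⟨C ^ (m+3), by positivity, ?_⟩
  intro ε1 ε2 z z' y x i j h1 h2 hz hy hx
  have hd : ∀ (k l : Fin (m+3)) (a : ℝ), |a| ≤ R → |delta k l a| ≤ R := by
    intro k l a ha
    unfold delta; split_ifs
    · exact ha
    · simp; exact (abs_nonneg _).trans ha
  unfold Wm
  rw [Finset.abs_prod]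
  refine (Finset.prod_le_prod (fun _ _ => abs_nonneg _) (g := fun _ => C) fun k _ => ?_).trans ?_
  · exact h _ _ _ _ _ _ _ _ _ _ h1 h2 hz (hd _ _ _ hy) (hd _ _ _ hy) (hd _ _ _ hx) (hd _ _ _ hx)
  · simp

lemma Ep_bdd (n : ℕ) (t R : ℝ) : ∃ C : ℝ, ∀ x y : ℝ, |y| ≤ R → |x| ≤ R → |Epoly n (2 * x * y / t)| ≤ C := by
  have hk : IsCompact (Set.Icc (-R) R ×ˢ Set.Icc (-R) R) := isCompact_Icc.prod isCompact_Icc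
  obtain ⟨C, hC⟩ := hk.exists_bound_of_continuousOn (f := fun p : ℝ × ℝ => Epoly n (2 * p.1 * p.2 / t))
    (Continuous.continuousOn (by have := Epoly_cont n; fun_prop))
  refine ⟨C, fun x y hy hx => ?_⟩
  exact hC (x, y) ⟨abs_le.mp hx, abs_le.mp hy⟩

lemma KU_bdd (m : ℕ) {t τ : ℝ} (ht : 0 < t) (hτ : 0 < τ) (R : ℝ) : ∃ C : ℝ, 0 ≤ C ∧ ∀ (ε1 ε2 z z' y x : ℝ) (w : Fin (m+3) → ℝ),
    0 < ε1 → 0 < ε2 → z ^ 2 + z' ^ 2 = 1 → |y| ≤ R → |x| ≤ R → w = z • Pi.single 0 1 + z' • Pi.single 1 1 →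
    |Kf t τ ε1 ε2 y x (Pi.single 0 1) w| ≤ C := by
  obtain ⟨C, hC, h⟩ := Wm_bdd (m := m) ht hτ R
  obtain ⟨E1, hE1⟩ := Ep_bdd (m+1) t R
  obtain ⟨E2, hE2⟩ := Ep_bdd m t R
  refine ⟨(t/2) ^ (m+1) * |E1| * (1 * C + 1 * C) + ((t/2) ^ (m+1) * |E1| + |R| * |R| * ((t/2) ^ m * |E2|)) * (1 * ∑ j : Fin (m+1), C), by positivity, ?_⟩
  intro ε1 ε2 z z' y x w h1 h2 hz hy hx hw
  rw [KU ht τ h1 h2 z z' y x w hw]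
  have hz1 : |z| ≤ 1 := by rw [abs_le]; constructor <;> nlinarith
  have hz2 : |z'| ≤ 1 := by rw [abs_le]; constructor <;> nlinarith
  have hW : ∀ i j, |Wm (m := m) t τ ε1 ε2 z z' y x i j| ≤ C := fun i j => h _ _ _ _ _ _ i j h1 h2 hz hy hx
  have a1 : |Epoly (m+1) (2 * x * y / t)| ≤ |E1| := (hE1 x y hy hx).trans (le_abs_self _)
  have a2 : |Epoly m (2 * x * y / t)| ≤ |E2| := (hE2 x y hy hx).trans (le_abs_self _)
  have hR : R ≤ |R| := le_abs_self _
  refine (abs_add_le _ _).trans (add_le_add ?_ ?_)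
  · rw [abs_mul, abs_mul, abs_of_nonneg (by positivity : 0 ≤ (t/2)^(m+1))]
    refine mul_le_mul (mul_le_mul_of_nonneg_left a1 (by positivity)) ?_ (abs_nonneg _) (by positivity)
    refine (abs_sub _ _).trans (add_le_add ?_ ?_) <;> rw [abs_mul]
    · exact mul_le_mul hz1 (hW _ _) (abs_nonneg _) zero_le_one
    · exact mul_le_mul hz2 (hW _ _) (abs_nonneg _) zero_le_one
  · rw [abs_mul]
    refine mul_le_mul ?_ ?_ (abs_nonneg _) (by positivity)
    · refine (abs_sub _ _).trans (add_le_add ?_ ?_)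
      · rw [abs_mul, abs_of_nonneg (by positivity : 0 ≤ (t/2)^(m+1))]
        exact mul_le_mul_of_nonneg_left a1 (by positivity)
      · rw [abs_mul, abs_mul, abs_mul, abs_of_nonneg (by positivity : 0 ≤ (t/2)^m)]
        have : 0 ≤ R := (abs_nonneg _).trans hx
        exact mul_le_mul (mul_le_mul (hx.trans hR) (hy.trans hR) (abs_nonneg _) (abs_nonneg _)) (mul_le_mul_of_nonneg_left a2 (by positivity))
          (by positivity) (by positivity)
    · rw [abs_mul]
      refine mul_le_mul hz1 ?_ (abs_nonneg _) zero_le_one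
      exact (Finset.abs_sum_le_sum_abs _ _).trans (Finset.sum_le_sum fun j _ => hW _ _)

noncomputable def W0 {m : ℕ} (t τ z z' y x : ℝ) (i j : Fin (m+3)) : ℝ :=
  ∏ k : Fin (m+3), row0 t τ z z' (delta k 0 y) (delta k 1 y) (delta k 0 x) (delta k 1 x) (k = i) (k = j)

noncomputable def K0 (m : ℕ) (t τ z z' y x : ℝ) : ℝ :=
     (t/2) ^ (m+1) * Epoly (m+1) (2 * x * y / t) * (z * W0 (m := m) t τ z z' y x 1 1 - z' * W0 (m := m) t τ z z' y x 1 0) +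
     ((t/2) ^ (m+1) * Epoly (m+1) (2 * x * y / t) - x * y * ((t/2) ^ m * Epoly m (2 * x * y / t))) *
       (z * ∑ j : Fin (m+1), W0 t τ z z' y x j.succ.succ j.succ.succ)

lemma KU_lim {m : ℕ} {t τ : ℝ} (ht : 0 < t) (hτ : 0 < τ) {e1 e2 : ℕ → ℝ} (p1 : ∀ n, 0 < e1 n) (p2 : ∀ n, 0 < e2 n)
    (l1 : Filter.Tendsto e1 Filter.atTop (nhds 0)) (l2 : Filter.Tendsto e2 Filter.atTop (nhds 0))
    (z z' y x : ℝ) (w : Fin (m+3) → ℝ) (hz : z ^ 2 + z' ^ 2 = 1) (hw : w = z • Pi.single 0 1 + z' • Pi.single 1 1) :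
    Filter.Tendsto (fun n => Kf t τ (e1 n) (e2 n) y x (Pi.single 0 1) w) Filter.atTop (nhds (K0 m t τ z z' y x)) := by
  have : ∀ n, Kf t τ (e1 n) (e2 n) y x (Pi.single 0 1) w = _ := fun n => KU ht τ (p1 n) (p2 n) z z' y x w hw
  simp only [this]
  have hW : ∀ i j, Filter.Tendsto (fun n => Wm (m := m) t τ (e1 n) (e2 n) z z' y x i j) Filter.atTop (nhds (W0 t τ z z' y x i j)) := by
    intro i j
    exact tendsto_finsetProd _ fun k _ => rowA_lim ht hτ p1 p2 l1 l2 _ _ _ _ _ _ _ _ hz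
  unfold K0
  refine Filter.Tendsto.add (((((hW _ _).const_mul _).sub ((hW _ _).const_mul _))).const_mul _) (Filter.Tendsto.const_mul _ (Filter.Tendsto.const_mul _ ?_))
  exact tendsto_finsetSum _ fun j _ => hW _ _

lemma K0_eq (m : ℕ) {t τ : ℝ} (ht : 0 < t) (hτ : 0 < τ) (z z' y x : ℝ) (hz : z ^ 2 + z' ^ 2 = 1) :
    K0 m t τ z z' y x = 4 / (t ^ 2 * (2 * Real.pi) ^ (m+3)) * Jf (m+3) t τ y x z := by
  set D := τ + t * z' ^ 2 with hD
  have hD0 : 0 < D := by rw [hD]; positivity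
  set B := (∏ k : Fin (m+3), ph t (delta k 0 y)) * ∏ k : Fin (m+3), ph D (z * (delta k 0 x - delta k 0 y) + z' * delta k 1 x) with hB
  set μ : Fin (m+3) → ℝ := fun k => z' * t * (z * (delta k 0 x - delta k 0 y) + z' * delta k 1 x) / D with hμ
  set κ : Fin (m+3) → ℝ := fun k => z * delta k 1 x + z' * (delta k 0 y - delta k 0 x) with hκ
  set v := t * τ / (2 * D) with hv
  have hW : ∀ i j, W0 (m := m) t τ z z' y x i j = B * ∏ k, (if k = i then (if k = j then z * v + (μ k - delta k 1 y) * (z * μ k - κ k) else μ k - delta k 1 y) else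
      (if k = j then z * μ k - κ k else 1)) := by
    intro i j
    unfold W0
    rw [hB, ← Finset.prod_mul_distrib, ← Finset.prod_mul_distrib]
    refine Finset.prod_congr rfl fun k _ => ?_
    rw [row0_eq ht hτ z z' _ _ _ _ _ _ D _ (μ k) (κ k) hD rfl rfl rfl, mul_assoc]
    congr
  have hii : ∀ i, W0 (m := m) t τ z z' y x i i = B * (z * v + (μ i - delta i 1 y) * (z * μ i - κ i)) := by
    intro i
    rw [hW, Finset.prod_eq_single i]
    · simp
    · intro b _ hb; simp [hb]
    · simp
  have h10 : W0 (m := m) t τ z z' y x 1 0 = B * ((μ 1 - y) * (z * μ 0 - κ 0)) := by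
    rw [hW, Fin.prod_univ_succ, Fin.prod_univ_succ]
    have : ∀ l : Fin (m+1), l.succ.succ ≠ 1 := by
          intro l h; have := congrArg Fin.val h; simp at this
    simp [this, delta]
    left; ring
  have h2 : ∀ j : Fin (m+1), W0 (m := m) t τ z z' y x j.succ.succ j.succ.succ = B * (z * v) := by
    intro l
    have : l.succ.succ ≠ 1 := by
          intro h; have := congrArg Fin.val h; simp at this
    rw [hii]
    simp [hμ, hκ, delta, this]
  have hBe : B = (√(Real.pi * t))⁻¹ ^ (m+3) * (√(Real.pi * D))⁻¹ ^ (m+3) * Real.exp (-(x ^ 2 - 2 * z ^ 2 * x * y + y ^ 2 * (1 + τ / t)) / D) := by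
    rw [hB]
    simp only [ph, Finset.prod_mul_distrib, Finset.prod_const, Finset.card_univ, Fintype.card_fin, ← Real.exp_sum]
    rw [mul_mul_mul_comm, ← Real.exp_add]
    congr 2
    rw [Fin.sum_univ_succ, Fin.sum_univ_succ, Fin.sum_univ_succ (n := m+2), Fin.sum_univ_succ (n := m+1)]
    have : ∀ l : Fin (m+1), l.succ.succ ≠ 1 := by
          intro l h; have := congrArg Fin.val h; simp at this
    simp [this, delta]
    have e1 : -y ^ 2 / t = - (y ^ 2 * (τ / t + z' ^ 2)) / D := by
      rw [hD]; field_simp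
    rw [e1]
    rw [← add_div, ← add_div]
    congr 1
    linear_combination (-y ^ 2 - x ^ 2) * hz
  have hDz : τ + t * (1 - z ^ 2) = D := by rw [hD]; linear_combination (-t) * hz
  have hpow : (√(Real.pi * t))⁻¹ ^ (m+3) * (√(Real.pi * D))⁻¹ ^ (m+3) = (Real.pi ^ (m+3) * t ^ (m+3))⁻¹ * (τ / t + (1 - z ^ 2)) ^ (-((m+3 : ℕ) : ℝ) / 2) := by
    have hq : τ / t + (1 - z ^ 2) = D / t := by rw [← hDz]; field_simp
    have hp : (D / t) ^ (-((m+3 : ℕ) : ℝ) / 2) = (√(D/t))⁻¹ ^ (m+3) := by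
      rw [Real.sqrt_eq_rpow, ← Real.rpow_neg (by positivity), ← Real.rpow_natCast, ← Real.rpow_mul (by positivity)]
      congr 1; ring
    rw [hq, hp, ← mul_pow, ← mul_pow, ← inv_pow, ← mul_pow]
    congr 1
    rw [← mul_inv, ← mul_inv, ← Real.sqrt_mul (by positivity)]
    congr 1
    have : Real.pi * t * (Real.pi * D) = (Real.pi * t) ^ 2 * (D / t) := by field_simp
    rw [this, Real.sqrt_mul (by positivity), Real.sqrt_sq (by positivity)]
  rw [hpow] at hBe
  set r := (τ / t + (1 - z ^ 2)) ^ (-((m+3 : ℕ) : ℝ) / 2) with hr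
  set ex := Real.exp (-(x ^ 2 - 2 * z ^ 2 * x * y + y ^ 2 * (1 + τ / t)) / D) with hex
  have hJ : Jf (m+3) t τ y x z = r * ex * ((x - y * (1 - z ^ 2) * (t + τ) / D) *
            (y - x * (1 - z ^ 2) * t / D) * Epoly (m+1) (2 * x * y / t) +
          (((m+3:ℕ) : ℝ) - 1) * t * τ * z ^ 2 / (2 * D) *
            Epoly (m+1) (2 * x * y / t) -
          (((m+3:ℕ) : ℝ) - 2) * t * τ * z ^ 2 / (2 * D) * (2 * x * y / t) *
            Epoly m (2 * x * y / t)) := by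
    unfold Jf
    rw [hDz]
    rfl
  have hm1 : μ 1 = z' * t * (z' * x) / D := by simp [hμ, delta]
  have hm0 : μ 0 = z' * t * (z * (x - y)) / D := by simp [hμ, delta]
  have hk1 : κ 1 = z * x := by simp [hκ, delta]
  have hk0 : κ 0 = z' * (y - x) := by simp [hκ, delta]
  have hP : (z * (z * v + (μ 1 - y) * (z * μ 1 - κ 1)) - z' * ((μ 1 - y) * (z * μ 0 - κ 0))) =
      z ^ 2 * v + (x - y * (1 - z ^ 2) * (t + τ) / D) * (y - x * (1 - z ^ 2) * t / D) := by
    rw [hm1, hm0, hk1, hk0]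
    have a1 : (z' * t * (z' * x) / D - y) = - (y - x * (1 - z ^ 2) * t / D) := by
      field_simp
      linear_combination (x * t) * hz
    have a2 : z * (z * (z' * t * (z' * x) / D) - z * x) - z' * (z * (z' * t * (z * (x - y)) / D) - z' * (y - x)) = - (x - y * (1 - z ^ 2) * (t + τ) / D) := by
      have hz' : z' ^ 2 = 1 - z ^ 2 := by linarith
      rw [← hz']
      have e : t + τ = D + t * z ^ 2 := by rw [hD]; linear_combination (-t) * hz
      rw [e]
      field_simp
      linear_combination (-x * D) * hz
    linear_combination (z * (z * (z' * t * (z' * x) / D) - z * x) - z' * (z * (z' * t * (z * (x - y)) / D) - z' * (y - x))) * a1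
      - (y - x * (1 - z ^ 2) * t / D) * a2
  unfold K0
  rw [hii 1, h10]
  simp only [h2, Finset.sum_const, Finset.card_univ, Fintype.card_fin, nsmul_eq_mul]
  have hd1 : delta (1 : Fin (m+3)) 1 y = y := by simp [delta]
  rw [hd1]
  have hc : 4 / (t ^ 2 * (2 * Real.pi) ^ (m+3)) = (t/2) ^ (m+1) * (Real.pi ^ (m+3) * t ^ (m+3))⁻¹ := by
    rw [mul_pow, div_pow]
    field_simp
    ring
  have hs : x * y * (t/2) ^ m = (t/2) ^ (m+1) * (2 * x * y / t) := by
    rw [pow_succ]; field_simp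
  have hf : ∀ E1 E2 : ℝ, (t / 2) ^ (m + 1) * E1 * (z * (B * (z * v + (μ 1 - y) * (z * μ 1 - κ 1))) - z' * (B * ((μ 1 - y) * (z * μ 0 - κ 0)))) +
    ((t / 2) ^ (m + 1) * E1 - x * y * ((t / 2) ^ m * E2)) * (z * (((m + 1 : ℕ) : ℝ) * (B * (z * v)))) =
    (t/2) ^ (m+1) * B * (E1 * (z ^ 2 * v + (x - y * (1 - z ^ 2) * (t + τ) / D) * (y - x * (1 - z ^ 2) * t / D)) + (E1 - (2 * x * y / t) * E2) * (z ^ 2 * v * ((m+1:ℕ) : ℝ))) := by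
    intro E1 E2
    linear_combination ((t / 2) ^ (m + 1) * E1 * B) * hP - (E2 * (z * (((m + 1 : ℕ) : ℝ) * (B * (z * v))))) * hs
  rw [hf, hJ, hc, hBe]
  push_cast
  have hv' : t * τ * z ^ 2 / (2 * D) = z ^ 2 * v := by rw [hv]; ring
  have e3 : ((m:ℝ) + 3 - 1) * t * τ * z ^ 2 / (2 * D) = (m + 3 - 1) * (z ^ 2 * v) := by rw [← hv']; ring
  have e4 : ((m:ℝ) + 3 - 2) * t * τ * z ^ 2 / (2 * D) = (m + 3 - 2) * (z ^ 2 * v) := by rw [← hv']; ring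
  rw [e3, e4]
  ring

end MDR

open MeasureTheory Matrix Nat intervalIntegral
open scoped Classical

namespace MDR
open ProbabilityTheory

lemma prod_ph {N : ℕ} (ε : ℝ) (v : Fin N → ℝ) : ∏ k, ph ε (v k) = (√(Real.pi * ε))⁻¹ ^ N * Real.exp (- (v ⬝ᵥ v) / ε) := by
  simp only [ph, Finset.prod_mul_distrib, Finset.prod_const, Finset.card_univ, Fintype.card_fin, ← Real.exp_sum, dotProduct]
  congr 2
  rw [← Finset.sum_div]
  congr 1
  rw [← Finset.sum_neg_distrib]
  exact Finset.sum_congr rfl fun i _ => by ring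

lemma ph_mul {ε r : ℝ} (hr : r ≠ 0) (x : ℝ) : ph ε (r * x) = |r|⁻¹ * ph (ε / r ^ 2) x := by
  unfold ph
  have h1 : (√(Real.pi * ε))⁻¹ = |r|⁻¹ * (√(Real.pi * (ε / r ^ 2)))⁻¹ := by
    rw [← mul_inv, ← Real.sqrt_sq_eq_abs, ← Real.sqrt_mul (by positivity)]
    congr 2
    field_simp
  rw [h1, mul_assoc]
  congr 3
  field_simp

lemma Qf_smul {N : ℕ} {ε r : ℝ} (hr : r ≠ 0) (X : Matrix (Fin N) (Fin N) ℝ) (u : Fin N → ℝ) :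
    Qf ε X (r • u) = (|r| ^ 2 / |r| ^ N) * Qf (ε / r ^ 2) X u := by
  unfold Qf
  simp only [mulVec_smul, smul_dotProduct, dotProduct_smul, Pi.smul_apply, smul_eq_mul, ph_mul hr, Finset.prod_mul_distrib,
    Finset.prod_const, Finset.card_univ, Fintype.card_fin, sq_abs, inv_pow]
  have : |r| ^ N ≠ 0 := pow_ne_zero _ (abs_ne_zero.mpr hr)
  field_simp

lemma Qf_conj {N : ℕ} (ε : ℝ) (X O : Matrix (Fin N) (Fin N) ℝ) (hO : O * Oᵀ = 1) (u : Fin N → ℝ) :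
    Qf ε (Oᵀ * X * O) u = Qf ε X (O *ᵥ u) := by
  have hO' : Oᵀ * O = 1 := by rw [← mul_eq_one_comm]; exact hO
  have hdet : O.det * O.det = 1 := by
    have := congrArg Matrix.det hO
    simpa using this
  have ha : O.adjugate = O.det • Oᵀ := by
    have := congrArg (· * Oᵀ) (adjugate_mul O)
    simp only [Matrix.mul_assoc, hO, Matrix.mul_one] at this
    rw [this]; simp
  have ha' : (Oᵀ).adjugate = O.det • O := by
    rw [← adjugate_transpose, ha]; simp
  have hadj : (Oᵀ * X * O).adjugate = Oᵀ * X.adjugate * O := by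
    rw [adjugate_mul_distrib, adjugate_mul_distrib, ha, ha']
    simp only [Matrix.smul_mul, Matrix.mul_smul, smul_smul, hdet, one_smul, Matrix.mul_assoc]
  unfold Qf
  rw [prod_ph, prod_ph, hadj]
  have e1 : u ⬝ᵥ (Oᵀ * X.adjugate * O) *ᵥ u = (O *ᵥ u) ⬝ᵥ X.adjugate *ᵥ (O *ᵥ u) := by
    rw [← mulVec_mulVec, ← mulVec_mulVec, dotProduct_mulVec, vecMul_transpose]
  have e2 : ((Oᵀ * X * O) *ᵥ u) ⬝ᵥ ((Oᵀ * X * O) *ᵥ u) = (X *ᵥ (O *ᵥ u)) ⬝ᵥ (X *ᵥ (O *ᵥ u)) := by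
    rw [← mulVec_mulVec, ← mulVec_mulVec, dotProduct_mulVec, vecMul_transpose, mulVec_mulVec (M := O), hO, one_mulVec]
  rw [e1, e2]

lemma Xm_conj {N : ℕ} (O : Matrix (Fin N) (Fin N) ℝ) (hO : O * Oᵀ = 1) (H : Fin N → Fin N → ℝ) (y : ℝ) :
    Xm (fun i j => (Oᵀ * Matrix.of H * O) i j) y = Oᵀ * Xm H y * O := by
  have hO' : Oᵀ * O = 1 := by rw [← mul_eq_one_comm]; exact hO
  unfold Xm
  rw [Matrix.mul_sub, Matrix.sub_mul]
  have : Oᵀ * (Matrix.scalar (Fin N)) y * O = Matrix.scalar (Fin N) y := by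
    rw [scalar_apply, ← smul_one_eq_diagonal]; simp [hO']
  rw [this]
  rfl

lemma Kf_conj {N : ℕ} (t τ ε1 ε2 y x : ℝ) (O : Matrix (Fin N) (Fin N) ℝ) (hO : O * Oᵀ = 1) (u w : Fin N → ℝ) :
    Kf t τ ε1 ε2 y x u w = Kf t τ ε1 ε2 y x (O *ᵥ u) (O *ᵥ w) := by
  have mp := (gm_conj (N := N) t O hO).prod (gm_conj (N := N) τ O hO)
  unfold Kf
  conv_lhs => rw [← mp.map_eq]
  rw [integral_map mp.measurable.aemeasurable]
  · refine integral_congr_ae (Filter.Eventually.of_forall fun p => ?_)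
    simp only [Prod.map]
    rw [Xm_conj O hO]
    have : ((fun i j => (Oᵀ * Matrix.of p.1 * O) i j) + (fun i j => (Oᵀ * Matrix.of p.2 * O) i j)) =
       (fun i j => (Oᵀ * Matrix.of (p.1 + p.2) * O) i j) := by
      ext i j
      have : Matrix.of (p.1 + p.2) = Matrix.of p.1 + Matrix.of p.2 := rfl
      rw [this, Matrix.mul_add, Matrix.add_mul]; rfl
    rw [this, Xm_conj O hO, Qf_conj _ _ _ hO, Qf_conj _ _ _ hO]
  · refine Continuous.aestronglyMeasurable ?_
    unfold Qf Xm
    have h1 := ph_cont ε1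
    have h2 := ph_cont ε2
    have c : ∀ y : ℝ, Continuous (fun p : (Fin N → Fin N → ℝ) × (Fin N → Fin N → ℝ) => Matrix.of p.1 - Matrix.scalar (Fin N) y) := by
      intro y
      exact continuous_fst.sub continuous_const
    have c' : ∀ y : ℝ, Continuous (fun p : (Fin N → Fin N → ℝ) × (Fin N → Fin N → ℝ) => Matrix.of (p.1 + p.2) - Matrix.scalar (Fin N) y) := by
      intro y
      refine Continuous.sub ?_ continuous_const
      have : Continuous (fun p : (Fin N → Fin N → ℝ) × (Fin N → Fin N → ℝ) => p.1 + p.2) := continuous_fst.add continuous_snd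
      exact this
    refine Continuous.mul (Continuous.mul ?_ ?_) (Continuous.mul ?_ ?_)
    · exact Continuous.dotProduct continuous_const ((c y).matrix_adjugate.matrix_mulVec continuous_const)
    · exact continuous_finsetProd _ fun k _ => h1.comp ((continuous_apply k).comp ((c y).matrix_mulVec continuous_const))
    · exact Continuous.dotProduct continuous_const ((c' x).matrix_adjugate.matrix_mulVec continuous_const)
    · exact continuous_finsetProd _ fun k _ => h2.comp ((continuous_apply k).comp ((c' x).matrix_mulVec continuous_const))

lemma Kf_smul {N : ℕ} (t τ ε1 ε2 y x : ℝ) {r s : ℝ} (hr : r ≠ 0) (hs : s ≠ 0) (u w : Fin N → ℝ) :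
    Kf t τ ε1 ε2 y x (r • u) (s • w) = (|r| ^ 2 / |r| ^ N) * (|s| ^ 2 / |s| ^ N) * Kf t τ (ε1 / r ^ 2) (ε2 / s ^ 2) y x u w := by
  unfold Kf
  rw [← MeasureTheory.integral_const_mul]
  refine integral_congr_ae (Filter.Eventually.of_forall fun p => ?_)
  simp only [Qf_smul hr, Qf_smul hs]
  ring

lemma exists_frame {m : ℕ} (u w : Fin (m+2) → ℝ) : ∃ O : Matrix (Fin (m+2)) (Fin (m+2)) ℝ, O * Oᵀ = 1 ∧
    (∃ c : ℝ, O *ᵥ u = c • Pi.single 0 1) ∧ ∃ a b : ℝ, O *ᵥ w = a • Pi.single 0 1 + b • Pi.single 1 1 := by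
  let f : Fin (m+2) → EuclideanSpace ℝ (Fin (m+2)) := fun i => if i = 0 then WithLp.toLp 2 u else if i = 1 then WithLp.toLp 2 w else 0
  let b := InnerProductSpace.gramSchmidtOrthonormalBasis (𝕜 := ℝ) (by simp) f
  have htri : ∀ i j, i < j → inner ℝ (b j) (f i) = 0 := by
    intro i j h
    exact InnerProductSpace.gramSchmidtOrthonormalBasis_inv_triangular _ f h
  refine ⟨Matrix.of fun j k => b j k, ?_, ?_, ?_⟩
  · ext i j
    have := b.inner_eq_ite i j
    rw [PiLp.inner_apply] at this
    simp only [RCLike.inner_apply, conj_trivial] at this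
    rw [Matrix.mul_apply, Matrix.one_apply, ← this]
    exact Finset.sum_congr rfl fun k _ => mul_comm (b i k) (b j k)
  · refine ⟨inner ℝ (b 0) (f 0), ?_⟩
    have h : ∀ j, ((Matrix.of fun j k => b j k : Matrix (Fin (m+2)) (Fin (m+2)) ℝ) *ᵥ u) j = inner ℝ (b j) (f 0) := by
      intro j
      rw [PiLp.inner_apply]
      simp only [mulVec, dotProduct, Matrix.of_apply, RCLike.inner_apply, conj_trivial]
      exact Finset.sum_congr rfl fun k _ => by simp [f, mul_comm]
    ext j
    rw [h]
    by_cases hj : j = 0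
    · subst hj; simp
    · rw [htri 0 j (Fin.pos_of_ne_zero hj)]; simp [hj]
  · refine ⟨inner ℝ (b 0) (f 1), inner ℝ (b 1) (f 1), ?_⟩
    have h : ∀ j, ((Matrix.of fun j k => b j k : Matrix (Fin (m+2)) (Fin (m+2)) ℝ) *ᵥ w) j = inner ℝ (b j) (f 1) := by
      intro j
      rw [PiLp.inner_apply]
      simp only [mulVec, dotProduct, Matrix.of_apply, RCLike.inner_apply, conj_trivial]
      exact Finset.sum_congr rfl fun k _ => by simp [f, mul_comm]
    ext j
    rw [h]
    by_cases hj : j = 0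
    · subst hj; simp
    · by_cases hj1 : j = 1
      · subst hj1; simp
      · rw [htri 1 j]
        · simp [hj, hj1]
        · have h0 : j.val ≠ 0 := fun h => hj (Fin.ext h)
          have h1 : j.val ≠ 1 := fun h => hj1 (Fin.ext h)
          rw [Fin.lt_def]; simp; omega

/-- weight -/
noncomputable def wt {N : ℕ} (u : Fin N → ℝ) : ℝ := √(u ⬝ᵥ u) ^ 2 / √(u ⬝ᵥ u) ^ N

lemma Kf_red {m : ℕ} (t τ y x : ℝ) (u w : Fin (m+3) → ℝ) (hu : u ≠ 0) (hw : w ≠ 0) :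
    ∃ z z' : ℝ, z ^ 2 + z' ^ 2 = 1 ∧ z ^ 2 = ((u ⬝ᵥ w) / (√(u ⬝ᵥ u) * √(w ⬝ᵥ w))) ^ 2 ∧ ∀ ε1 ε2 : ℝ,
     Kf t τ ε1 ε2 y x u w = wt u * wt w * Kf t τ (ε1 / (u ⬝ᵥ u)) (ε2 / (w ⬝ᵥ w)) y x (Pi.single 0 1 : Fin (m+3) → ℝ) (z • Pi.single 0 1 + z' • Pi.single 1 1 : Fin (m+3) → ℝ) := by
  obtain ⟨O, hO, ⟨c, hc⟩, a, b, hab⟩ := exists_frame u w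
  have hO' : Oᵀ * O = 1 := by rw [← mul_eq_one_comm]; exact hO
  have hd : ∀ p q : Fin (m+3) → ℝ, (O *ᵥ p) ⬝ᵥ (O *ᵥ q) = p ⬝ᵥ q := by
    intro p q
    rw [dotProduct_mulVec, ← mulVec_transpose, mulVec_mulVec, hO', one_mulVec]
  have h1 : u ⬝ᵥ u = c ^ 2 := by rw [← hd, hc]; simp; ring
  have h2 : w ⬝ᵥ w = a ^ 2 + b ^ 2 := by rw [← hd, hab]; simp [add_dotProduct, dotProduct_add]; ring
  have h3 : u ⬝ᵥ w = c * a := by rw [← hd, hab, hc]; simp [dotProduct_add, mul_comm]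
  have hu0 : 0 < u ⬝ᵥ u := by
    have := (dotProduct_self_eq_zero (v := u)).not.mpr hu
    rcases lt_or_eq_of_le (by rw [h1]; positivity : 0 ≤ u ⬝ᵥ u) with h | h
    · exact h
    · exact absurd h.symm this
  have hw0 : 0 < w ⬝ᵥ w := by
    have := (dotProduct_self_eq_zero (v := w)).not.mpr hw
    rcases lt_or_eq_of_le (by rw [h2]; positivity : 0 ≤ w ⬝ᵥ w) with h | h
    · exact h
    · exact absurd h.symm this
  set s := √(w ⬝ᵥ w) with hs
  have hs0 : 0 < s := Real.sqrt_pos.mpr hw0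
  have hs2 : s ^ 2 = w ⬝ᵥ w := Real.sq_sqrt hw0.le
  have hc0 : c ≠ 0 := by rintro rfl; rw [h1] at hu0; simp at hu0
  have hcr : √(u ⬝ᵥ u) = |c| := by rw [h1, Real.sqrt_sq_eq_abs]
  refine ⟨a / s, b / s, ?_, ?_, ?_⟩
  · rw [div_pow, div_pow, ← add_div, hs2, ← h2, div_self hw0.ne']
  · rw [h3, hcr, div_pow, div_pow, mul_pow, mul_pow, sq_abs]
    field_simp
  · intro ε1 ε2
    rw [Kf_conj t τ ε1 ε2 y x O hO u w, hc, hab]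
    have : a • (Pi.single 0 1 : Fin (m+3) → ℝ) + b • Pi.single 1 1 = s • ((a / s) • Pi.single 0 1 + (b / s) • Pi.single 1 1) := by
      rw [smul_add, smul_smul, smul_smul, mul_div_cancel₀ _ hs0.ne', mul_div_cancel₀ _ hs0.ne']
    rw [this, Kf_smul t τ ε1 ε2 y x hc0 hs0.ne', abs_of_pos hs0, hs2, ← h1]
    unfold wt
    rw [hcr, ← hs, hs2]

lemma Jf_sq (N : ℕ) (t τ y x : ℝ) {z z1 : ℝ} (h : z ^ 2 = z1 ^ 2) : Jf N t τ y x z = Jf N t τ y x z1 := by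
  unfold Jf; rw [h]

lemma Kf_bdd (m : ℕ) {t τ : ℝ} (ht : 0 < t) (hτ : 0 < τ) (R : ℝ) : ∃ C : ℝ, 0 ≤ C ∧ ∀ (ε1 ε2 y x : ℝ) (u w : Fin (m+3) → ℝ),
    0 < ε1 → 0 < ε2 → |y| ≤ R → |x| ≤ R → u ≠ 0 → w ≠ 0 → |Kf t τ ε1 ε2 y x u w| ≤ C * (wt u * wt w) := by
  obtain ⟨C, hC, h⟩ := KU_bdd m ht hτ R
  refine ⟨C, hC, ?_⟩
  intro ε1 ε2 y x u w h1 h2 hy hx hu hw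
  obtain ⟨z, z', hz, _, hK⟩ := Kf_red t τ y x u w hu hw
  have hp : ∀ v : Fin (m+3) → ℝ, v ≠ 0 → 0 < v ⬝ᵥ v := by
    intro v hv
    have h := (dotProduct_self_eq_zero (v := v)).not.mpr hv
    have : 0 ≤ v ⬝ᵥ v := Finset.sum_nonneg fun i _ => mul_self_nonneg _
    exact lt_of_le_of_ne this (Ne.symm h)
  have hwt : ∀ v : Fin (m+3) → ℝ, 0 ≤ wt v := fun v => by unfold wt; positivity
  rw [hK, abs_mul, abs_of_nonneg (mul_nonneg (hwt u) (hwt w)), mul_comm]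
  exact mul_le_mul_of_nonneg_right (h _ _ _ _ _ _ _ (div_pos h1 (hp u hu)) (div_pos h2 (hp w hw)) hz hy hx rfl) (mul_nonneg (hwt u) (hwt w))

lemma Kf_lim {m : ℕ} {t τ : ℝ} (ht : 0 < t) (hτ : 0 < τ) {e : ℕ → ℝ} (p : ∀ n, 0 < e n)
    (l : Filter.Tendsto e Filter.atTop (nhds 0)) (y x : ℝ) (u w : Fin (m+3) → ℝ) (hu : u ≠ 0) (hw : w ≠ 0) :
    Filter.Tendsto (fun n => Kf t τ (e n) (e n) y x u w) Filter.atTop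
      (nhds (wt u * wt w * (4 / (t ^ 2 * (2 * Real.pi) ^ (m+3)) * Jf (m+3) t τ y x ((u ⬝ᵥ w) / (√(u ⬝ᵥ u) * √(w ⬝ᵥ w)))))) := by
  obtain ⟨z, z', hz, hzz, hK⟩ := Kf_red t τ y x u w hu hw
  have hp : ∀ v : Fin (m+3) → ℝ, v ≠ 0 → 0 < v ⬝ᵥ v := by
    intro v hv
    have h := (dotProduct_self_eq_zero (v := v)).not.mpr hv
    have : 0 ≤ v ⬝ᵥ v := Finset.sum_nonneg fun i _ => mul_self_nonneg _
    exact lt_of_le_of_ne this (Ne.symm h)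
  simp only [hK]
  rw [← Jf_sq _ _ _ _ _ hzz, ← K0_eq m ht hτ z z' y x hz]
  refine Filter.Tendsto.const_mul _ (KU_lim ht hτ (fun n => div_pos (p n) (hp u hu)) (fun n => div_pos (p n) (hp w hw)) ?_ ?_ z z' y x _ hz rfl)
  · simpa using l.div_const (u ⬝ᵥ u)
  · simpa using l.div_const (w ⬝ᵥ w)

end MDR

open MeasureTheory Matrix Nat intervalIntegral
open scoped Classical

namespace MDR
open ProbabilityTheory

lemma det_deriv {N : ℕ} (H : Fin N → Fin N → ℝ) (y : ℝ) :
    HasDerivAt (fun y => (Xm H y).det) (-(Xm H y).adjugate.trace) y := by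
  have hent : ∀ k l : Fin N, HasDerivAt (fun y => Xm H y k l) (-(if k = l then 1 else 0)) y := by
    intro k l
    simp only [Xm_apply, delta]
    by_cases h : k = l
    · simpa [h] using (hasDerivAt_id y).const_sub (H l l)
    · simpa [h] using hasDerivAt_const y (H k l)
  have h1 : HasDerivAt (fun y => (Xm H y).det)
      (∑ σ : Equiv.Perm (Fin N), ((Equiv.Perm.sign σ : ℤ) : ℝ) * ∑ i, (∏ j ∈ Finset.univ.erase i, Xm H y (σ j) j) • (-(if σ i = i then (1:ℝ) else 0))) y := by
    simp only [Matrix.det_apply']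
    refine HasDerivAt.fun_sum fun σ _ => HasDerivAt.const_mul _ ?_
    exact HasDerivAt.fun_finsetProd fun i _ => hent (σ i) i
  convert h1 using 1
  simp only [Matrix.trace, Matrix.diag]
  rw [← Finset.sum_neg_distrib]
  simp only [Finset.mul_sum]
  rw [Finset.sum_comm]
  refine Finset.sum_congr rfl fun i _ => ?_
  have : (Xm H y).adjugate i i = ((Xm H y).updateCol i (Pi.single i 1)).det := by
    rw [← Matrix.cramer_apply, Matrix.cramer_eq_adjugate_mulVec]; simp
  rw [this, Matrix.det_apply', ← Finset.sum_neg_distrib]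
  refine Finset.sum_congr rfl fun σ _ => ?_
  rw [← Finset.mul_prod_erase _ _ (Finset.mem_univ i)]
  have h2 : ∏ j ∈ Finset.univ.erase i, (Xm H y).updateCol i (Pi.single i 1) (σ j) j = ∏ j ∈ Finset.univ.erase i, Xm H y (σ j) j := by
    refine Finset.prod_congr rfl fun j hj => ?_
    rw [Matrix.updateCol_ne (Finset.ne_of_mem_erase hj)]
  rw [h2]
  by_cases h : σ i = i
  · simp [h]
  · simp [h]

/-- the regularized delta -/
noncomputable def gg {N : ℕ} (ε : ℝ) (v : Fin N → ℝ) : ℝ := ∏ k, ph ε (v k)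

lemma gg_line {N : ℕ} {ε : ℝ} {f f' : ℝ → Fin N → ℝ} {y : ℝ} (h : ∀ k, HasDerivAt (fun t => f t k) (f' y k) y) :
    HasDerivAt (fun t => gg ε (f t)) (gg ε (f y) * (-(2 / ε) * (f y ⬝ᵥ f' y))) y := by
  unfold gg
  simp only [prod_ph]
  have h1 : HasDerivAt (fun t => f t ⬝ᵥ f t) (2 * (f y ⬝ᵥ f' y)) y := by
    simp only [dotProduct]
    have : HasDerivAt (fun t => ∑ i, f t i * f t i) (∑ i, (f' y i * f y i + f y i * f' y i)) y :=
      HasDerivAt.fun_sum fun i _ => (h i).mul (h i)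
    convert this using 1
    rw [Finset.mul_sum]
    exact Finset.sum_congr rfl fun i _ => by ring
  have h2 := ((h1.fun_neg.div_const ε).exp).const_mul ((√(Real.pi * ε))⁻¹ ^ N)
  exact h2.congr_deriv (by ring)

lemma gv_density {ι : Type*} [Fintype ι] {s : ℝ} (hs : 0 < s) :
    gv ι s = (volume : Measure (ι → ℝ)).withDensity (fun u => ENNReal.ofReal (∏ k, ph s (u k))) := by
  unfold gv
  refine Measure.pi_eq fun S hS => ?_
  rw [withDensity_apply _ (MeasurableSet.univ_pi hS), volume_pi, Measure.restrict_pi_pi]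
  have hi : Integrable (ph s) volume := by
    have := integrable_gaussianPDFReal 0 (Real.toNNReal (s/2))
    exact this.congr (Filter.Eventually.of_forall fun x => ph_eq hs x)
  rw [← ofReal_integral_eq_lintegral_ofReal]
  · rw [integral_fintype_prod_eq_prod (fun _ => ph s), ENNReal.ofReal_prod_of_nonneg]
    · refine Finset.prod_congr rfl fun i _ => ?_
      rw [gaussianReal_apply_eq_integral _ (toNN_ne hs)]
      simp only [ph_eq hs]
    · intro i _
      exact integral_nonneg fun x => ph_nonneg _ _
  · exact Integrable.fintype_prod (f := fun _ => ph s) fun i => hi.restrict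
  · exact Filter.Eventually.of_forall fun x => Finset.prod_nonneg fun i _ => ph_nonneg _ _

lemma gg_cont {N : ℕ} (ε : ℝ) : Continuous (gg (N := N) ε) := by
  unfold gg
  exact continuous_finsetProd _ fun k _ => (ph_cont ε).comp (continuous_apply k)

lemma gg_nonneg {N : ℕ} (ε : ℝ) (v : Fin N → ℝ) : 0 ≤ gg ε v := Finset.prod_nonneg fun i _ => ph_nonneg _ _

lemma int_gv {N : ℕ} {s : ℝ} (hs : 0 < s) (F : (Fin N → ℝ) → ℝ) :
    ∫ u, F u ∂(gv (Fin N) s) = ∫ u, gg s u * F u := by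
  rw [gv_density hs, integral_withDensity_eq_integral_toReal_smul]
  · refine integral_congr_ae (Filter.Eventually.of_forall fun u => ?_)
    have := gg_nonneg s u
    unfold gg at *
    simp [ENNReal.toReal_ofReal this]
  · exact (gg_cont s).measurable.ennreal_ofReal
  · exact Filter.Eventually.of_forall fun u => ENNReal.ofReal_lt_top

lemma intble_gv {N : ℕ} {s : ℝ} (hs : 0 < s) (F : (Fin N → ℝ) → ℝ) :
    Integrable F (gv (Fin N) s) ↔ Integrable (fun u => gg s u * F u) volume := by
  rw [gv_density hs, integrable_withDensity_iff_integrable_smul']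
  · refine integrable_congr (Filter.Eventually.of_forall fun u => ?_)
    have := gg_nonneg s u
    unfold gg at *
    simp [ENNReal.toReal_ofReal this]
  · exact (gg_cont s).measurable.ennreal_ofReal
  · exact Filter.Eventually.of_forall fun u => ENNReal.ofReal_lt_top

lemma gv_ibp {N : ℕ} (i : Fin N) (F F' : (Fin N → ℝ) → ℝ) (hF : ∀ u, HasLineDerivAt ℝ F (F' u) u (Pi.single i 1))
    (a1 : AM (gv (Fin N) 1) F) (a2 : AM (gv (Fin N) 1) F') :
    ∫ u, F' u ∂(gv (Fin N) 1) = 2 * ∫ u, u i * F u ∂(gv (Fin N) 1) := by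
  rw [int_gv one_pos, int_gv one_pos]
  have hg : ∀ u : Fin N → ℝ, HasLineDerivAt ℝ (gg 1) (gg 1 u * (-2 * u i)) u (Pi.single i 1) := by
    intro u
    unfold HasLineDerivAt
    have := gg_line (ε := 1) (f := fun t => u + t • Pi.single i (1:ℝ)) (f' := fun _ => Pi.single i 1) (y := 0) (fun k => by
      simp only [Pi.add_apply, Pi.smul_apply, smul_eq_mul]
      simpa using ((hasDerivAt_id (0:ℝ)).mul_const (Pi.single (M := fun _ => ℝ) i (1:ℝ) k)).const_add (u k))
    refine this.congr_deriv ?_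
    simp
  have a3 := AM.gv (ι := Fin N) 1 i
  have := integral_bilinear_hasLineDerivAt_right_eq_neg_left_of_integrable (μ := (volume : Measure (Fin N → ℝ)))
    (f := gg 1) (g := F) (g' := F') (v := Pi.single i 1) (B := ContinuousLinearMap.mul ℝ ℝ)
    (f' := fun u => gg 1 u * (-2 * u i)) ?_ ?_ ?_ (fun x _ => hg x) (fun x _ => hF x)
  · simp only [ContinuousLinearMap.mul_apply'] at this
    rw [this, ← MeasureTheory.integral_neg, ← MeasureTheory.integral_const_mul]
    refine integral_congr_ae (Filter.Eventually.of_forall fun u => ?_)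
    simp only
    ring
  · simp only [ContinuousLinearMap.mul_apply']
    have := (intble_gv one_pos _).1 (((AM.const (-2)).mul a3).mul a1).integrable
    simpa [mul_assoc] using this
  · simp only [ContinuousLinearMap.mul_apply']
    exact (intble_gv one_pos _).1 a2.integrable
  · simp only [ContinuousLinearMap.mul_apply']
    exact (intble_gv one_pos _).1 a1.integrable

end MDR

open MeasureTheory Matrix Nat intervalIntegral
open scoped Classical

namespace MDR
open ProbabilityTheory

lemma gv_scale {N : ℕ} {s : ℝ} (hs : 0 < s) : MeasurePreserving (fun (u : Fin N → ℝ) i => √s * u i) (gv (Fin N) 1) (gv (Fin N) s) :=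
  measurePreserving_pi (fun _ => gr 1) (fun _ => gr s) fun _ => ⟨by fun_prop, gr_scale hs⟩

/-- regularized sign -/
noncomputable def Sg {N : ℕ} (ε : ℝ) (X : Matrix (Fin N) (Fin N) ℝ) : ℝ :=
  √Real.pi ^ N * (X.det * ∫ u, gg ε (X *ᵥ u) ∂(gv (Fin N) 1))

lemma Sg_eq {N : ℕ} {ε : ℝ} (hε : 0 < ε) (X : Matrix (Fin N) (Fin N) ℝ) (hX : X.det ≠ 0) :
    Sg ε X = ((SignType.sign X.det : SignType) : ℝ) * ∫ v, Real.exp (-(ε * ((X⁻¹ *ᵥ v) ⬝ᵥ (X⁻¹ *ᵥ v)))) ∂(gv (Fin N) 1) := by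
  have hu : IsUnit X.det := isUnit_iff_ne_zero.mpr hX
  have cm : ∀ M : Matrix (Fin N) (Fin N) ℝ, Continuous fun v : Fin N → ℝ => M *ᵥ v := fun M =>
    Continuous.matrix_mulVec continuous_const continuous_id
  have h1 : ∫ u, gg ε (X *ᵥ u) ∂(gv (Fin N) 1) = |X.det⁻¹| * ∫ v, gg ε v * gg 1 (X⁻¹ *ᵥ v) := by
    rw [int_gv one_pos]
    have e : ∀ u, gg 1 u * gg ε (X *ᵥ u) = (fun v => gg ε v * gg 1 (X⁻¹ *ᵥ v)) (Matrix.toLin' X u) := by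
      intro u
      simp only [Matrix.toLin'_apply, mulVec_mulVec, Matrix.nonsing_inv_mul _ hu, one_mulVec]
      ring
    simp only [e]
    have k1 : AEMeasurable (Matrix.toLin' X) (volume : Measure (Fin N → ℝ)) := (cm X).measurable.aemeasurable
    have k2 : AEStronglyMeasurable (fun v => gg ε v * gg 1 (X⁻¹ *ᵥ v)) (Measure.map (Matrix.toLin' X) (volume : Measure (Fin N → ℝ))) :=
      ((gg_cont ε).mul ((gg_cont 1).comp (cm _))).aestronglyMeasurable
    rw [← integral_map k1 k2, Real.map_matrix_volume_pi_eq_smul_volume_pi hX,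
      MeasureTheory.integral_smul_measure, ENNReal.toReal_ofReal (abs_nonneg _), smul_eq_mul]
  have h2 : √Real.pi ^ N * ∫ v, gg ε v * gg 1 (X⁻¹ *ᵥ v) = ∫ v, Real.exp (-(ε * ((X⁻¹ *ᵥ v) ⬝ᵥ (X⁻¹ *ᵥ v)))) ∂(gv (Fin N) 1) := by
    rw [← int_gv hε (fun v => gg 1 (X⁻¹ *ᵥ v)), ← (gv_scale hε).map_eq, integral_map (gv_scale hε).measurable.aemeasurable,
      ← MeasureTheory.integral_const_mul]
    · refine integral_congr_ae (Filter.Eventually.of_forall fun v => ?_)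
      have : (fun i => √ε * v i) = √ε • v := rfl
      simp only [this, mulVec_smul]
      unfold gg
      have hp : √Real.pi ≠ 0 := (Real.sqrt_pos.mpr Real.pi_pos).ne'
      rw [prod_ph, mul_one, ← mul_assoc, ← mul_pow, mul_inv_cancel₀ hp, one_pow, one_mul, smul_dotProduct, dotProduct_smul, smul_eq_mul, smul_eq_mul,
       ← mul_assoc, Real.mul_self_sqrt hε.le, div_one]
    · exact ((gg_cont 1).comp (cm _)).aestronglyMeasurable
  unfold Sg
  rw [h1, ← h2]
  have : X.det * |X.det⁻¹| = ((SignType.sign X.det : SignType) : ℝ) := by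
    rcases lt_or_gt_of_ne hX with h | h
    · rw [sign_neg h, abs_of_neg (inv_lt_zero.mpr h)]; simp; field_simp
    · rw [sign_pos h, abs_of_pos (inv_pos.mpr h)]; simp; field_simp
  rw [← this]; ring

lemma Sg_exp_le {N : ℕ} {ε : ℝ} (hε : 0 < ε) (v : Fin N → ℝ) : |Real.exp (-(ε * (v ⬝ᵥ v)))| ≤ 1 := by
  rw [abs_of_pos (Real.exp_pos _), Real.exp_le_one_iff]
  have : 0 ≤ v ⬝ᵥ v := Finset.sum_nonneg fun i _ => mul_self_nonneg _
  have := mul_nonneg hε.le this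
  linarith

lemma Sg_le {N : ℕ} {ε : ℝ} (hε : 0 < ε) (X : Matrix (Fin N) (Fin N) ℝ) : |Sg ε X| ≤ 1 := by
  by_cases hX : X.det = 0
  · simp [Sg, hX]
  rw [Sg_eq hε X hX, abs_mul]
  have h1 : |((SignType.sign X.det : SignType) : ℝ)| ≤ 1 := by
    rcases lt_or_gt_of_ne hX with h | h
    · rw [sign_neg h]; simp
    · rw [sign_pos h]; simp
  have h2 : |∫ v, Real.exp (-(ε * ((X⁻¹ *ᵥ v) ⬝ᵥ (X⁻¹ *ᵥ v)))) ∂(gv (Fin N) 1)| ≤ 1 := by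
    have := norm_integral_le_of_norm_le_const (μ := gv (Fin N) 1) (f := fun v => Real.exp (-(ε * ((X⁻¹ *ᵥ v) ⬝ᵥ (X⁻¹ *ᵥ v)))))
      (C := 1) (Filter.Eventually.of_forall fun v => Sg_exp_le hε _)
    simpa using this
  calc _ ≤ 1 * 1 := mul_le_mul h1 h2 (abs_nonneg _) zero_le_one
    _ = 1 := one_mul 1

lemma Sg_lim {N : ℕ} {e : ℕ → ℝ} (p : ∀ n, 0 < e n) (l : Filter.Tendsto e Filter.atTop (nhds 0)) (X : Matrix (Fin N) (Fin N) ℝ) (hX : X.det ≠ 0) :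
    Filter.Tendsto (fun n => Sg (e n) X) Filter.atTop (nhds ((SignType.sign X.det : SignType) : ℝ)) := by
  simp only [fun n => Sg_eq (p n) X hX]
  have cm : Continuous fun v : Fin N → ℝ => X⁻¹ *ᵥ v := Continuous.matrix_mulVec continuous_const continuous_id
  have : Filter.Tendsto (fun n => ∫ v, Real.exp (-(e n * ((X⁻¹ *ᵥ v) ⬝ᵥ (X⁻¹ *ᵥ v)))) ∂(gv (Fin N) 1)) Filter.atTop (nhds (∫ v, 1 ∂(gv (Fin N) 1))) := by
    refine tendsto_integral_of_dominated_convergence (fun _ => 1) ?_ (integrable_const _) ?_ ?_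
    · intro n
      refine Continuous.aestronglyMeasurable ?_
      exact Real.continuous_exp.comp (continuous_const.mul (cm.dotProduct cm)).neg
    · intro n
      exact Filter.Eventually.of_forall fun v => Sg_exp_le (p n) _
    · refine Filter.Eventually.of_forall fun v => ?_
      have := (Real.continuous_exp.tendsto _).comp (l.mul_const ((X⁻¹ *ᵥ v) ⬝ᵥ (X⁻¹ *ᵥ v))).neg
      simpa [Function.comp_def] using this
  simpa using this.const_mul ((SignType.sign X.det : SignType) : ℝ)

/-- derivative -/
noncomputable def Dg {N : ℕ} (ε : ℝ) (X : Matrix (Fin N) (Fin N) ℝ) (u : Fin N → ℝ) : ℝ :=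
  gg ε (X *ᵥ u) * (X.adjugate.trace - (2 / ε) * (X.det * ((X *ᵥ u) ⬝ᵥ u)))

lemma AM.gg {Ω : Type*} [MeasurableSpace Ω] {μ : Measure Ω} [IsFiniteMeasure μ] {N : ℕ} {ε : ℝ} (hε : 0 < ε) {v : Ω → Fin N → ℝ}
    (h : ∀ i, AM μ fun ω => v ω i) : AM μ (fun ω => gg ε (v ω)) := by
  unfold MDR.gg
  exact AM.prod _ fun k _ => (h k).ph hε

lemma AM.Dg {Ω : Type*} [MeasurableSpace Ω] {μ : Measure Ω} [IsFiniteMeasure μ] {N : ℕ} {ε : ℝ} (hε : 0 < ε) {X : Ω → Matrix (Fin N) (Fin N) ℝ} {v : Ω → Fin N → ℝ}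
    (hX : ∀ i j, AM μ fun ω => X ω i j) (h : ∀ i, AM μ fun ω => v ω i) : AM μ (fun ω => Dg ε (X ω) (v ω)) := by
  unfold MDR.Dg Matrix.trace Matrix.diag
  exact (AM.gg hε (AM.mulVec hX h)).mul ((AM.sum _ fun i _ => AM.adj hX i i).sub ((AM.const _).mul ((AM.det hX).mul (AM.dotProduct (AM.mulVec hX h) h))))

lemma AM.Qf {Ω : Type*} [MeasurableSpace Ω] {μ : Measure Ω} [IsFiniteMeasure μ] {N : ℕ} {ε : ℝ} (hε : 0 < ε) {X : Ω → Matrix (Fin N) (Fin N) ℝ} {v : Ω → Fin N → ℝ}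
    (hX : ∀ i j, AM μ fun ω => X ω i j) (h : ∀ i, AM μ fun ω => v ω i) : AM μ (fun ω => Qf ε (X ω) (v ω)) := by
  unfold MDR.Qf
  exact (AM.dotProduct h (AM.mulVec (AM.adj hX) h)).mul (AM.gg hε (AM.mulVec hX h))

lemma AM.Xm {Ω : Type*} [MeasurableSpace Ω] {μ : Measure Ω} [IsFiniteMeasure μ] {N : ℕ} {H : Ω → Fin N → Fin N → ℝ} {y : Ω → ℝ}
    (hH : ∀ i j, AM μ fun ω => H ω i j) (hy : AM μ y) (i j : Fin N) : AM μ (fun ω => Xm (H ω) (y ω) i j) := by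
  simp only [Xm_apply, delta]
  by_cases h : i = j
  · simp only [h, if_true]; exact (hH j j).sub hy
  · simp only [h, if_false]; exact (hH i j).sub (AM.const _)

lemma Dg_int {N : ℕ} {ε : ℝ} (hε : 0 < ε) (X : Matrix (Fin N) (Fin N) ℝ) :
    ∫ u, Dg ε X u ∂(gv (Fin N) 1) = 2 * ∫ u, Qf ε X u ∂(gv (Fin N) 1) := by
  set ν := gv (Fin N) 1
  have au : ∀ i, AM ν fun u => u i := fun i => AM.gv 1 i
  have ac : ∀ M : Matrix (Fin N) (Fin N) ℝ, ∀ i j, AM ν fun _ => M i j := fun M i j => AM.const _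
  have ag : AM ν (fun u => gg ε (X *ᵥ u)) := AM.gg hε (AM.mulVec (ac X) au)
  let F : Fin N → (Fin N → ℝ) → ℝ := fun i u => (X.adjugate *ᵥ u) i * gg ε (X *ᵥ u)
  let F' : Fin N → (Fin N → ℝ) → ℝ := fun i u => X.adjugate i i * gg ε (X *ᵥ u) + (X.adjugate *ᵥ u) i * (gg ε (X *ᵥ u) * (-(2/ε) * ((X *ᵥ u) ⬝ᵥ (fun k => X k i))))
  have a1 : ∀ i, AM ν (F i) := fun i => (AM.mulVec (ac X.adjugate) au i).mul ag
  have a2 : ∀ i, AM ν (F' i) := fun i => ((AM.const _).mul ag).add ((AM.mulVec (ac X.adjugate) au i).mul (ag.mul ((AM.const _).mul (AM.dotProduct (AM.mulVec (ac X) au) (fun k => AM.const _)))))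
  have hd : ∀ i u, HasLineDerivAt ℝ (F i) (F' i u) u (Pi.single i 1) := by
    intro i u
    unfold HasLineDerivAt
    have hl : ∀ M : Matrix (Fin N) (Fin N) ℝ, ∀ k, HasDerivAt (fun t : ℝ => (M *ᵥ (u + t • Pi.single i (1:ℝ))) k) (M k i) 0 := by
      intro M k
      simp only [mulVec_add, mulVec_smul, Pi.add_apply, Pi.smul_apply, smul_eq_mul, mulVec_single_one, Matrix.col_apply]
      simpa using ((hasDerivAt_id (0:ℝ)).mul_const (M k i)).const_add ((M *ᵥ u) k)
    have h1 := gg_line (ε := ε) (f := fun t => X *ᵥ (u + t • Pi.single i (1:ℝ))) (f' := fun _ k => X k i) (y := 0) (fun k => hl X k)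
    have h2 := (hl X.adjugate i).mul h1
    refine h2.congr_deriv ?_
    simp [F']
  have h1 : ∀ u, Dg ε X u = ∑ i, F' i u := by
    intro u
    simp only [F', Finset.sum_add_distrib, Dg]
    have e1 : ∑ i, (X.adjugate *ᵥ u) i * (gg ε (X *ᵥ u) * (-(2/ε) * ((X *ᵥ u) ⬝ᵥ (fun k => X k i)))) =
        gg ε (X *ᵥ u) * (-(2/ε)) * ∑ i, (X.adjugate *ᵥ u) i * ((X *ᵥ u) ⬝ᵥ (fun k => X k i)) := by
      rw [Finset.mul_sum]
      exact Finset.sum_congr rfl fun i _ => by ring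
    have e2 : ∑ i, (X.adjugate *ᵥ u) i * ((X *ᵥ u) ⬝ᵥ (fun k => X k i)) = X.det * ((X *ᵥ u) ⬝ᵥ u) := by
      have : ∑ i, (X.adjugate *ᵥ u) i * ((X *ᵥ u) ⬝ᵥ (fun k => X k i)) = ((X *ᵥ u) ᵥ* X) ⬝ᵥ (X.adjugate *ᵥ u) := by
        rw [dotProduct_comm]; rfl
      rw [this, ← dotProduct_mulVec, mulVec_mulVec, mul_adjugate, smul_mulVec, one_mulVec, dotProduct_smul, smul_eq_mul]
    rw [e1, e2, ← Finset.sum_mul]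
    simp only [Matrix.trace, Matrix.diag]
    ring
  have h2 : ∀ u, Qf ε X u = ∑ i, u i * F i u := by
    intro u
    simp only [F, Qf, dotProduct]
    rw [Finset.sum_mul]
    exact Finset.sum_congr rfl fun i _ => by unfold gg; ring
  simp only [h1, h2]
  rw [MeasureTheory.integral_finsetSum _ fun i _ => (a2 i).integrable, MeasureTheory.integral_finsetSum _ fun i _ => ((au i).mul (a1 i)).integrable, Finset.mul_sum]
  exact Finset.sum_congr rfl fun i _ => gv_ibp i _ _ (hd i) (a1 i) (a2 i)

lemma Xm_cont {N : ℕ} (H : Fin N → Fin N → ℝ) : Continuous (Xm H) := by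
  unfold Xm
  refine continuous_const.sub ?_
  have : Continuous fun y : ℝ => Matrix.diagonal (fun _ : Fin N => y) := Continuous.matrix_diagonal (continuous_pi fun _ => continuous_id)
  exact this

lemma AM_Ioc (a b : ℝ) : AM (volume.restrict (Set.Ioc a b)) (fun y : ℝ => y) := by
  refine AM.of_bdd aestronglyMeasurable_id (|a| + |b|) ?_
  filter_upwards [ae_restrict_mem measurableSet_Ioc] with y hy
  rw [abs_le]
  have := neg_abs_le a
  have := le_abs_self b
  have := abs_nonneg a
  have := abs_nonneg b
  constructor <;> linarith [hy.1, hy.2]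

lemma Sg_diff {N : ℕ} {ε : ℝ} (hε : 0 < ε) (H : Fin N → Fin N → ℝ) {a b : ℝ} (hab : a ≤ b) :
    Sg ε (Xm H a) - Sg ε (Xm H b) = 2 * √Real.pi ^ N * ∫ y in Set.Ioc a b, ∫ u, Qf ε (Xm H y) u ∂(gv (Fin N) 1) := by
  set ν := gv (Fin N) 1
  have au : ∀ i, AM ν fun u => u i := fun i => AM.gv 1 i
  have ax : ∀ y i j, AM ν fun _ => Xm H y i j := fun y i j => AM.const _
  have hder : ∀ u y, HasDerivAt (fun y => (Xm H y).det * gg ε (Xm H y *ᵥ u)) (-Dg ε (Xm H y) u) y := by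
    intro u y
    have h1 := gg_line (ε := ε) (f := fun y => Xm H y *ᵥ u) (f' := fun _ k => - u k) (y := y) (fun k => by
      have e : ∀ y, (Xm H y *ᵥ u) k = (Matrix.of H *ᵥ u) k - y * u k := by
        intro y
        unfold Xm
        rw [sub_mulVec, scalar_apply, Pi.sub_apply, mulVec_diagonal]
      simp only [e]
      simpa using ((hasDerivAt_id y).mul_const (u k)).const_sub ((Matrix.of H *ᵥ u) k))
    refine ((det_deriv H y).mul h1).congr_deriv ?_
    have : (Xm H y *ᵥ u) ⬝ᵥ (fun k => - u k) = -((Xm H y *ᵥ u) ⬝ᵥ u) := dotProduct_neg _ _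
    simp only [this, Dg]
    ring
  have hc : ∀ u, Continuous fun y => Dg ε (Xm H y) u := by
    intro u
    have cx := Xm_cont H
    have cv : Continuous fun y => Xm H y *ᵥ u := cx.matrix_mulVec continuous_const
    unfold Dg
    exact ((gg_cont ε).comp cv).mul (cx.matrix_adjugate.matrix_trace.sub (continuous_const.mul (cx.matrix_det.mul (cv.dotProduct continuous_const))))
  have hftc : ∀ u, ∫ y in Set.Ioc a b, Dg ε (Xm H y) u = (Xm H a).det * gg ε (Xm H a *ᵥ u) - (Xm H b).det * gg ε (Xm H b *ᵥ u) := by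
    intro u
    have := integral_eq_sub_of_hasDerivAt (a := a) (b := b) (fun y _ => hder u y) ((hc u).neg.intervalIntegrable a b)
    rw [intervalIntegral.integral_neg, intervalIntegral.integral_of_le hab] at this
    linarith
  have ig : ∀ y, Integrable (fun u => (Xm H y).det * gg ε (Xm H y *ᵥ u)) ν := fun y =>
    ((AM.const _).mul (AM.gg hε (AM.mulVec (ax y) au))).integrable
  have h1 : Sg ε (Xm H a) - Sg ε (Xm H b) = √Real.pi ^ N * ∫ u, (∫ y in Set.Ioc a b, Dg ε (Xm H y) u) ∂ν := by
    simp only [hftc]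
    rw [integral_sub (ig a) (ig b)]
    simp only [Sg, MeasureTheory.integral_const_mul]
    ring
  rw [h1, MeasureTheory.integral_integral_swap]
  · have e := fun y => Dg_int hε (Xm H y)
    change √Real.pi ^ N * ∫ y in Set.Ioc a b, ∫ u, Dg ε (Xm H y) u ∂(gv (Fin N) 1) = _
    simp only [e]
    rw [MeasureTheory.integral_const_mul]; ring
  · have : AM (ν.prod (volume.restrict (Set.Ioc a b))) (fun p => Dg ε (Xm H p.2) p.1) :=
      AM.Dg hε (fun i j => AM.Xm (H := fun _ => H) (fun i j => AM.const _) (AM.snd (AM_Ioc a b)) i j) (fun i => (au i).fst)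
    exact this.integrable

end MDR

open MeasureTheory Matrix Nat intervalIntegral
open scoped Classical

namespace MDR
open ProbabilityTheory

lemma norm_toLp {n : ℕ} (v : Fin n → ℝ) : ‖WithLp.toLp 2 v‖ = √(v ⬝ᵥ v) := by
  rw [EuclideanSpace.norm_eq]
  congr 1
  exact Finset.sum_congr rfl fun i _ => by simp [sq]

lemma sphere_const (k : ℕ) : ((k + 1 : ℕ) : ℝ) * (√Real.pi ^ (k+1) / Real.Gamma (((k+1 : ℕ) : ℝ) / 2 + 1)) = sphereArea k := by
  unfold sphereArea
  have h : (0:ℝ) < ((k:ℝ)+1)/2 := by positivity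
  push_cast
  rw [Real.Gamma_add_one h.ne', Real.sqrt_eq_rpow, ← Real.rpow_natCast, ← Real.rpow_mul Real.pi_pos.le]
  have hG := (Real.Gamma_pos_of_pos h).ne'
  have : (1/2:ℝ) * ((k+1:ℕ):ℝ) = ((k:ℝ)+1)/2 := by push_cast; ring
  rw [this]
  field_simp

lemma radial {k : ℕ} (f : ℝ → ℝ) : ∫ v : Fin (k+1) → ℝ, f (√(v ⬝ᵥ v)) = sphereArea k * ∫ r in Set.Ioi (0:ℝ), r ^ k * f r := by
  have h := integral_fun_norm_addHaar (volume : Measure (EuclideanSpace ℝ (Fin (k+1)))) f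
  rw [← (PiLp.volume_preserving_toLp (Fin (k+1))).integral_comp (MeasurableEquiv.toLp 2 _).measurableEmbedding] at h
  simp only [norm_toLp] at h
  rw [h]
  simp only [finrank_euclideanSpace_fin, smul_eq_mul, nsmul_eq_mul, Nat.add_sub_cancel]
  rw [← sphere_const, ← mul_assoc]
  congr 2
  rw [Measure.real, EuclideanSpace.volume_ball]
  simp
  positivity

lemma radial_int {k : ℕ} (f : ℝ → ℝ) : Integrable (fun v : Fin (k+1) → ℝ => f (√(v ⬝ᵥ v))) volume ↔ IntegrableOn (fun r => r ^ k * f r) (Set.Ioi (0:ℝ)) := by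
  have h := integrable_fun_norm_addHaar (volume : Measure (EuclideanSpace ℝ (Fin (k+1)))) (f := f)
  rw [← (PiLp.volume_preserving_toLp (Fin (k+1))).integrable_comp_emb (MeasurableEquiv.toLp 2 _).measurableEmbedding] at h
  simp only [Function.comp_def, norm_toLp] at h
  rw [h]
  simp only [finrank_euclideanSpace_fin, smul_eq_mul, Nat.add_sub_cancel]

lemma int_r : ∫ r in Set.Ioi (0:ℝ), r * Real.exp (-r ^ 2) = 1 / 2 := by
  have := integral_rpow_mul_exp_neg_rpow (p := 2) (q := 1) (by norm_num) (by norm_num)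
  norm_num at this
  simpa using this

lemma intble_r : IntegrableOn (fun r : ℝ => r * Real.exp (-r ^ 2)) (Set.Ioi (0:ℝ)) := by
  have := (integrable_mul_exp_neg_mul_sq (b := 1) one_pos).integrableOn (s := Set.Ioi (0:ℝ))
  simpa using this

lemma gg_one {N : ℕ} (u : Fin N → ℝ) : gg 1 u = (√Real.pi)⁻¹ ^ N * Real.exp (-(√(u ⬝ᵥ u)) ^ 2) := by
  unfold gg
  have h : 0 ≤ u ⬝ᵥ u := Finset.sum_nonneg fun i _ => mul_self_nonneg _
  rw [prod_ph, mul_one, div_one, Real.sq_sqrt h]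

lemma r_aux {m : ℕ} {r : ℝ} (hr : 0 < r) (c : ℝ) : r ^ (m+2) * (c * Real.exp (-r^2) * (r ^ 2 / r ^ (m+3))) = c * (r * Real.exp (-r^2)) := by
  field_simp
  ring

lemma wt_intble (m : ℕ) : Integrable (wt (N := m+3)) (gv (Fin (m+3)) 1) := by
  rw [intble_gv one_pos]
  simp only [gg_one, wt]
  rw [radial_int (k := m+2) (fun r => (√Real.pi)⁻¹ ^ (m+3) * Real.exp (-r ^ 2) * (r ^ 2 / r ^ (m+3)))]
  have h : IntegrableOn (fun r : ℝ => (√Real.pi)⁻¹ ^ (m+3) * (r * Real.exp (-r ^ 2))) (Set.Ioi 0) := intble_r.const_mul ((√Real.pi)⁻¹ ^ (m+3))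
  refine IntegrableOn.congr_fun h (fun r hr => ?_) measurableSet_Ioi
  exact (r_aux hr _).symm

lemma wt_int (m : ℕ) : ∫ u, wt u ∂(gv (Fin (m+3)) 1) = (√Real.pi)⁻¹ ^ (m+3) * (sphereArea (m+2) * (1 / 2)) := by
  rw [int_gv one_pos]
  simp only [gg_one, wt]
  rw [radial (k := m+2) (fun r => (√Real.pi)⁻¹ ^ (m+3) * Real.exp (-r ^ 2) * (r ^ 2 / r ^ (m+3)))]
  rw [setIntegral_congr_fun measurableSet_Ioi (fun r hr => r_aux hr _), MeasureTheory.integral_const_mul, int_r]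
  ring

lemma sin_subst (m : ℕ) (J : ℝ → ℝ) (hJ : Continuous J) :
    ∫ θ in (0:ℝ)..Real.pi, Real.sin θ ^ (m+1) * J (Real.cos θ) = ∫ z in (-1:ℝ)..1, (1 - z ^ 2) ^ ((m:ℝ)/2) * J z := by
  have hg : Continuous fun z : ℝ => (1 - z ^ 2) ^ ((m:ℝ)/2) * J z := by
    refine Continuous.mul ?_ hJ
    exact Continuous.rpow_const (by fun_prop) fun x => Or.inr (by positivity)
  have := integral_comp_mul_deriv'' (a := 0) (b := Real.pi) (f := Real.cos) (f' := fun x => - Real.sin x) (g := fun z : ℝ => (1 - z ^ 2) ^ ((m:ℝ)/2) * J z)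
    Real.continuous_cos.continuousOn (fun x _ => (Real.hasDerivAt_cos x).hasDerivWithinAt) (by fun_prop) hg.continuousOn
  rw [Real.cos_zero, Real.cos_pi, integral_symm (-1) 1] at this
  rw [eq_neg_iff_add_eq_zero, add_comm, ← eq_neg_iff_add_eq_zero] at this
  rw [this, ← intervalIntegral.integral_neg]
  refine intervalIntegral.integral_congr fun θ hθ => ?_
  rw [Set.uIcc_of_le Real.pi_pos.le] at hθ
  have hs : 0 ≤ Real.sin θ := Real.sin_nonneg_of_mem_Icc hθ
  simp only [Function.comp]
  have : (1 - Real.cos θ ^ 2) ^ ((m:ℝ)/2) = Real.sin θ ^ m := by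
    rw [← Real.sin_sq, ← Real.rpow_natCast, ← Real.rpow_mul hs, ← Real.rpow_natCast]
    congr 1; push_cast; ring
  rw [this]; ring

/-- planar integrand -/
noncomputable def Hp (m : ℕ) (J : ℝ → ℝ) (x r : ℝ) : ℝ :=
  (√Real.pi)⁻¹ ^ (m+3) * Real.exp (-(√(x^2+r^2)) ^ 2) * ((√(x^2+r^2)) ^ 2 / (√(x^2+r^2)) ^ (m+3) * J (x / √(x^2+r^2)))

lemma Hp_meas (m : ℕ) {J : ℝ → ℝ} (hJ : Continuous J) : Measurable (fun p : ℝ × ℝ => p.2 ^ (m+1) * Hp m J p.1 p.2) := by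
  unfold Hp
  have := hJ.measurable
  fun_prop

lemma Hp_bdd (m : ℕ) {J : ℝ → ℝ} {C : ℝ} (hC : ∀ z, |J z| ≤ C) (x r : ℝ) (hr : 0 < r) :
   |r ^ (m+1) * Hp m J x r| ≤ ((√Real.pi)⁻¹ ^ (m+3) * C) * (Real.exp (-x^2) * Real.exp (-r^2)) := by
  unfold Hp
  set ρ := √(x^2+r^2) with hρ
  have h0 : 0 < ρ := Real.sqrt_pos.mpr (by positivity)
  have h2 : ρ ^ 2 = x^2+r^2 := Real.sq_sqrt (by positivity)
  have hle : r ≤ ρ := by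
    apply Real.le_sqrt_of_sq_le; nlinarith [sq_nonneg x]
  have e : r ^ (m+1) * ((√Real.pi)⁻¹ ^ (m+3) * Real.exp (-ρ ^ 2) * (ρ ^ 2 / ρ ^ (m+3) * J (x/ρ))) = 
     ((√Real.pi)⁻¹ ^ (m+3) * Real.exp (-ρ ^ 2)) * (r ^ (m+1) / ρ ^ (m+1)) * J (x / ρ) := by
    field_simp
    ring
  rw [e, abs_mul, abs_of_nonneg (by positivity), h2, neg_add, Real.exp_add]
  have h3 : r ^ (m+1) / ρ ^ (m+1) ≤ 1 := by
    rw [div_le_one (by positivity)]; gcongr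
  have hC0 := (abs_nonneg _).trans (hC 0)
  calc _ ≤ ((√Real.pi)⁻¹ ^ (m+3) * (Real.exp (-x^2) * Real.exp (-r^2))) * 1 * C := by
        gcongr
        exact hC _
    _ = _ := by ring

lemma planar (m : ℕ) {J : ℝ → ℝ} (hJ : Continuous J) {C : ℝ} (hC : ∀ z, |J z| ≤ C) :
    ∫ x : ℝ, ∫ r in Set.Ioi (0:ℝ), r ^ (m+1) * Hp m J x r = (√Real.pi)⁻¹ ^ (m+3) * (1 / 2) * ∫ z in (-1:ℝ)..1, (1 - z ^ 2) ^ ((m:ℝ)/2) * J z := by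
  have hint : Integrable (fun p : ℝ × ℝ => p.2 ^ (m+1) * Hp m J p.1 p.2) (volume.prod (volume.restrict (Set.Ioi (0:ℝ)))) := by
    have g0 : Integrable (fun x : ℝ => Real.exp (-x^2)) volume := by
      simpa using integrable_exp_neg_mul_sq (b := 1) one_pos
    have g1 := (Integrable.mul_prod g0 (g0.restrict (s := Set.Ioi (0:ℝ)))).const_mul ((√Real.pi)⁻¹ ^ (m+3) * C)
    refine g1.mono' (Hp_meas m hJ).aestronglyMeasurable ?_
    have : ∀ᵐ p ∂((volume : Measure ℝ).prod (volume.restrict (Set.Ioi (0:ℝ)))), p.2 ∈ Set.Ioi (0:ℝ) :=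
      Measure.quasiMeasurePreserving_snd.ae (ae_restrict_mem measurableSet_Ioi)
    filter_upwards [this] with p hp
    exact Hp_bdd m hC p.1 p.2 hp
  rw [← integral_prod (f := fun p : ℝ × ℝ => p.2 ^ (m+1) * Hp m J p.1 p.2) hint]
  have e1 : (volume : Measure ℝ).prod (volume.restrict (Set.Ioi (0:ℝ))) = (volume : Measure (ℝ × ℝ)).restrict (Set.univ ×ˢ Set.Ioi 0) := by
    rw [Measure.volume_eq_prod, ← Measure.prod_restrict, Measure.restrict_univ]
  rw [e1, ← MeasureTheory.integral_indicator (MeasurableSet.univ.prod measurableSet_Ioi), ← integral_comp_polarCoord_symm]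
  have e2 : ∀ p ∈ polarCoord.target, p.1 • ((Set.univ ×ˢ Set.Ioi (0:ℝ)).indicator (fun p : ℝ × ℝ => p.2 ^ (m+1) * Hp m J p.1 p.2)) (polarCoord.symm p) =
      ((√Real.pi)⁻¹ ^ (m+3) * (p.1 * Real.exp (-p.1 ^ 2))) * (Set.Ioo (0:ℝ) Real.pi).indicator (fun θ => Real.sin θ ^ (m+1) * J (Real.cos θ)) p.2 := by
    rintro ⟨ρ, θ⟩ hp
    simp only [polarCoord_target, Set.mem_prod, Set.mem_Ioi, Set.mem_Ioo] at hp
    obtain ⟨hρ, h1, h2⟩ := hp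
    simp only [polarCoord_symm_apply, smul_eq_mul]
    by_cases hθ : 0 < θ
    · have hs : 0 < Real.sin θ := Real.sin_pos_of_pos_of_lt_pi hθ h2
      rw [Set.indicator_of_mem, Set.indicator_of_mem]
      · unfold Hp
        have : (ρ * Real.cos θ) ^ 2 + (ρ * Real.sin θ) ^ 2 = ρ ^ 2 := by
          have := Real.sin_sq_add_cos_sq θ
          linear_combination ρ ^ 2 * this
        simp only [this, Real.sqrt_sq hρ.le]
        rw [mul_div_cancel_left₀ _ hρ.ne']
        field_simp
        ring
      · exact ⟨hθ, h2⟩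
      · simp [hρ, hs]
    · have hs : Real.sin θ ≤ 0 := Real.sin_nonpos_of_nonpos_of_neg_pi_le (not_lt.mp hθ) h1.le
      rw [Set.indicator_of_notMem, Set.indicator_of_notMem]
      · simp
      · exact fun h => hθ h.1
      · rintro ⟨_, h⟩
        simp only [Set.mem_Ioi] at h
        nlinarith
  rw [setIntegral_congr_fun polarCoord.open_target.measurableSet e2, polarCoord_target, Measure.volume_eq_prod,
    setIntegral_prod_mul (fun ρ => (√Real.pi)⁻¹ ^ (m+3) * (ρ * Real.exp (-ρ ^ 2))) ((Set.Ioo (0:ℝ) Real.pi).indicator (fun θ => Real.sin θ ^ (m+1) * J (Real.cos θ))),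
    MeasureTheory.integral_const_mul, int_r, MeasureTheory.setIntegral_indicator measurableSet_Ioo]
  have e3 : Set.Ioo (-Real.pi) Real.pi ∩ Set.Ioo 0 Real.pi = Set.Ioo 0 Real.pi := by
    apply Set.inter_eq_right.mpr
    exact Set.Ioo_subset_Ioo_left (by linarith [Real.pi_pos])
  rw [e3, ← integral_Ioc_eq_integral_Ioo, ← intervalIntegral.integral_of_le Real.pi_pos.le, sin_subst m J hJ]

end MDR

open MeasureTheory Matrix Nat intervalIntegral
open scoped Classical

namespace MDR
open ProbabilityTheory

lemma ang_meas {N : ℕ} (u : Fin N → ℝ) : Measurable (fun w : Fin N → ℝ => (u ⬝ᵥ w) / (√(u ⬝ᵥ u) * √(w ⬝ᵥ w))) := by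
  have h1 : Continuous fun w : Fin N → ℝ => u ⬝ᵥ w := by fun_prop
  have h2 : Continuous fun w : Fin N → ℝ => w ⬝ᵥ w := by fun_prop
  exact h1.measurable.div (measurable_const.mul h2.measurable.sqrt)

lemma wt_nonneg {N : ℕ} (u : Fin N → ℝ) : 0 ≤ wt u := by unfold wt; positivity

lemma w0_int (m : ℕ) {J : ℝ → ℝ} (hJ : Continuous J) {C : ℝ} (hC : ∀ z, |J z| ≤ C) :
    ∫ w, wt w * J (w 0 / √(w ⬝ᵥ w)) ∂(gv (Fin (m+3)) 1) = sphereArea (m+1) * ((√Real.pi)⁻¹ ^ (m+3) * (1 / 2) * ∫ z in (-1:ℝ)..1, (1 - z ^ 2) ^ ((m:ℝ)/2) * J z) := by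
  have h2 : Continuous fun w : Fin (m+3) → ℝ => w ⬝ᵥ w := by fun_prop
  have hI : Integrable (fun w : Fin (m+3) → ℝ => wt w * J (w 0 / √(w ⬝ᵥ w))) (gv (Fin (m+3)) 1) := by
    refine (wt_intble m).mul_bdd (c := C) ?_ (Filter.Eventually.of_forall fun w => hC _)
    exact (hJ.measurable.comp ((measurable_pi_apply 0).div h2.measurable.sqrt)).aestronglyMeasurable
  rw [intble_gv one_pos] at hI
  rw [int_gv one_pos]
  have mp := (volume_preserving_piFinSuccAbove (fun _ : Fin (m+3) => ℝ) 0).symm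
  rw [← mp.integral_comp']
  rw [← mp.integrable_comp_emb (MeasurableEquiv.measurableEmbedding _)] at hI
  have e : ∀ p : ℝ × (Fin (m+2) → ℝ), gg 1 ((MeasurableEquiv.piFinSuccAbove (fun _ : Fin (m+3) => ℝ) 0).symm p) * (wt ((MeasurableEquiv.piFinSuccAbove (fun _ : Fin (m+3) => ℝ) 0).symm p) * J (((MeasurableEquiv.piFinSuccAbove (fun _ : Fin (m+3) => ℝ) 0).symm p) 0 / √(((MeasurableEquiv.piFinSuccAbove (fun _ : Fin (m+3) => ℝ) 0).symm p) ⬝ᵥ ((MeasurableEquiv.piFinSuccAbove (fun _ : Fin (m+3) => ℝ) 0).symm p)))) = Hp m J p.1 (√(p.2 ⬝ᵥ p.2)) := by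
    rintro ⟨x, v⟩
    have h0 : (MeasurableEquiv.piFinSuccAbove (fun _ : Fin (m+3) => ℝ) 0).symm (x, v) = (Fin.cons x v : Fin (m+3) → ℝ) := by
      ext i
      refine Fin.cases ?_ (fun j => ?_) i <;> simp [MeasurableEquiv.piFinSuccAbove]
    have hv : 0 ≤ v ⬝ᵥ v := Finset.sum_nonneg fun i _ => mul_self_nonneg _
    have h1 : (Fin.cons x v : Fin (m+3) → ℝ) ⬝ᵥ (Fin.cons x v : Fin (m+3) → ℝ) = x ^ 2 + (√(v ⬝ᵥ v)) ^ 2 := by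
      rw [Real.sq_sqrt hv]
      simp only [dotProduct]
      rw [Fin.sum_univ_succ]
      simp [sq]
    rw [h0, gg_one]
    unfold wt Hp
    rw [h1, Fin.cons_zero]
  simp only [Function.comp_def, e] at hI ⊢
  rw [Measure.volume_eq_prod] at hI ⊢
  rw [integral_prod _ hI]
  simp only []
  have e2 : ∀ x : ℝ, ∫ v : Fin (m+2) → ℝ, Hp m J x (√(v ⬝ᵥ v)) = sphereArea (m+1) * ∫ r in Set.Ioi (0:ℝ), r ^ (m+1) * Hp m J x r := fun x => radial (k := m+1) (fun r => Hp m J x r)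
  simp only [e2]
  rw [MeasureTheory.integral_const_mul, planar m hJ hC]

lemma wu_int (m : ℕ) {J : ℝ → ℝ} (hJ : Continuous J) {C : ℝ} (hC : ∀ z, |J z| ≤ C) (hev : ∀ z, J (-z) = J z) (u : Fin (m+3) → ℝ) (hu : u ≠ 0) :
    ∫ w, wt w * J ((u ⬝ᵥ w) / (√(u ⬝ᵥ u) * √(w ⬝ᵥ w))) ∂(gv (Fin (m+3)) 1) = sphereArea (m+1) * ((√Real.pi)⁻¹ ^ (m+3) * (1 / 2) * ∫ z in (-1:ℝ)..1, (1 - z ^ 2) ^ ((m:ℝ)/2) * J z) := by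
  obtain ⟨O, hO, ⟨c, hc⟩, -⟩ := exists_frame u u
  have hO' : Oᵀ * O = 1 := by rw [← mul_eq_one_comm]; exact hO
  have hd : ∀ p q : Fin (m+3) → ℝ, (O *ᵥ p) ⬝ᵥ (O *ᵥ q) = p ⬝ᵥ q := by
    intro p q
    rw [dotProduct_mulVec, ← mulVec_transpose, mulVec_mulVec, hO', one_mulVec]
  have h1 : u ⬝ᵥ u = c ^ 2 := by rw [← hd, hc]; simp; ring
  have hc0 : c ≠ 0 := by
    rintro rfl
    apply hu
    apply dotProduct_self_eq_zero.mp
    rw [h1]; simp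
  rw [← w0_int m hJ hC]
  have mp := gv_rot 1 O hO
  have h2 : Continuous fun w : Fin (m+3) → ℝ => w ⬝ᵥ w := by fun_prop
  have hwt : Measurable (wt (N := m+3)) := by
    unfold wt
    exact (h2.measurable.sqrt.pow_const _).div (h2.measurable.sqrt.pow_const _)
  conv_rhs => rw [← mp.map_eq]
  rw [integral_map mp.measurable.aemeasurable]
  · congr 1
    ext w
    have h3 : u ⬝ᵥ w = c * (O *ᵥ w) 0 := by rw [← hd, hc]; simp
    have h4 : wt (O *ᵥ w) = wt w := by unfold wt; rw [hd]
    rw [h4, hd, h3, h1, Real.sqrt_sq_eq_abs]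
    congr 1
    rcases abs_cases c with ⟨h, _⟩ | ⟨h, _⟩ <;> rw [h]
    · rw [mul_div_mul_left _ _ hc0]
    · rw [← hev, neg_mul, div_neg, neg_neg, mul_div_mul_left _ _ hc0]
  · exact (hwt.mul (hJ.measurable.comp ((measurable_pi_apply 0).div h2.measurable.sqrt))).aestronglyMeasurable

/-- clamped integrand -/
noncomputable def Jt (N : ℕ) (t τ y x z : ℝ) : ℝ := Jf N t τ y x (max (-1) (min z 1))

lemma Jt_eq (N : ℕ) (t τ y x : ℝ) {z : ℝ} (h1 : -1 ≤ z) (h2 : z ≤ 1) : Jt N t τ y x z = Jf N t τ y x z := by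
  unfold Jt; rw [min_eq_left h2, max_eq_right h1]

lemma clamp_sq (z : ℝ) : (max (-1) (min z 1)) ^ 2 ≤ 1 := by
  have h1 : -1 ≤ max (-1) (min z 1) := le_max_left _ _
  have h2 : max (-1) (min z 1) ≤ 1 := max_le (by norm_num) (min_le_right _ _)
  nlinarith

lemma Jt_cont (N : ℕ) {t τ : ℝ} (ht : 0 < t) (hτ : 0 < τ) : Continuous (fun p : ℝ × ℝ × ℝ => Jt N t τ p.1 p.2.1 p.2.2) := by
  unfold Jt Jf
  have hE := Epoly_cont
  set q : ℝ → ℝ := fun z => max (-1) (min z 1) with hq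
  have hqc : Continuous q := by fun_prop
  have hq1 : ∀ z, q z ^ 2 ≤ 1 := clamp_sq
  have hD : ∀ z, τ + t * (1 - q z ^ 2) ≠ 0 := fun z => by
    have : 0 ≤ t * (1 - q z ^ 2) := mul_nonneg ht.le (by linarith [hq1 z])
    positivity
  have hD2 : ∀ z, 2 * (τ + t * (1 - q z ^ 2)) ≠ 0 := fun z => mul_ne_zero two_ne_zero (hD z)
  have hR : Continuous fun p : ℝ × ℝ × ℝ => (τ / t + (1 - q p.2.2 ^ 2)) ^ (-(N : ℝ) / 2) := by
    refine Continuous.rpow_const (by fun_prop) fun p => Or.inl ?_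
    have := hq1 p.2.2
    have : 0 < τ / t := by positivity
    apply ne_of_gt; linarith
  have hE1 : Continuous fun p : ℝ × ℝ × ℝ => Epoly (N-2) (2 * p.2.1 * p.1 / t) := (hE _).comp (by fun_prop)
  have hE2 : Continuous fun p : ℝ × ℝ × ℝ => Epoly (N-3) (2 * p.2.1 * p.1 / t) := (hE _).comp (by fun_prop)
  refine (hR.mul (Continuous.rexp (Continuous.div (by fun_prop) (by fun_prop) fun p => hD _))).mul ?_
  refine Continuous.sub (Continuous.add ?_ ?_) ?_
  · refine (Continuous.mul (Continuous.sub (by fun_prop) (Continuous.div (by fun_prop) (by fun_prop) fun p => hD _)) (Continuous.sub (by fun_prop) (Continuous.div (by fun_prop) (by fun_prop) fun p => hD _))).mul hE1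
  · exact (Continuous.div (by fun_prop) (by fun_prop) fun p => hD2 _).mul hE1
  · exact ((Continuous.div (by fun_prop) (by fun_prop) fun p => hD2 _).mul (by fun_prop)).mul hE2

lemma Jt_cont1 (N : ℕ) {t τ : ℝ} (ht : 0 < t) (hτ : 0 < τ) (y x : ℝ) : Continuous (Jt N t τ y x) :=
  Continuous.comp (g := fun p : ℝ × ℝ × ℝ => Jt N t τ p.1 p.2.1 p.2.2) (f := fun z : ℝ => (y, x, z)) (Jt_cont N ht hτ) (by fun_prop)

lemma Jt_even (N : ℕ) (t τ y x z : ℝ) : Jt N t τ y x (-z) = Jt N t τ y x z := by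
  unfold Jt
  apply Jf_sq
  have : max (-1) (min (-z) 1) = - max (-1) (min z 1) := by
    simp only [max_def, min_def]
    split_ifs <;> linarith
  rw [this]; ring

lemma Jt_bdd (N : ℕ) {t τ : ℝ} (ht : 0 < t) (hτ : 0 < τ) (R : ℝ) : ∃ C, ∀ y x z, |y| ≤ R → |x| ≤ R → |Jt N t τ y x z| ≤ C := by
  obtain ⟨C, hC⟩ := (IsCompact.prod (isCompact_Icc (a := -R) (b := R)) (IsCompact.prod (isCompact_Icc (a := -R) (b := R)) (isCompact_Icc (a := (-1:ℝ)) (b := 1)))).exists_bound_of_continuousOn (Jt_cont N ht hτ).continuousOn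
  refine ⟨C, fun y x z hy hx => ?_⟩
  have h1 : -1 ≤ max (-1) (min z 1) := le_max_left _ _
  have h2 : max (-1) (min z 1) ≤ 1 := max_le (by norm_num) (min_le_right _ _)
  have := hC (y, x, max (-1) (min z 1)) ⟨abs_le.mp hy, abs_le.mp hx, h1, h2⟩
  simp only at this
  rw [Jt_eq _ _ _ _ _ h1 h2] at this
  exact this

lemma rhoMod_eq (m : ℕ) (t τ y x : ℝ) : rhoMod (m+3) t τ y x = 2 * sphereArea (m+2) * sphereArea (m+1) / (t ^ 2 * (2 * Real.pi) ^ (m+3)) *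
    ∫ z in (0 : ℝ)..1, (1 - z ^ 2) ^ ((m:ℝ) / 2) * Jt (m+3) t τ y x z := by
  unfold rhoMod
  congr 1
  refine intervalIntegral.integral_congr fun z hz => ?_
  rw [Set.uIcc_of_le zero_le_one] at hz
  beta_reduce
  rw [Jt_eq _ _ _ _ _ (by linarith [hz.1]) hz.2]
  unfold Jf
  have : (((m+3:ℕ):ℝ) - 3) / 2 = (m:ℝ)/2 := by push_cast; ring
  rw [this]
  ring

lemma rhoMod_eq' (m : ℕ) {t τ : ℝ} (ht : 0 < t) (hτ : 0 < τ) (y x : ℝ) : rhoMod (m+3) t τ y x = sphereArea (m+2) * sphereArea (m+1) / (t ^ 2 * (2 * Real.pi) ^ (m+3)) *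
    ∫ z in (-1 : ℝ)..1, (1 - z ^ 2) ^ ((m:ℝ) / 2) * Jt (m+3) t τ y x z := by
  have hJ := Jt_cont1 (m+3) ht hτ y x
  have hg : Continuous fun z : ℝ => (1 - z ^ 2) ^ ((m:ℝ)/2) * Jt (m+3) t τ y x z := by
    refine Continuous.mul ?_ hJ
    exact Continuous.rpow_const (by fun_prop) fun x => Or.inr (by positivity)
  have h := intervalIntegral.integral_comp_neg (a := 0) (b := 1) (fun z : ℝ => (1 - z ^ 2) ^ ((m:ℝ)/2) * Jt (m+3) t τ y x z)
  simp only [neg_sq, Jt_even, neg_zero] at h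
  rw [rhoMod_eq, ← intervalIntegral.integral_add_adjacent_intervals (hg.intervalIntegrable (-1) 0) (hg.intervalIntegrable 0 1), ← h]
  ring

lemma rho_cont (m : ℕ) {t τ : ℝ} (ht : 0 < t) (hτ : 0 < τ) : Continuous (fun p : ℝ × ℝ => rhoMod (m+3) t τ p.1 p.2) := by
  simp only [rhoMod_eq]
  refine continuous_const.mul ?_
  apply intervalIntegral.continuous_parametric_intervalIntegral_of_continuous'
  refine Continuous.mul ?_ ?_
  · exact Continuous.rpow_const (by fun_prop) fun x => Or.inr (by positivity)
  · exact Continuous.comp (g := fun p : ℝ × ℝ × ℝ => Jt (m+3) t τ p.1 p.2.1 p.2.2) (f := fun p : (ℝ × ℝ) × ℝ => (p.1.1, p.1.2, p.2)) (Jt_cont (m+3) ht hτ) (by fun_prop)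

lemma ang_bd {N : ℕ} (u w : Fin N → ℝ) : -1 ≤ (u ⬝ᵥ w) / (√(u ⬝ᵥ u) * √(w ⬝ᵥ w)) ∧ (u ⬝ᵥ w) / (√(u ⬝ᵥ u) * √(w ⬝ᵥ w)) ≤ 1 := by
  rw [← abs_le, abs_div, abs_of_nonneg (by positivity : 0 ≤ √(u ⬝ᵥ u) * √(w ⬝ᵥ w))]
  apply div_le_one_of_le₀ _ (by positivity)
  rw [← norm_toLp, ← norm_toLp]
  have := abs_real_inner_le_norm (WithLp.toLp 2 u) (WithLp.toLp 2 w)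
  rw [EuclideanSpace.inner_eq_star_dotProduct] at this
  simpa [dotProduct_comm] using this

lemma gv_ne (m : ℕ) : ∀ᵐ u ∂(gv (Fin (m+3)) 1), u ≠ 0 := by
  rw [gv_density one_pos]
  apply (withDensity_absolutelyContinuous _ _).ae_le
  exact Measure.ae_ne volume 0

lemma key_int (m : ℕ) {t τ : ℝ} (ht : 0 < t) (hτ : 0 < τ) (y x : ℝ) :
    ∫ u, ∫ w, wt u * wt w * (4 / (t ^ 2 * (2 * Real.pi) ^ (m+3)) * Jf (m+3) t τ y x ((u ⬝ᵥ w) / (√(u ⬝ᵥ u) * √(w ⬝ᵥ w)))) ∂(gv (Fin (m+3)) 1) ∂(gv (Fin (m+3)) 1)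
     = (Real.pi)⁻¹ ^ (m+3) * rhoMod (m+3) t τ y x := by
  have hJ := Jt_cont1 (m+3) ht hτ y x
  obtain ⟨C, hC⟩ := Jt_bdd (m+3) ht hτ (max |y| |x|)
  have hC' : ∀ z, |Jt (m+3) t τ y x z| ≤ C := fun z => hC y x z (le_max_left _ _) (le_max_right _ _)
  have e : ∀ᵐ u ∂(gv (Fin (m+3)) 1), ∫ w, wt u * wt w * (4 / (t ^ 2 * (2 * Real.pi) ^ (m+3)) * Jf (m+3) t τ y x ((u ⬝ᵥ w) / (√(u ⬝ᵥ u) * √(w ⬝ᵥ w)))) ∂(gv (Fin (m+3)) 1) =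
     wt u * (4 / (t ^ 2 * (2 * Real.pi) ^ (m+3)) * (sphereArea (m+1) * ((√Real.pi)⁻¹ ^ (m+3) * (1 / 2) * ∫ z in (-1:ℝ)..1, (1 - z ^ 2) ^ ((m:ℝ)/2) * Jt (m+3) t τ y x z))) := by
    filter_upwards [gv_ne m] with u hu
    rw [← wu_int m hJ hC' (Jt_even _ _ _ _ _) u hu, ← MeasureTheory.integral_const_mul, ← MeasureTheory.integral_const_mul]
    congr 1
    ext w
    rw [Jt_eq _ _ _ _ _ (ang_bd u w).1 (ang_bd u w).2]
    ring
  rw [integral_congr_ae e, MeasureTheory.integral_mul_const, wt_int, rhoMod_eq' m ht hτ]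
  have : (Real.pi)⁻¹ ^ (m+3) = (√Real.pi)⁻¹ ^ (m+3) * (√Real.pi)⁻¹ ^ (m+3) := by
    rw [← mul_pow, ← mul_inv, Real.mul_self_sqrt Real.pi_pos.le]
  rw [this]
  ring

end MDR

open MeasureTheory Matrix Nat intervalIntegral
open scoped Classical

namespace MDR
open ProbabilityTheory

lemma pi_ac {α : Type*} [MeasurableSpace α] (n : ℕ) (μ ν : Measure α) [SigmaFinite μ] [SigmaFinite ν] (h : μ ≪ ν) :
    Measure.pi (fun _ : Fin n => μ) ≪ Measure.pi (fun _ : Fin n => ν) := by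
  induction n with
  | zero => rw [Measure.pi_of_empty, Measure.pi_of_empty]
  | succ n ih =>
    rw [← (measurePreserving_piFinSuccAbove (fun _ : Fin (n+1) => μ) 0).symm.map_eq, ← (measurePreserving_piFinSuccAbove (fun _ : Fin (n+1) => ν) 0).symm.map_eq]
    exact (h.prod ih).map (MeasurableEquiv.measurable _)

lemma gm_ac {N : ℕ} {s : ℝ} (hs : 0 < s) : gm N s ≪ (volume : Measure (Fin N → Fin N → ℝ)) := by
  have : gv (Fin N) s ≪ volume := by
    rw [gv_density hs]; exact withDensity_absolutelyContinuous _ _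
  exact pi_ac N _ _ this

lemma ae_fst {N : ℕ} {t τ : ℝ} (ht : 0 < t) {P : (Fin N → Fin N → ℝ) → Prop} (h : ∀ᵐ M, P M) :
    ∀ᵐ p ∂((gm N t).prod (gm N τ)), P p.1 :=
  Measure.quasiMeasurePreserving_fst.ae ((gm_ac ht).ae_le h)

lemma ae_add {N : ℕ} {t τ : ℝ} (ht : 0 < t) (hτ : 0 < τ) {P : (Fin N → Fin N → ℝ) → Prop} (h : ∀ᵐ M, P M) :
    ∀ᵐ p ∂((gm N t).prod (gm N τ)), P (p.1 + p.2) := by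
  have h1 : ∀ᵐ p ∂((volume : Measure (Fin N → Fin N → ℝ)).prod (volume : Measure (Fin N → Fin N → ℝ))), P p.2 := Measure.quasiMeasurePreserving_snd.ae h
  have h2 := (measurePreserving_prod_add (volume : Measure (Fin N → Fin N → ℝ)) (volume : Measure (Fin N → Fin N → ℝ))).quasiMeasurePreserving.ae h1
  exact ((gm_ac ht).prod (gm_ac hτ)).ae_le h2

/-- parameter measure -/
noncomputable def kap (N : ℕ) (a b c d : ℝ) : Measure ((ℝ × ℝ) × ((Fin N → ℝ) × (Fin N → ℝ))) :=
  ((volume.restrict (Set.Ioc a b)).prod (volume.restrict (Set.Ioc c d))).prod ((gv (Fin N) 1).prod (gv (Fin N) 1))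

instance (N : ℕ) (a b c d : ℝ) : IsFiniteMeasure (kap N a b c d) := by unfold kap; infer_instance

lemma AM_joint {N : ℕ} (t τ : ℝ) {ε : ℝ} (hε : 0 < ε) (a b c d : ℝ) :
    AM (((gm N t).prod (gm N τ)).prod (kap N a b c d)) (fun ω => Qf ε (Xm ω.1.1 ω.2.1.1) ω.2.2.1 * Qf ε (Xm (ω.1.1 + ω.1.2) ω.2.1.2) ω.2.2.2) := by
  have y1 : AM (kap N a b c d) (fun q => q.1.1) := AM.fst (f := fun r : ℝ × ℝ => r.1) (AM_Ioc a b).fst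
  have y2 : AM (kap N a b c d) (fun q => q.1.2) := AM.fst (f := fun r : ℝ × ℝ => r.2) (AM_Ioc c d).snd
  have u1 : ∀ i, AM (kap N a b c d) (fun q => q.2.1 i) := fun i => AM.snd (f := fun r : (Fin N → ℝ) × (Fin N → ℝ) => r.1 i) (AM.gv 1 i).fst
  have u2 : ∀ i, AM (kap N a b c d) (fun q => q.2.2 i) := fun i => AM.snd (f := fun r : (Fin N → ℝ) × (Fin N → ℝ) => r.2 i) (AM.gv 1 i).snd
  have h1 : ∀ i j, AM (((gm N t).prod (gm N τ)).prod (kap N a b c d)) (fun ω => ω.1.1 i j) := fun i j =>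
    AM.fst (f := fun r : (Fin N → Fin N → ℝ) × (Fin N → Fin N → ℝ) => r.1 i j) (AM.gm t i j).fst
  have h2 : ∀ i j, AM (((gm N t).prod (gm N τ)).prod (kap N a b c d)) (fun ω => ω.1.2 i j) := fun i j =>
    AM.fst (f := fun r : (Fin N → Fin N → ℝ) × (Fin N → Fin N → ℝ) => r.2 i j) (AM.gm τ i j).snd
  refine AM.mul (AM.Qf hε (fun i j => AM.Xm h1 y1.snd i j) (fun i => (u1 i).snd)) (AM.Qf hε (fun i j => AM.Xm (fun i j => ?_) y2.snd i j) (fun i => (u2 i).snd))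
  exact (h1 i j).add (h2 i j)

lemma E_reg {N : ℕ} (t τ : ℝ) {ε : ℝ} (hε : 0 < ε) {a b c d : ℝ} (hab : a ≤ b) (hcd : c ≤ d) :
    ∫ p, (Sg ε (Xm p.1 a) - Sg ε (Xm p.1 b)) * (Sg ε (Xm (p.1 + p.2) c) - Sg ε (Xm (p.1 + p.2) d)) ∂((gm N t).prod (gm N τ)) =
    4 * Real.pi ^ N * ∫ q, Kf t τ ε ε q.1.1 q.1.2 q.2.1 q.2.2 ∂(kap N a b c d) := by
  have hJ := (AM_joint (N := N) t τ hε a b c d).integrable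
  have e : ∀ᵐ p ∂((gm N t).prod (gm N τ)), (Sg ε (Xm p.1 a) - Sg ε (Xm p.1 b)) * (Sg ε (Xm (p.1 + p.2) c) - Sg ε (Xm (p.1 + p.2) d)) =
     4 * Real.pi ^ N * ∫ q, Qf ε (Xm p.1 q.1.1) q.2.1 * Qf ε (Xm (p.1 + p.2) q.1.2) q.2.2 ∂(kap N a b c d) := by
    filter_upwards [hJ.prod_right_ae] with p hp
    rw [Sg_diff hε _ hab, Sg_diff hε _ hcd]
    unfold kap at hp ⊢
    rw [integral_prod _ hp]
    simp only []
    have e1 : ∀ r : ℝ × ℝ, ∫ v, Qf ε (Xm p.1 r.1) v.1 * Qf ε (Xm (p.1 + p.2) r.2) v.2 ∂((gv (Fin N) 1).prod (gv (Fin N) 1)) =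
       (∫ u, Qf ε (Xm p.1 r.1) u ∂(gv (Fin N) 1)) * (∫ w, Qf ε (Xm (p.1 + p.2) r.2) w ∂(gv (Fin N) 1)) := fun r =>
      integral_prod_mul (fun u => Qf ε (Xm p.1 r.1) u) (fun w => Qf ε (Xm (p.1 + p.2) r.2) w)
    simp only [e1]
    rw [integral_prod_mul (fun y => ∫ u, Qf ε (Xm p.1 y) u ∂(gv (Fin N) 1)) (fun x => ∫ w, Qf ε (Xm (p.1 + p.2) x) w ∂(gv (Fin N) 1))]
    have : Real.pi ^ N = √Real.pi ^ N * √Real.pi ^ N := by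
      rw [← mul_pow, Real.mul_self_sqrt Real.pi_pos.le]
    rw [this]; ring
  rw [integral_congr_ae e, MeasureTheory.integral_const_mul]
  congr 1
  exact MeasureTheory.integral_integral_swap (f := fun (p : (Fin N → Fin N → ℝ) × (Fin N → Fin N → ℝ)) (q : (ℝ × ℝ) × ((Fin N → ℝ) × (Fin N → ℝ))) => Qf ε (Xm p.1 q.1.1) q.2.1 * Qf ε (Xm (p.1 + p.2) q.1.2) q.2.2) hJ

lemma Kf_meas {N : ℕ} (t τ : ℝ) {ε : ℝ} (hε : 0 < ε) (a b c d : ℝ) :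
    AEStronglyMeasurable (fun q : (ℝ × ℝ) × ((Fin N → ℝ) × (Fin N → ℝ)) => Kf t τ ε ε q.1.1 q.1.2 q.2.1 q.2.2) (kap N a b c d) :=
  ((AM_joint (N := N) t τ hε a b c d).integrable.integral_prod_right).1

lemma kap_lim (m : ℕ) {t τ : ℝ} (ht : 0 < t) (hτ : 0 < τ) {e : ℕ → ℝ} (p : ∀ n, 0 < e n)
    (l : Filter.Tendsto e Filter.atTop (nhds 0)) (a b c d : ℝ) :
    Filter.Tendsto (fun n => 4 * Real.pi ^ (m+3) * ∫ q, Kf t τ (e n) (e n) q.1.1 q.1.2 q.2.1 q.2.2 ∂(kap (m+3) a b c d)) Filter.atTop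
      (nhds (4 * ∫ r, rhoMod (m+3) t τ r.1 r.2 ∂((volume.restrict (Set.Ioc a b)).prod (volume.restrict (Set.Ioc c d))))) := by
  set R := |a| + |b| + |c| + |d| with hR
  obtain ⟨C, hC0, hC⟩ := Kf_bdd m ht hτ R
  set L : (ℝ × ℝ) × ((Fin (m+3) → ℝ) × (Fin (m+3) → ℝ)) → ℝ := fun q => wt q.2.1 * wt q.2.2 * (4 / (t ^ 2 * (2 * Real.pi) ^ (m+3)) * Jf (m+3) t τ q.1.1 q.1.2 ((q.2.1 ⬝ᵥ q.2.2) / (√(q.2.1 ⬝ᵥ q.2.1) * √(q.2.2 ⬝ᵥ q.2.2)))) with hL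
  have hy : ∀ᵐ q ∂(kap (m+3) a b c d), |q.1.1| ≤ R ∧ |q.1.2| ≤ R ∧ q.2.1 ≠ 0 ∧ q.2.2 ≠ 0 := by
    have ha := abs_le.mp (le_refl |a|)
    have hb := abs_le.mp (le_refl |b|)
    have hc := abs_le.mp (le_refl |c|)
    have hd := abs_le.mp (le_refl |d|)
    have p1 : ∀ᵐ r ∂((volume.restrict (Set.Ioc a b)).prod (volume.restrict (Set.Ioc c d))), r.1 ∈ Set.Ioc a b :=
      Measure.quasiMeasurePreserving_fst.ae (ae_restrict_mem measurableSet_Ioc)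
    have p2 : ∀ᵐ r ∂((volume.restrict (Set.Ioc a b)).prod (volume.restrict (Set.Ioc c d))), r.2 ∈ Set.Ioc c d :=
      Measure.quasiMeasurePreserving_snd.ae (ae_restrict_mem measurableSet_Ioc)
    have p3 : ∀ᵐ r ∂((gv (Fin (m+3)) 1).prod (gv (Fin (m+3)) 1)), r.1 ≠ 0 := Measure.quasiMeasurePreserving_fst.ae (gv_ne m)
    have p4 : ∀ᵐ r ∂((gv (Fin (m+3)) 1).prod (gv (Fin (m+3)) 1)), r.2 ≠ 0 := Measure.quasiMeasurePreserving_snd.ae (gv_ne m)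
    have q1 : ∀ᵐ q ∂(kap (m+3) a b c d), q.1.1 ∈ Set.Ioc a b ∧ q.1.2 ∈ Set.Ioc c d := Measure.quasiMeasurePreserving_fst.ae (p1.and p2)
    have q2 : ∀ᵐ q ∂(kap (m+3) a b c d), q.2.1 ≠ 0 ∧ q.2.2 ≠ 0 := Measure.quasiMeasurePreserving_snd.ae (p3.and p4)
    filter_upwards [q1, q2] with q h1 h2
    refine ⟨?_, ?_, h2.1, h2.2⟩
    · rw [abs_le]; constructor <;> linarith [h1.1.1, h1.1.2, abs_nonneg a, abs_nonneg b, abs_nonneg c, abs_nonneg d]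
    · rw [abs_le]; constructor <;> linarith [h1.2.1, h1.2.2, abs_nonneg a, abs_nonneg b, abs_nonneg c, abs_nonneg d]
  have hB : Integrable (fun q : (ℝ × ℝ) × ((Fin (m+3) → ℝ) × (Fin (m+3) → ℝ)) => C * (wt q.2.1 * wt q.2.2)) (kap (m+3) a b c d) :=
    (Integrable.comp_snd (f := fun r : (Fin (m+3) → ℝ) × (Fin (m+3) → ℝ) => wt r.1 * wt r.2) (Integrable.mul_prod (wt_intble m) (wt_intble m)) _).const_mul C
  have hK : ∀ n, ∀ᵐ q ∂(kap (m+3) a b c d), ‖Kf t τ (e n) (e n) q.1.1 q.1.2 q.2.1 q.2.2‖ ≤ C * (wt q.2.1 * wt q.2.2) := by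
    intro n
    filter_upwards [hy] with q h
    exact hC _ _ _ _ _ _ (p n) (p n) h.1 h.2.1 h.2.2.1 h.2.2.2
  have hlim : ∀ᵐ q ∂(kap (m+3) a b c d), Filter.Tendsto (fun n => Kf t τ (e n) (e n) q.1.1 q.1.2 q.2.1 q.2.2) Filter.atTop (nhds (L q)) := by
    filter_upwards [hy] with q h
    exact Kf_lim ht hτ p l _ _ _ _ h.2.2.1 h.2.2.2
  have hLm : AEStronglyMeasurable L (kap (m+3) a b c d) := aestronglyMeasurable_of_tendsto_ae Filter.atTop (fun n => Kf_meas t τ (p n) a b c d) hlim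
  have hLi : Integrable L (kap (m+3) a b c d) := by
    refine hB.mono' hLm ?_
    filter_upwards [hlim, ae_all_iff.mpr hK] with q h1 h2
    exact le_of_tendsto h1.norm (Filter.Eventually.of_forall h2)
  have hT := tendsto_integral_of_dominated_convergence _ (fun n => Kf_meas t τ (p n) a b c d) hB hK hlim
  have hval : ∫ q, L q ∂(kap (m+3) a b c d) = (Real.pi)⁻¹ ^ (m+3) * ∫ r, rhoMod (m+3) t τ r.1 r.2 ∂((volume.restrict (Set.Ioc a b)).prod (volume.restrict (Set.Ioc c d))) := by
    unfold kap at hLi ⊢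
    rw [integral_prod _ hLi, ← MeasureTheory.integral_const_mul]
    refine integral_congr_ae ?_
    filter_upwards [hLi.prod_right_ae] with r hr
    rw [integral_prod _ hr]
    exact key_int m ht hτ r.1 r.2
  have := hT.const_mul (4 * Real.pi ^ (m+3))
  rw [hval] at this
  convert this using 2
  rw [inv_pow]
  field_simp

lemma Xm_cont' {N : ℕ} (x : ℝ) : Continuous fun M : Fin N → Fin N → ℝ => Xm M x := by
  unfold Xm
  have : Continuous fun M : Fin N → Fin N → ℝ => Matrix.of M := continuous_id
  exact this.sub continuous_const

lemma Sg_meas {N : ℕ} (ε x : ℝ) : Measurable (fun M : Fin N → Fin N → ℝ => Sg ε (Xm M x)) := by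
  unfold Sg
  have h1 := (Xm_cont' (N := N) x).matrix_det
  have h2 : Continuous fun p : (Fin N → Fin N → ℝ) × (Fin N → ℝ) => gg ε (Xm p.1 x *ᵥ p.2) :=
    (gg_cont ε).comp (((Xm_cont' (N := N) x).comp continuous_fst).matrix_mulVec continuous_snd)
  have h3 : StronglyMeasurable fun M : Fin N → Fin N → ℝ => ∫ u, gg ε (Xm M x *ᵥ u) ∂(gv (Fin N) 1) :=
    StronglyMeasurable.integral_prod_right' (f := fun p : (Fin N → Fin N → ℝ) × (Fin N → ℝ) => gg ε (Xm p.1 x *ᵥ p.2)) h2.stronglyMeasurable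
  exact measurable_const.mul (h1.measurable.mul h3.measurable)

lemma box (m : ℕ) {t τ : ℝ} (ht : 0 < t) (hτ : 0 < τ) {a b c d : ℝ} (hab : a ≤ b) (hcd : c ≤ d) :
    ∫ p, rs (Set.Ico a b) (Matrix.of p.1) * rs (Set.Ico c d) (Matrix.of (p.1 + p.2)) ∂((gm (m+3) t).prod (gm (m+3) τ)) =
    ∫ r, rhoMod (m+3) t τ r.1 r.2 ∂((volume.restrict (Set.Ioc a b)).prod (volume.restrict (Set.Ioc c d))) := by
  set e : ℕ → ℝ := fun n => 1 / ((n:ℝ) + 1) with he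
  have p : ∀ n, 0 < e n := fun n => by positivity
  have l : Filter.Tendsto e Filter.atTop (nhds 0) := tendsto_one_div_add_atTop_nhds_zero_nat
  have hA := kap_lim m ht hτ p l a b c d
  simp only [← E_reg t τ (p _) hab hcd] at hA
  have hm : ∀ n (x : ℝ), Measurable (fun M : Fin (m+3) → Fin (m+3) → ℝ => Sg (e n) (Xm M x)) := fun n x => Sg_meas _ _
  have hB : Filter.Tendsto (fun n => ∫ p, (Sg (e n) (Xm p.1 a) - Sg (e n) (Xm p.1 b)) * (Sg (e n) (Xm (p.1 + p.2) c) - Sg (e n) (Xm (p.1 + p.2) d)) ∂((gm (m+3) t).prod (gm (m+3) τ)))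
     Filter.atTop (nhds (∫ p, 4 * (rs (Set.Ico a b) (Matrix.of p.1) * rs (Set.Ico c d) (Matrix.of (p.1 + p.2))) ∂((gm (m+3) t).prod (gm (m+3) τ)))) := by
    refine tendsto_integral_of_dominated_convergence (fun _ => 4) (fun n => ?_) (integrable_const _) (fun n => ?_) ?_
    · exact ((((hm n a).comp measurable_fst).sub ((hm n b).comp measurable_fst)).mul (((hm n c).comp (measurable_fst.add measurable_snd)).sub ((hm n d).comp (measurable_fst.add measurable_snd)))).aestronglyMeasurable
    · refine Filter.Eventually.of_forall fun q => ?_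
      have h1 := Sg_le (p n) (Xm q.1 a)
      have h2 := Sg_le (p n) (Xm q.1 b)
      have h3 := Sg_le (p n) (Xm (q.1+q.2) c)
      have h4 := Sg_le (p n) (Xm (q.1+q.2) d)
      rw [norm_mul]
      have h5 := (norm_sub_le (Sg (e n) (Xm q.1 a)) (Sg (e n) (Xm q.1 b)))
      have h6 := (norm_sub_le (Sg (e n) (Xm (q.1+q.2) c)) (Sg (e n) (Xm (q.1+q.2) d)))
      simp only [Real.norm_eq_abs] at *
      nlinarith [abs_nonneg (Sg (e n) (Xm q.1 a) - Sg (e n) (Xm q.1 b)), abs_nonneg (Sg (e n) (Xm (q.1+q.2) c) - Sg (e n) (Xm (q.1+q.2) d))]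
    · filter_upwards [ae_fst (τ := τ) ht (ae_det_ne (N := m+3) a), ae_fst (τ := τ) ht (ae_det_ne (N := m+3) b), ae_add ht hτ (ae_det_ne (N := m+3) c), ae_add ht hτ (ae_det_ne (N := m+3) d),
        ae_fst (τ := τ) ht (ae_nodup (N := m+3)), ae_add ht hτ (ae_nodup (N := m+3))] with q h1 h2 h3 h4 h5 h6
      rw [rs_Ico _ h5 a b hab, rs_Ico _ h6 c d hcd, spin_eq _ _ h1, spin_eq _ _ h2, spin_eq _ _ h3, spin_eq _ _ h4]
      have := ((Sg_lim p l _ h1).sub (Sg_lim p l _ h2)).mul ((Sg_lim p l _ h3).sub (Sg_lim p l _ h4))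
      convert this using 2
      · rfl
      · ring
  have := tendsto_nhds_unique hA hB
  rw [MeasureTheory.integral_const_mul] at this
  linarith

end MDR

open MeasureTheory Matrix Nat intervalIntegral
open scoped Classical

namespace MDR
open ProbabilityTheory

lemma Epoly_bd (n : ℕ) {t S u : ℝ} (ht : 0 < t) (hS : 1 ≤ S) (hu : |u| ≤ S / t) : |Epoly n u| ≤ Epoly n (1/t) * S ^ n := by
  unfold Epoly
  rw [abs_mul, Nat.abs_cast, mul_assoc, Finset.sum_mul]
  gcongr
  refine (Finset.abs_sum_le_sum_abs _ _).trans (Finset.sum_le_sum fun k hk => ?_)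
  have hk' : k ≤ n := by have := Finset.mem_range.mp hk; omega
  rw [abs_div, Nat.abs_cast, abs_pow, div_mul_eq_mul_div]
  gcongr
  calc |u| ^ k ≤ (S / t) ^ k := by gcongr
    _ = (1 / t) ^ k * S ^ k := by rw [← mul_pow]; congr 1; ring
    _ ≤ (1/t)^k * S ^ n := by gcongr

lemma Epoly_nn (n : ℕ) {u : ℝ} (hu : 0 ≤ u) : 0 ≤ Epoly n u := by
  unfold Epoly; positivity

lemma pow_exp_bd (k : ℕ) {c S : ℝ} (hc : 0 < c) (hS : 0 ≤ S) : S ^ k ≤ ((k+1:ℝ) / c) ^ k * Real.exp (c * S) := by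
  have h1 : S ≤ ((k+1:ℝ)/c) * Real.exp (c * S / (k+1)) := by
    have := Real.add_one_le_exp (c * S / (k+1))
    have h2 : c * S / (k+1) ≤ Real.exp (c * S / (k+1)) := by linarith
    calc S = ((k+1:ℝ)/c) * (c * S / (k+1)) := by field_simp
      _ ≤ _ := by gcongr
  calc S ^ k ≤ (((k+1:ℝ)/c) * Real.exp (c * S / (k+1))) ^ k := by gcongr
    _ = ((k+1:ℝ)/c) ^ k * Real.exp (k * (c * S / (k+1))) := by rw [mul_pow, ← Real.exp_nat_mul]
    _ ≤ _ := by
      refine mul_le_mul_of_nonneg_left (Real.exp_le_exp.mpr ?_) (by positivity)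
      rw [mul_div_assoc', div_le_iff₀ (by positivity)]
      nlinarith [mul_nonneg hc.le hS]

lemma quad_bd {δ T c D x y z : ℝ} (hδ : 0 < δ) (hT : 0 < T) (hc : c = (δ / 2) / (1 + δ / 2) / T) (hD : 0 < D) (hDT : D ≤ T) (hz : z^2 ≤ 1) :
    -(x ^ 2 - 2 * z ^ 2 * x * y + y ^ 2 * (1 + δ)) / D ≤ -(c * (x^2+y^2)) := by
  have hc0 : 0 < c := by rw [hc]; positivity
  rw [neg_div, neg_le_neg_iff, le_div_iff₀ hD]
  obtain ⟨c1, hc1d⟩ : ∃ c1, c1 = (δ / 2) / (1 + δ / 2) := ⟨_, rfl⟩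
  have hc1 : c * D ≤ c1 := by
    calc c * D ≤ c * T := by gcongr
      _ = _ := by rw [hc, hc1d]; field_simp
  have hc2 : c1 * (1 + δ/2) = δ / 2 := by rw [hc1d]; field_simp
  have hc3 : 0 < c1 := by rw [hc1d]; positivity
  have hc4 : (1 - c1) * (1 + δ/2) = 1 := by linarith
  have h6 : c1 ≤ δ / 2 := by nlinarith
  have h8 : 2 * z^2 * x * y ≤ 2 * |x| * |y| := by
    have h : x * y ≤ |x| * |y| := by rw [← abs_mul]; exact le_abs_self _
    have h9 : 0 ≤ |x| * |y| := by positivity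
    have h10 : z^2 * (x*y) ≤ z^2 * (|x| * |y|) := by gcongr
    have h11 : z^2 * (|x| * |y|) ≤ 1 * (|x| * |y|) := by gcongr
    linarith
  have h9 : 0 ≤ (1 + δ/2) * ((1 - c1) * |x| - |y|)^2 := by positivity
  have h10 : (1 + δ/2) * ((1 - c1) * |x| - |y|)^2 = (1 - c1) * x^2 - 2 * |x| * |y| + (1 + δ/2) * y^2 := by
    have : (1 + δ/2) * ((1 - c1) * |x| - |y|)^2 = ((1 - c1) * (1 + δ/2)) * ((1 - c1) * |x|^2 - 2 * |x| * |y|) + (1 + δ/2) * |y|^2 := by ring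
    rw [this, hc4, sq_abs, sq_abs]; ring
  have h11 : c * D * (x^2+y^2) ≤ c1 * (x^2+y^2) := by gcongr
  have h12 : c1 * y^2 ≤ δ/2 * y^2 := by gcongr
  linarith

lemma br_bd (m : ℕ) {S K t e1 e2 a b p1 p2 u E1 E2 : ℝ} (ht : 0 < t) (hS : 1 ≤ S) (hK : 0 ≤ K) (he1 : 0 ≤ e1) (he2 : 0 ≤ e2)
    (f1 : |a| ≤ S * (1+K)) (f2 : |b| ≤ S * (1+K)) (g1 : |p1| ≤ (m+2)*t) (g2 : |p2| ≤ (m+1)*t) (hu : |u| ≤ S / t)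
    (hE1 : |E1| ≤ e1 * S^(m+1)) (hE2 : |E2| ≤ e2 * S^m) :
    |a * b * E1 + p1 * E1 - p2 * u * E2| ≤ ((1+K)*(1+K)*e1 + (m+2)*t*e1 + (m+1)*e2) * S ^ (m+3) := by
  have hS0 : 0 < S := by linarith
  have h1 : |a * b * E1| ≤ (S * (1+K)) * (S * (1+K)) * (e1 * S ^ (m+1)) := by
    rw [abs_mul, abs_mul]; gcongr
  have h2 : |p1 * E1| ≤ (m+2)*t * (e1 * S ^ (m+1)) := by
    rw [abs_mul]; gcongr
  have h3 : |p2 * u * E2| ≤ (m+1)*t * (S / t) * (e2 * S ^ m) := by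
    rw [abs_mul, abs_mul]; gcongr
  have h4 := abs_sub (a * b * E1 + p1 * E1) (p2 * u * E2)
  have h5 := abs_add_le (a * b * E1) (p1 * E1)
  have h6 : S ^ (m+1) ≤ S ^ (m+3) := pow_le_pow_right₀ hS (by omega)
  calc _ ≤ (S * (1+K)) * (S * (1+K)) * (e1 * S ^ (m+1)) + (m+2)*t * (e1 * S ^ (m+1)) + (m+1)*t * (S / t) * (e2 * S ^ m) := by linarith
    _ = (1+K)*(1+K)*e1 * S^(m+3) + (m+2)*t*e1 * S ^ (m+1) + (m+1)*e2 * S ^ (m+1) := by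
        have : (m+1)*t * (S / t) * (e2 * S ^ m) = (m+1)*e2*S^(m+1) := by field_simp; try ring
        rw [this]; ring
    _ ≤ (1+K)*(1+K)*e1 * S^(m+3) + (m+2)*t*e1 * S ^ (m+3) + (m+1)*e2 * S ^ (m+3) := by gcongr
    _ = _ := by ring

lemma fac_bd {S K x y k : ℝ} (hx : |x| ≤ S) (hy : |y| ≤ S) (hk : |k| ≤ K) : |x - y * k| ≤ S * (1 + K) := by
  have h0 := abs_sub x (y*k)
  rw [abs_mul] at h0
  have : |y| * |k| ≤ S * K := mul_le_mul hy hk (abs_nonneg _) ((abs_nonneg _).trans hy)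
  linarith

lemma p_bd {n t τ D z : ℝ} (hn : 0 ≤ n) (ht : 0 < t) (hτ : 0 < τ) (hD : τ ≤ D) (hz : z^2 ≤ 1) : |n * t * τ * z ^ 2 / (2 * D)| ≤ n * t := by
  have hD0 : 0 < D := by linarith
  have g0 : τ * z^2 / (2 * D) ≤ 1 := by
    rw [div_le_one (by positivity)]
    nlinarith
  rw [abs_of_nonneg (by positivity)]
  calc n * t * τ * z^2 / (2 * D) = n * t * (τ * z^2 / (2*D)) := by ring
    _ ≤ n * t * 1 := by gcongr
    _ = _ := by ring

lemma Jf_bd (m : ℕ) {t τ : ℝ} (ht : 0 < t) (hτ : 0 < τ) : ∃ C c : ℝ, 0 < c ∧ ∀ y x z, z ^ 2 ≤ 1 →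
    |Jf (m+3) t τ y x z| ≤ C * ((1 + x^2 + y^2) ^ (m+3) * Real.exp (-(c * (x^2 + y^2)))) := by
  refine ⟨(τ/t) ^ (-((m+3:ℕ):ℝ)/2) * ((1+(t + τ) / τ)*(1+(t + τ) / τ)*Epoly (m+1) (1/t) + (m+2)*t*Epoly (m+1) (1/t) + (m+1)*Epoly m (1/t)), ((τ/t) / 2) / (1 + (τ/t) / 2) / (t + τ), by positivity, ?_⟩
  intro y x z hz
  have hS1 : 1 ≤ 1 + x^2 + y^2 := by nlinarith [sq_nonneg x, sq_nonneg y]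
  have hx : |x| ≤ 1 + x^2 + y^2 := by rw [abs_le]; constructor <;> nlinarith [sq_nonneg (x-1), sq_nonneg (x+1), sq_nonneg y]
  have hy : |y| ≤ 1 + x^2 + y^2 := by rw [abs_le]; constructor <;> nlinarith [sq_nonneg (y-1), sq_nonneg (y+1), sq_nonneg x]
  have hu : |2 * x * y / t| ≤ (1 + x^2 + y^2) / t := by
    rw [abs_div, abs_of_pos ht]
    gcongr
    rw [abs_le]; constructor <;> nlinarith [sq_nonneg (x-y), sq_nonneg (x+y)]
  have hq0 : 0 ≤ 1 - z^2 := by linarith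
  have hq1 : 1 - z^2 ≤ 1 := by nlinarith [sq_nonneg z]
  have hDτ : τ ≤ τ + t * (1 - z^2) := by nlinarith
  have hD0 : 0 < τ + t * (1 - z^2) := by linarith
  have hDt : τ + t * (1 - z^2) ≤ t + τ := by nlinarith
  have b1 : (τ / t + (1 - z^2)) ^ (-((m+3:ℕ):ℝ)/2) ≤ (τ/t) ^ (-((m+3:ℕ):ℝ)/2) :=
    Real.rpow_le_rpow_of_nonpos (by positivity) (by linarith) (by rw [neg_div]; exact neg_nonpos.mpr (by positivity))
  have b3 := Real.exp_le_exp.mpr (quad_bd (δ := τ/t) (T := t + τ) (x := x) (y := y) (by positivity) (by positivity) rfl hD0 hDt hz)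
  have k1 : |(1 - z^2) * (t+τ) / (τ + t * (1 - z^2))| ≤ (t + τ)/τ := by
    rw [abs_of_nonneg (by positivity)]
    apply div_le_div₀ (by positivity) _ hτ hDτ
    nlinarith
  have k2 : |(1 - z^2) * t / (τ + t * (1 - z^2))| ≤ (t + τ)/τ := by
    rw [abs_of_nonneg (by positivity)]
    apply div_le_div₀ (by positivity) _ hτ hDτ
    nlinarith
  have f1 : |x - y * (1 - z^2) * (t + τ) / (τ + t * (1 - z^2))| ≤ (1 + x^2 + y^2) * (1 + (t+τ)/τ) := by
    have : x - y * (1 - z^2) * (t + τ) / (τ + t * (1 - z^2)) = x - y * ((1 - z^2) * (t+τ) / (τ + t * (1 - z^2))) := by ring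
    rw [this]; exact fac_bd hx hy k1
  have f2 : |y - x * (1 - z^2) * t / (τ + t * (1 - z^2))| ≤ (1 + x^2 + y^2) * (1 + (t+τ)/τ) := by
    have : y - x * (1 - z^2) * t / (τ + t * (1 - z^2)) = y - x * ((1 - z^2) * t / (τ + t * (1 - z^2))) := by ring
    rw [this]; exact fac_bd hy hx k2
  have hcast1 : (((m+3:ℕ):ℝ) - 1) = m + 2 := by push_cast; ring
  have hcast2 : (((m+3:ℕ):ℝ) - 2) = m + 1 := by push_cast; ring
  have hbr := br_bd m ht hS1 (K := (t+τ)/τ) (by positivity) (Epoly_nn (m+1) (u := 1/t) (by positivity)) (Epoly_nn m (u := 1/t) (by positivity)) f1 f2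
    (p_bd (n := (m:ℝ)+2) (by positivity) ht hτ hDτ hz) (p_bd (n := (m:ℝ)+1) (by positivity) ht hτ hDτ hz) hu (Epoly_bd (m+1) ht hS1 hu) (Epoly_bd m ht hS1 hu)
  rw [← hcast1, ← hcast2] at hbr
  unfold Jf
  rw [abs_mul, abs_mul, abs_of_nonneg (Real.rpow_nonneg (by positivity) _), abs_of_pos (Real.exp_pos _)]
  rw [← hcast1, ← hcast2]
  refine (mul_le_mul (mul_le_mul b1 b3 (Real.exp_pos _).le (by positivity)) hbr (abs_nonneg _) (by positivity)).trans (le_of_eq ?_)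
  ring

lemma rho_intble (m : ℕ) {t τ : ℝ} (ht : 0 < t) (hτ : 0 < τ) : Integrable (fun p : ℝ × ℝ => rhoMod (m+3) t τ p.1 p.2) (volume.prod volume) := by
  obtain ⟨C, c, hc, h⟩ := Jf_bd m ht hτ
  have hC : 0 ≤ C := by
    have := (abs_nonneg _).trans (h 0 0 0 (by norm_num))
    simpa using this
  set A := |2 * sphereArea (m+2) * sphereArea (m+1) / (t ^ 2 * (2 * Real.pi) ^ (m+3))| with hA
  set B := (((m+3:ℕ)+1:ℝ) / (c/2)) ^ (m+3) with hB
  have g0 : Integrable (fun x : ℝ => Real.exp (-(c/2)*x^2)) volume := integrable_exp_neg_mul_sq (by positivity)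
  have g1 := (Integrable.mul_prod g0 g0).const_mul (A * (C * (B * Real.exp (c/2))))
  refine g1.mono' (rho_cont m ht hτ).aestronglyMeasurable (Filter.Eventually.of_forall fun p => ?_)
  obtain ⟨y, x⟩ := p
  rw [rhoMod_eq, norm_mul, Real.norm_eq_abs, ← hA, mul_assoc A]
  simp only
  gcongr
  have hS := pow_exp_bd (m+3) (c := c/2) (S := 1+x^2+y^2) (by positivity) (by positivity)
  have key : ∀ z ∈ Set.uIoc (0:ℝ) 1, ‖(1 - z ^ 2) ^ ((m:ℝ) / 2) * Jt (m+3) t τ y x z‖ ≤ C * (B * Real.exp (c/2)) * (Real.exp (-(c/2)*y^2) * Real.exp (-(c/2)*x^2)) := by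
    intro z hz
    rw [Set.uIoc_of_le zero_le_one] at hz
    have hz2 : z ^ 2 ≤ 1 := by nlinarith [hz.1, hz.2]
    rw [Jt_eq _ _ _ _ _ (by linarith [hz.1]) hz.2, norm_mul, Real.norm_eq_abs, Real.norm_eq_abs, abs_of_nonneg (Real.rpow_nonneg (by linarith) _)]
    have h1 : (1 - z ^ 2) ^ ((m:ℝ) / 2) ≤ 1 := Real.rpow_le_one (by linarith) (by nlinarith) (by positivity)
    calc _ ≤ 1 * (C * ((1 + x^2 + y^2) ^ (m+3) * Real.exp (-(c * (x^2 + y^2))))) := by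
          gcongr
          exact h y x z hz2
      _ ≤ 1 * (C * ((B * Real.exp (c/2 * (1+x^2+y^2))) * Real.exp (-(c * (x^2 + y^2))))) := by gcongr
      _ = _ := by
        have : Real.exp (c/2 * (1+x^2+y^2)) * Real.exp (-(c * (x^2 + y^2))) = Real.exp (c/2) * (Real.exp (-(c/2)*y^2) * Real.exp (-(c/2)*x^2)) := by
          simp only [← Real.exp_add]; congr 1; ring
        rw [mul_assoc B, this]; ring
  have := intervalIntegral.norm_integral_le_of_norm_le_const key
  simpa using this

end MDR

open MeasureTheory Matrix Nat intervalIntegral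
open scoped Classical

namespace MDR
open ProbabilityTheory

lemma borel_ind (P : Set ℝ → Prop) (hI : ∀ a b, a ≤ b → P (Set.Ico a b))
    (hU : ∀ (ι : Type) [Countable ι] (f : ι → Set ℝ), Pairwise (Function.onFun Disjoint f) → (∀ i, MeasurableSet (f i)) → (∀ i, P (f i)) → P (⋃ i, f i))
    (hD : ∀ A, MeasurableSet A → P Set.univ → P A → P Aᶜ) : ∀ A, MeasurableSet A → P A := by
  have huniv : P Set.univ := by
    have h := hU ℤ (fun n : ℤ => Set.Ico (n:ℝ) (n+1)) (Set.pairwise_disjoint_Ico_intCast ℝ) (fun n => measurableSet_Ico) (fun n => hI _ _ (by linarith))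
    rwa [iUnion_Ico_intCast ℝ] at h
  intro A hA
  refine MeasurableSpace.induction_on_inter (m := borel ℝ) (C := fun A _ => P A) (borel_eq_generateFrom_Ico ℝ) (isPiSystem_Ico id id) ?_ ?_ ?_ ?_ A (by rw [← BorelSpace.measurable_eq (α := ℝ)]; exact hA)
  · have := hI 0 0 le_rfl
    rwa [Set.Ico_self] at this
  · rintro t ht
    obtain ⟨a, b, h, rfl⟩ := ht
    exact hI _ _ h.le
  · intro t ht h
    exact hD t (by rw [BorelSpace.measurable_eq (α := ℝ)]; exact ht) huniv h
  · intro f hd hm h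
    exact hU ℕ f hd (fun i => by rw [BorelSpace.measurable_eq (α := ℝ)]; exact hm i) h

lemma ms_hasSum {ι : Type} (R : Multiset ℝ) (g : ℝ → ℝ) (f : ι → Set ℝ) (hd : Pairwise (Function.onFun Disjoint f)) :
    HasSum (fun i => (Multiset.map g (Multiset.filter (fun l => l ∈ f i) R)).sum) (Multiset.map g (Multiset.filter (fun l => l ∈ ⋃ i, f i) R)).sum := by
  induction R using Multiset.induction_on with
  | empty => simp
  | cons a R ih =>
    have h : HasSum (fun i => if a ∈ f i then g a else 0) (if a ∈ ⋃ i, f i then g a else 0) := by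
      by_cases ha : a ∈ ⋃ i, f i
      · rw [if_pos ha]
        obtain ⟨i, hi⟩ := Set.mem_iUnion.mp ha
        have := hasSum_single (f := fun i => if a ∈ f i then g a else 0) i (fun j hj => if_neg fun hh => Set.disjoint_left.mp (hd hj) hh hi)
        simpa [hi] using this
      · rw [if_neg ha]
        have : (fun i => if a ∈ f i then g a else 0) = fun _ => 0 := by
          funext i
          exact if_neg fun hh => ha (Set.mem_iUnion.mpr ⟨i, hh⟩)
        rw [this]; exact hasSum_zero
    have h2 : ∀ s : Set ℝ, (Multiset.map g (Multiset.filter (fun l => l ∈ s) (a ::ₘ R))).sum = (if a ∈ s then g a else 0) + (Multiset.map g (Multiset.filter (fun l => l ∈ s) R)).sum := by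
      intro s
      by_cases hs : a ∈ s
      · rw [Multiset.filter_cons_of_pos _ hs, Multiset.map_cons, Multiset.sum_cons, if_pos hs]
      · rw [Multiset.filter_cons_of_neg _ hs, if_neg hs, zero_add]
    simp only [h2]
    exact h.add ih

lemma ms_bd (R : Multiset ℝ) (g : ℝ → ℝ) (hg : ∀ x, |g x| ≤ 1) (s : Set ℝ) : |(Multiset.map g (Multiset.filter (fun l => l ∈ s) R)).sum| ≤ Multiset.card R := by
  induction R using Multiset.induction_on with
  | empty => simp
  | cons a R ih =>
    rw [Multiset.card_cons]
    push_cast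
    by_cases hs : a ∈ s
    · rw [Multiset.filter_cons_of_pos _ hs, Multiset.map_cons, Multiset.sum_cons]
      have := abs_add_le (g a) (Multiset.map g (Multiset.filter (fun l => l ∈ s) R)).sum
      linarith [hg a]
    · rw [Multiset.filter_cons_of_neg _ hs]; linarith

lemma rs_bd {N : ℕ} (A : Set ℝ) (M : Matrix (Fin N) (Fin N) ℝ) : |rs A M| ≤ N := by
  unfold rs
  refine (ms_bd _ _ (fun x => ?_) A).trans ?_
  · unfold spin; rw [abs_pow, abs_neg, abs_one, one_pow]
  · have := M.charpoly.card_roots'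
    rw [Matrix.charpoly_natDegree_eq_dim, Fintype.card_fin] at this
    exact_mod_cast this

lemma rs_hasSum {ι : Type} {N : ℕ} (f : ι → Set ℝ) (hd : Pairwise (Function.onFun Disjoint f)) (M : Matrix (Fin N) (Fin N) ℝ) :
    HasSum (fun i => rs (f i) M) (rs (⋃ i, f i) M) := ms_hasSum _ _ f hd

lemma rs_compl {N : ℕ} (A : Set ℝ) (M : Matrix (Fin N) (Fin N) ℝ) : rs Aᶜ M = rs Set.univ M - rs A M := by
  have h1 := rs_hasSum (fun b : Bool => cond b A Aᶜ) (pairwise_disjoint_on_bool.mpr disjoint_compl_right) M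
  have h2 := h1.unique (hasSum_fintype _)
  rw [← Set.union_eq_iUnion, Set.union_compl_self] at h2
  simp at h2
  linarith

lemma rs_univ_le {ι : Type} {N : ℕ} (f : ι → Set ℝ) (hd : Pairwise (Function.onFun Disjoint f)) (s : Finset ι) (M : Matrix (Fin N) (Fin N) ℝ) :
    |∑ i ∈ s, rs (f i) M| ≤ N := by
  have h1 := rs_hasSum (fun i : s => f i) (fun i j hij => hd (fun h => hij (Subtype.ext h))) M
  have h2 := h1.unique (hasSum_fintype _)
  rw [Finset.sum_coe_sort s (fun i => rs (f i) M)] at h2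
  rw [← h2]; exact rs_bd _ _

lemma rs_meas {N : ℕ} : ∀ A, MeasurableSet A → AEStronglyMeasurable (fun M : Fin N → Fin N → ℝ => rs A (Matrix.of M)) volume := by
  apply borel_ind
  · intro a b hab
    have hc : ∀ x : ℝ, Measurable fun M : Fin N → Fin N → ℝ => ((SignType.sign (Matrix.of M - Matrix.scalar (Fin N) x).det : SignType) : ℝ) := by
      intro x
      have h1 : Measurable fun M : Fin N → Fin N → ℝ => (Matrix.of M - Matrix.scalar (Fin N) x).det := ((Xm_cont' (N := N) x).matrix_det).measurable
      have h2 : Measurable fun u : ℝ => ((SignType.sign u : SignType) : ℝ) := by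
        have : (fun u : ℝ => ((SignType.sign u : SignType) : ℝ)) = fun u => if 0 < u then 1 else if u < 0 then -1 else 0 := by
          funext u
          rw [sign_apply]
          split_ifs <;> simp
        rw [this]
        exact Measurable.ite measurableSet_Ioi measurable_const (Measurable.ite measurableSet_Iio measurable_const measurable_const)
      exact h2.comp h1
    refine AEStronglyMeasurable.congr (((hc a).sub (hc b)).div_const 2).aestronglyMeasurable ?_
    filter_upwards [ae_det_ne (N := N) a, ae_det_ne (N := N) b, ae_nodup (N := N)] with M h1 h2 h3
    rw [rs_Ico _ h3 a b hab, spin_eq _ _ h1, spin_eq _ _ h2]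
    rfl
  · intro ι _ f hd hm h
    refine aestronglyMeasurable_of_tendsto_ae (u := Filter.atTop) (f := fun (s : Finset ι) (M : Fin N → Fin N → ℝ) => ∑ i ∈ s, rs (f i) (Matrix.of M)) ?_ ?_
    · intro s
      exact Finset.aestronglyMeasurable_fun_sum s (fun i _ => h i)
    · exact Filter.Eventually.of_forall fun M => rs_hasSum f hd (Matrix.of M)
  · intro A hA h1 h2
    simp only [rs_compl A]
    exact h1.sub h2

lemma ext_step {Ω : Type*} [MeasurableSpace Ω] (μ : Measure Ω) [IsFiniteMeasure μ] {N : ℕ} (T : Ω → Matrix (Fin N) (Fin N) ℝ) (X : Ω → ℝ) (C : ℝ)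
    (hX : AEStronglyMeasurable X μ) (hXC : ∀ ω, |X ω| ≤ C) (hT : ∀ A, MeasurableSet A → AEStronglyMeasurable (fun ω => rs A (T ω)) μ)
    (k : ℝ → ℝ) (hk : Integrable k volume) (hI : ∀ a b, a ≤ b → ∫ ω, rs (Set.Ico a b) (T ω) * X ω ∂μ = ∫ y in Set.Ico a b, k y) :
    ∀ A, MeasurableSet A → ∫ ω, rs A (T ω) * X ω ∂μ = ∫ y in A, k y := by
  have hint : ∀ A, MeasurableSet A → Integrable (fun ω => rs A (T ω) * X ω) μ := by
    intro A hA
    refine Integrable.of_bound ((hT A hA).mul hX) (N * C) (Filter.Eventually.of_forall fun ω => ?_)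
    rw [norm_mul, Real.norm_eq_abs, Real.norm_eq_abs]
    exact mul_le_mul (rs_bd _ _) (hXC ω) (abs_nonneg _) (Nat.cast_nonneg _)
  refine borel_ind (fun A => ∫ ω, rs A (T ω) * X ω ∂μ = ∫ y in A, k y) hI ?_ ?_
  · intro ι _ f hd hm h
    have h1 : HasSum (fun i => ∫ y in f i, k y) (∫ y in ⋃ i, f i, k y) := hasSum_integral_iUnion hm hd hk.integrableOn
    simp only [← h] at h1
    refine HasSum.unique ?_ h1
    unfold HasSum
    have h2 : ∀ s : Finset ι, ∑ i ∈ s, ∫ ω, rs (f i) (T ω) * X ω ∂μ = ∫ ω, (∑ i ∈ s, rs (f i) (T ω)) * X ω ∂μ := by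
      intro s
      rw [← MeasureTheory.integral_finsetSum s (fun i _ => hint _ (hm i))]
      simp only [Finset.sum_mul]
    simp only [h2]
    refine tendsto_integral_filter_of_dominated_convergence (fun _ => N * C) ?_ ?_ (integrable_const _) ?_
    · exact Filter.Eventually.of_forall fun s => (Finset.aestronglyMeasurable_fun_sum s (fun i _ => hT _ (hm i))).mul hX
    · refine Filter.Eventually.of_forall fun s => Filter.Eventually.of_forall fun ω => ?_
      rw [norm_mul, Real.norm_eq_abs, Real.norm_eq_abs]
      exact mul_le_mul (rs_univ_le f hd s _) (hXC ω) (abs_nonneg _) (Nat.cast_nonneg _)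
    · exact Filter.Eventually.of_forall fun ω => (rs_hasSum f hd (T ω)).mul_const _
  · intro A hA h1 h2
    simp only [rs_compl A, sub_mul]
    rw [integral_sub (hint _ MeasurableSet.univ) (hint _ hA), h1, h2, setIntegral_univ, setIntegral_compl hA hk]

lemma main_prod (m : ℕ) {t τ : ℝ} (ht : 0 < t) (hτ : 0 < τ) (A B : Set ℝ) (hA : MeasurableSet A) (hB : MeasurableSet B) :
    Integrable (fun p : (Fin (m+3) → Fin (m+3) → ℝ) × (Fin (m+3) → Fin (m+3) → ℝ) => rs A (Matrix.of p.1) * rs B (Matrix.of (p.1 + p.2))) ((gm (m+3) t).prod (gm (m+3) τ)) ∧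
    ∫ p, rs A (Matrix.of p.1) * rs B (Matrix.of (p.1 + p.2)) ∂((gm (m+3) t).prod (gm (m+3) τ)) = ∫ y in A, ∫ x in B, rhoMod (m+3) t τ y x := by
  have hm1 : ∀ A, MeasurableSet A → AEStronglyMeasurable (fun p : (Fin (m+3) → Fin (m+3) → ℝ) × (Fin (m+3) → Fin (m+3) → ℝ) => rs A (Matrix.of p.1)) ((gm (m+3) t).prod (gm (m+3) τ)) := by
    intro A hA
    obtain ⟨g, hg, hg'⟩ := rs_meas (N := m+3) A hA
    exact ⟨fun p => g p.1, hg.comp_measurable measurable_fst, ae_fst ht hg'⟩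
  have hm2 : ∀ A, MeasurableSet A → AEStronglyMeasurable (fun p : (Fin (m+3) → Fin (m+3) → ℝ) × (Fin (m+3) → Fin (m+3) → ℝ) => rs A (Matrix.of (p.1 + p.2))) ((gm (m+3) t).prod (gm (m+3) τ)) := by
    intro A hA
    obtain ⟨g, hg, hg'⟩ := rs_meas (N := m+3) A hA
    exact ⟨fun p => g (p.1 + p.2), hg.comp_measurable (measurable_fst.add measurable_snd), ae_add ht hτ hg'⟩
  have hr := rho_intble m ht hτ
  have hrAB : ∀ A B : Set ℝ, Integrable (fun p : ℝ × ℝ => rhoMod (m+3) t τ p.1 p.2) ((volume.restrict A).prod (volume.restrict B)) := by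
    intro A B
    rw [Measure.prod_restrict]
    exact hr.restrict
  have hrA : ∀ B : Set ℝ, Integrable (fun p : ℝ × ℝ => rhoMod (m+3) t τ p.1 p.2) (volume.prod (volume.restrict B)) := by
    intro B
    have := hrAB Set.univ B
    rwa [Measure.restrict_univ] at this
  have hrB : ∀ A : Set ℝ, Integrable (fun p : ℝ × ℝ => rhoMod (m+3) t τ p.1 p.2) ((volume.restrict A).prod volume) := by
    intro A
    have := hrAB A Set.univ
    rwa [Measure.restrict_univ] at this
  have s1 : ∀ c d, c ≤ d → ∀ A, MeasurableSet A → ∫ p, rs A (Matrix.of p.1) * rs (Set.Ico c d) (Matrix.of (p.1 + p.2)) ∂((gm (m+3) t).prod (gm (m+3) τ)) = ∫ y in A, ∫ x in Set.Ico c d, rhoMod (m+3) t τ y x := by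
    intro c d hcd
    refine ext_step ((gm (m+3) t).prod (gm (m+3) τ)) (fun p => Matrix.of p.1) (fun p => rs (Set.Ico c d) (Matrix.of (p.1 + p.2))) ((m+3:ℕ):ℝ) (hm2 _ measurableSet_Ico) (fun ω => rs_bd _ _) hm1 (fun y => ∫ x in Set.Ico c d, rhoMod (m+3) t τ y x) (hrA _).integral_prod_left ?_
    intro a b hab
    rw [box m ht hτ hab hcd, ← Measure.restrict_congr_set Ico_ae_eq_Ioc, ← Measure.restrict_congr_set Ico_ae_eq_Ioc, integral_prod _ (hrAB _ _)]
  refine ⟨Integrable.of_bound ((hm1 A hA).mul (hm2 B hB)) (((m+3:ℕ):ℝ) * ((m+3:ℕ):ℝ)) (Filter.Eventually.of_forall fun ω => ?_), ?_⟩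
  · rw [norm_mul, Real.norm_eq_abs, Real.norm_eq_abs]
    exact mul_le_mul (rs_bd _ _) (rs_bd _ _) (abs_nonneg _) (Nat.cast_nonneg _)
  have s2 := ext_step ((gm (m+3) t).prod (gm (m+3) τ)) (fun p => Matrix.of (p.1 + p.2)) (fun p => rs A (Matrix.of p.1)) ((m+3:ℕ):ℝ) (hm1 A hA) (fun ω => rs_bd _ _) hm2
    (fun x => ∫ y in A, rhoMod (m+3) t τ y x) (hrB A).integral_prod_right ?_ B hB
  · simp only [mul_comm (rs A _)]
    rw [s2]
    exact (integral_integral_swap (f := fun y x => rhoMod (m+3) t τ y x) (hrAB A B)).symm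
  · intro c d hcd
    simp only [mul_comm _ (rs A _)]
    rw [s1 c d hcd A hA]
    exact integral_integral_swap (f := fun y x => rhoMod (m+3) t τ y x) (hrAB A _)

end MDR

/-- The exact finite-`N` representation of the two-time modified density of real eigenvalues:
for Borel sets `A, B ⊆ ℝ`, the expectation over the Ginibre evolution of
`(Σ_{λ∈R(H), λ∈A} s_λ(H))·(Σ_{μ∈R(H+D), μ∈B} s_μ(H+D))` equals `∫_A ∫_B ρ̃^{(N)}_{t,t+τ}(y,x)`. -/
theorem modified_density_representation (N : ℕ) (hN : 3 ≤ N) (t τ : ℝ)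
    (ht : 0 < t) (hτ : 0 < τ) (A B : Set ℝ) (hA : MeasurableSet A) (hB : MeasurableSet B) :
    (∫ H, ∫ D,
        (Multiset.map (fun l => spin l H)
          (Multiset.filter (fun l => l ∈ A) H.charpoly.roots)).sum *
        (Multiset.map (fun m => spin m (H + D))
          (Multiset.filter (fun m => m ∈ B) (H + D).charpoly.roots)).sum
        ∂(ginibre N τ) ∂(ginibre N t)) =
      ∫ y in A, ∫ x in B, rhoMod N t τ y x := by
  obtain ⟨m, rfl⟩ : ∃ m, N = m + 3 := ⟨N - 3, by omega⟩
  obtain ⟨h1, h2⟩ := MDR.main_prod m ht hτ A B hA hB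
  rw [← h2, integral_prod _ h1]
  rfl
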